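/- Let T ∈ ℝ and let g be a smooth time-dependent metric on ℝ^n with n = 3 over the interval (−∞, T) solving the Ricci flow, such that g(t) is complete for every t ∈ (−∞, T) (an ancient solution). Then g has nonnegative sectional curvature everywhere: for every (x,t) ∈ ℝ³ × (−∞,T) and every pair of linearly independent u, v ∈ ℝ³, sec(u,v) ≥ 0 at (x,t). -/

import Mathlib

open Set MeasureTheory
open scoped BigOperators Matrix

noncomputable section

variable {n : ℕ}

/-- Partial derivative of `f` at `x` in the `i`-th coordinate direction. -/
def pd (f : (Fin n → ℝ) → ℝ) (i : Fin n) (x : Fin n → ℝ) : ℝ :=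
  fderiv ℝ f x (Pi.single i 1)

/-- Christoffel symbols `Γ^k_{ij}` of a (time-independent) metric `G`. -/
def christoffel (G : (Fin n → ℝ) → Matrix (Fin n) (Fin n) ℝ)
    (x : Fin n → ℝ) (k i j : Fin n) : ℝ :=
  (1/2) * ∑ l, (G x)⁻¹ k l *
    (pd (fun y => G y j l) i x + pd (fun y => G y i l) j x - pd (fun y => G y i j) l x)

/-- Ricci tensor `R_{jk}`. -/
def ricci (G : (Fin n → ℝ) → Matrix (Fin n) (Fin n) ℝ)
    (x : Fin n → ℝ) (j k : Fin n) : ℝ :=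
  ∑ i, (pd (fun y => christoffel G y i j k) i x
      - pd (fun y => christoffel G y i i k) j x
      + ∑ p, (christoffel G x i i p * christoffel G x p j k
            - christoffel G x i j p * christoffel G x p i k))

/-- Scalar curvature. -/
def scalarCurv (G : (Fin n → ℝ) → Matrix (Fin n) (Fin n) ℝ) (x : Fin n → ℝ) : ℝ :=
  ∑ j, ∑ k, (G x)⁻¹ j k * ricci G x j k

/-- Riemann tensor `R_{ijkl}`. -/
def riemann (G : (Fin n → ℝ) → Matrix (Fin n) (Fin n) ℝ)
    (x : Fin n → ℝ) (i j k l : Fin n) : ℝ :=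
  ∑ m, G x l m *
    (pd (fun y => christoffel G y m j k) i x - pd (fun y => christoffel G y m i k) j x
      + ∑ p, (christoffel G x m i p * christoffel G x p j k
            - christoffel G x m j p * christoffel G x p i k))

/-- Norm of the Riemann tensor. -/
def riemNorm (G : (Fin n → ℝ) → Matrix (Fin n) (Fin n) ℝ) (x : Fin n → ℝ) : ℝ :=
  Real.sqrt (∑ i, ∑ j, ∑ k, ∑ l, ∑ a, ∑ b, ∑ c, ∑ d,
    (G x)⁻¹ i a * (G x)⁻¹ j b * (G x)⁻¹ k c * (G x)⁻¹ l d *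
      riemann G x i j k l * riemann G x a b c d)

/-- Sectional curvature of the plane spanned by `u`, `v`. -/
def sectionalCurv (G : (Fin n → ℝ) → Matrix (Fin n) (Fin n) ℝ)
    (x : Fin n → ℝ) (u v : Fin n → ℝ) : ℝ :=
  (∑ i, ∑ j, ∑ k, ∑ l, riemann G x i j k l * u i * v j * v k * u l) /
    ((∑ i, ∑ j, G x i j * u i * u j) * (∑ i, ∑ j, G x i j * v i * v j)
      - (∑ i, ∑ j, G x i j * u i * v j) ^ 2)

/-- Length of a path with respect to the metric `G`. -/
def pathLength (G : (Fin n → ℝ) → Matrix (Fin n) (Fin n) ℝ)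
    (γ : ℝ → (Fin n → ℝ)) : ℝ :=
  ∫ s in (0:ℝ)..1, Real.sqrt (∑ i, ∑ j, G (γ s) i j * deriv γ s i * deriv γ s j)

/-- Riemannian distance: infimum of lengths of C¹ paths. -/
def riemDist (G : (Fin n → ℝ) → Matrix (Fin n) (Fin n) ℝ)
    (x y : Fin n → ℝ) : ℝ :=
  sInf {L : ℝ | ∃ γ : ℝ → (Fin n → ℝ),
    ContDiffOn ℝ 1 γ (Icc 0 1) ∧ γ 0 = x ∧ γ 1 = y ∧ L = pathLength G γ}

/-- Metric ball. -/
def rBall (G : (Fin n → ℝ) → Matrix (Fin n) (Fin n) ℝ)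
    (x₀ : Fin n → ℝ) (r : ℝ) : Set (Fin n → ℝ) :=
  {x | riemDist G x₀ x < r}

/-- Completeness of `(ℝⁿ, riemDist G)`. -/
def riemComplete (G : (Fin n → ℝ) → Matrix (Fin n) (Fin n) ℝ) : Prop :=
  ∀ u : ℕ → (Fin n → ℝ),
    (∀ ε > (0:ℝ), ∃ N, ∀ p ≥ N, ∀ q ≥ N, riemDist G (u p) (u q) < ε) →
    ∃ x, ∀ ε > (0:ℝ), ∃ N, ∀ p ≥ N, riemDist G (u p) x < ε

/-- Riemannian volume of a set. -/
def riemVol (G : (Fin n → ℝ) → Matrix (Fin n) (Fin n) ℝ)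
    (S : Set (Fin n → ℝ)) : ℝ :=
  ∫ x in S, Real.sqrt ((G x).det)

/-- A smooth (time-independent) Riemannian metric. -/
def SmoothMetric (G : (Fin n → ℝ) → Matrix (Fin n) (Fin n) ℝ) : Prop :=
  (∀ i j, ContDiff ℝ (⊤ : ℕ∞) (fun x => G x i j)) ∧ ∀ x, (G x).IsSymm ∧ (G x).PosDef

/-- A smooth time-dependent metric over the time interval `I`. -/
def SmoothMetricFamily (g : (Fin n → ℝ) → ℝ → Matrix (Fin n) (Fin n) ℝ)
    (I : Set ℝ) : Prop :=
  (∀ i j, ContDiffOn ℝ (⊤ : ℕ∞) (fun p : (Fin n → ℝ) × ℝ => g p.1 p.2 i j) (univ ×ˢ I)) ∧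
  ∀ x : Fin n → ℝ, ∀ t ∈ I, (g x t).IsSymm ∧ (g x t).PosDef

/-- The Ricci flow equation `∂ₜ g = -2 Ric` over the time interval `I`. -/
def IsRicciFlow (g : (Fin n → ℝ) → ℝ → Matrix (Fin n) (Fin n) ℝ)
    (I : Set ℝ) : Prop :=
  ∀ x : Fin n → ℝ, ∀ t ∈ I, ∀ j k,
    derivWithin (fun s => g x s j k) I t = -2 * ricci (fun y => g y t) x j k

/-- `lam ≥ mu ≥ nu` are the eigenvalues of the 3×3 matrix `M`
(characterized via the characteristic polynomial). -/
def IsEigTriple (M : Matrix (Fin 3) (Fin 3) ℝ) (lam mu nu : ℝ) : Prop :=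
  nu ≤ mu ∧ mu ≤ lam ∧
  ∀ z : ℝ, (z • (1 : Matrix (Fin 3) (Fin 3) ℝ) - M).det = (z - lam) * (z - mu) * (z - nu)

/-- Hamilton's curvature operator `g^{il}(R g_{lj} - 2 R_{lj})` in dimension 3. -/
def curvOp (G : (Fin 3 → ℝ) → Matrix (Fin 3) (Fin 3) ℝ) (x : Fin 3 → ℝ) :
    Matrix (Fin 3) (Fin 3) ℝ :=
  Matrix.of fun i j => ∑ l, (G x)⁻¹ i l * (scalarCurv G x * G x l j - 2 * ricci G x l j)


section AlgebraicCurvature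

variable {A : Type*} [CommRing A] [Algebra ℝ A]

/-- Christoffel symbols of a metric with entries in a ring with derivations. -/
def aGam (D : Fin 3 → Derivation ℝ A A) (g gi : Matrix (Fin 3) (Fin 3) A) (k i j : Fin 3) : A :=
  (1/2 : ℝ) • ∑ l, gi k l * (D i (g j l) + D j (g i l) - D l (g i j))

/-- Curvature `R_{ijk}{}^m` of a connection over a ring with derivations. -/
def aRm (D : Fin 3 → Derivation ℝ A A) (Γ : Fin 3 → Fin 3 → Fin 3 → A) (m i j k : Fin 3) : A :=
  D i (Γ m j k) - D j (Γ m i k) + ∑ p, (Γ m i p * Γ p j k - Γ m j p * Γ p i k)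

/-- Ricci tensor of a connection over a ring with derivations. -/
def aRic (D : Fin 3 → Derivation ℝ A A) (Γ : Fin 3 → Fin 3 → Fin 3 → A) (j k : Fin 3) : A :=
  ∑ i, aRm D Γ i i j k

/-- Covariant derivative of a covector. -/
def nab1 (D : Fin 3 → Derivation ℝ A A) (Γ : Fin 3 → Fin 3 → Fin 3 → A)
    (w : Fin 3 → A) (a k : Fin 3) : A :=
  D a (w k) - ∑ m, Γ m a k * w m

/-- Covariant derivative of a covariant 2-tensor. -/
def nab2 (D : Fin 3 → Derivation ℝ A A) (Γ : Fin 3 → Fin 3 → Fin 3 → A)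
    (T : Fin 3 → Fin 3 → A) (a i j : Fin 3) : A :=
  D a (T i j) - ∑ m, (Γ m a i * T m j + Γ m a j * T i m)

/-- Covariant derivative of a covariant 3-tensor. -/
def nab3 (D : Fin 3 → Derivation ℝ A A) (Γ : Fin 3 → Fin 3 → Fin 3 → A)
    (T : Fin 3 → Fin 3 → Fin 3 → A) (a i j k : Fin 3) : A :=
  D a (T i j k) - ∑ m, (Γ m a i * T m j k + Γ m a j * T i m k + Γ m a k * T i j m)

/-- Covariant derivative of a covariant 4-tensor. -/
def nab4 (D : Fin 3 → Derivation ℝ A A) (Γ : Fin 3 → Fin 3 → Fin 3 → A)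
    (T : Fin 3 → Fin 3 → Fin 3 → Fin 3 → A) (a i j k l : Fin 3) : A :=
  D a (T i j k l) - ∑ m, (Γ m a i * T m j k l + Γ m a j * T i m k l + Γ m a k * T i j m l
    + Γ m a l * T i j k m)

/-- `Γ` is the Levi-Civita connection of `g`, whose inverse is `gi`. -/
structure LeviCivita (D : Fin 3 → Derivation ℝ A A) (g gi : Matrix (Fin 3) (Fin 3) A)
    (Γ : Fin 3 → Fin 3 → Fin 3 → A) : Prop where
  comm : ∀ i j a, D i (D j a) = D j (D i a)
  symm : ∀ i j, g i j = g j i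
  symm_inv : ∀ i j, gi i j = gi j i
  mul_inv : g * gi = 1
  torsion : ∀ k i j, Γ k i j = Γ k j i
  compat : ∀ a i j, D a (g i j) = ∑ m, (Γ m a i * g m j + Γ m a j * g i m)

theorem leviCivita_aGam {D : Fin 3 → Derivation ℝ A A} {g gi : Matrix (Fin 3) (Fin 3) A}
    (comm : ∀ i j a, D i (D j a) = D j (D i a)) (symm : ∀ i j, g i j = g j i)
    (symm_inv : ∀ i j, gi i j = gi j i) (mul_inv : g * gi = 1) :
    LeviCivita D g gi (aGam D g gi) := by
  have key : ∀ i a j, ∑ m, aGam D g gi m a i * g m j =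
      (1/2 : ℝ) • (D a (g i j) + D i (g a j) - D j (g a i)) := by
    intro i a j
    have h : ∀ l, ∑ m, g j m * gi m l = if j = l then 1 else 0 := fun l => by
      have := congrFun (congrFun mul_inv j) l
      rwa [Matrix.mul_apply, Matrix.one_apply] at this
    calc ∑ m, aGam D g gi m a i * g m j
        = (1/2 : ℝ) • ∑ l, (∑ m, g j m * gi m l) * (D a (g i l) + D i (g a l) - D l (g a i)) := by
          simp only [aGam, Fin.sum_univ_three, Algebra.smul_def, symm j]; ring
      _ = _ := by simp [h]
  refine ⟨comm, symm, symm_inv, mul_inv, ?_, ?_⟩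
  · intro k i j
    simp only [aGam, Fin.sum_univ_three, symm i j]
    congr 1; ring
  · intro a i j
    have : ∑ m, (aGam D g gi m a i * g m j + aGam D g gi m a j * g i m)
        = ∑ m, aGam D g gi m a i * g m j + ∑ m, aGam D g gi m a j * g m i := by
      rw [Finset.sum_add_distrib]; simp only [symm i]
    rw [this, key, key, ← smul_add, symm j i, symm a i, symm a j]
    have : D a (g i j) + D i (g j a) - D j (g i a) + (D a (g i j) + D j (g i a) - D i (g j a))
      = (2 : ℝ) • D a (g i j) := by rw [two_smul]; ring
    rw [this, smul_smul]; norm_num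

namespace LeviCivita

variable {D : Fin 3 → Derivation ℝ A A} {g gi : Matrix (Fin 3) (Fin 3) A}
  {Γ : Fin 3 → Fin 3 → Fin 3 → A} 

theorem deriv_inv (h : LeviCivita D g gi Γ) (a i j : Fin 3) :
    D a (gi i j) = - ∑ m, (Γ i a m * gi m j + Γ j a m * gi i m) := by
  have h1 : g.map (D a) = (Matrix.of fun m k => Γ m a k)ᵀ * g + g * (Matrix.of fun m k => Γ m a k) := by
    ext p q
    simp only [Matrix.map_apply, h.compat, Matrix.add_apply, Matrix.mul_apply, Matrix.transpose_apply,
      Matrix.of_apply, Fin.sum_univ_three]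
    ring
  have h2 : g.map (D a) * gi + g * gi.map (D a) = 0 := by
    ext p q
    have := congrArg (D a) (congrFun (congrFun h.mul_inv p) q)
    have h0 : D a ((1 : Matrix (Fin 3) (Fin 3) A) p q) = 0 := by
      rw [Matrix.one_apply]; split_ifs <;> simp
    rw [h0] at this
    refine Eq.trans ?_ this
    simp only [Matrix.map_apply, Matrix.add_apply, Matrix.mul_apply, Fin.sum_univ_three, map_add,
      Derivation.leibniz, smul_eq_mul]
    ring
  have h3 : gi * g = 1 := mul_eq_one_comm.mp h.mul_inv
  have h4 : gi.map (D a) = -((Matrix.of fun m k => Γ m a k) * gi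
      + gi * (Matrix.of fun m k => Γ m a k)ᵀ) := by
    calc gi.map (D a) = gi * (g.map (D a) * gi + g * gi.map (D a)) - gi * g.map (D a) * gi := by
          rw [mul_add, ← mul_assoc gi g, h3]; noncomm_ring
      _ = - (gi * g.map (D a) * gi) := by rw [h2]; simp
      _ = _ := by
        rw [h1, mul_add, add_mul, ← mul_assoc gi g, h3, one_mul]
        rw [mul_assoc gi, mul_assoc _ g, h.mul_inv, mul_one]; abel
  have := congrFun (congrFun h4 i) j
  simp only [Matrix.map_apply, Matrix.neg_apply, Matrix.add_apply, Matrix.mul_apply,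
    Matrix.transpose_apply, Matrix.of_apply, Fin.sum_univ_three] at this ⊢
  rw [this]; ring

/-- Traces commute with covariant differentiation. -/
theorem trace_nab2 (h : LeviCivita D g gi Γ) (T : Fin 3 → Fin 3 → A) (a : Fin 3) :
    ∑ i, ∑ j, gi i j * nab2 D Γ T a i j = D a (∑ i, ∑ j, gi i j * T i j) := by
  simp only [nab2, map_sum, Derivation.leibniz, smul_eq_mul, h.deriv_inv]
  simp only [Fin.sum_univ_three]
  ring

theorem trace_nab3 (h : LeviCivita D g gi Γ) (T : Fin 3 → Fin 3 → Fin 3 → A) (a k : Fin 3) :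
    ∑ i, ∑ j, gi i j * nab3 D Γ T a i j k = nab1 D Γ (fun k => ∑ i, ∑ j, gi i j * T i j k) a k := by
  have := h.trace_nab2 (fun i j => T i j k) a
  simp only [nab1, nab2, nab3] at this ⊢
  rw [← this]
  simp only [Fin.sum_univ_three]
  ring

theorem trace_nab3' (h : LeviCivita D g gi Γ) (T : Fin 3 → Fin 3 → Fin 3 → A) (a k : Fin 3) :
    ∑ i, ∑ j, gi i j * nab3 D Γ T a k i j = nab1 D Γ (fun k => ∑ i, ∑ j, gi i j * T k i j) a k := by
  have := h.trace_nab2 (fun i j => T k i j) a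
  simp only [nab1, nab2, nab3] at this ⊢
  rw [← this]
  simp only [Fin.sum_univ_three]
  ring

theorem trace_nab4_first_fourth (h : LeviCivita D g gi Γ) (T : Fin 3 → Fin 3 → Fin 3 → Fin 3 → A)
    (a r s : Fin 3) :
    ∑ p, ∑ q, gi p q * nab4 D Γ T a p r s q =
      nab2 D Γ (fun r s => ∑ p, ∑ q, gi p q * T p r s q) a r s := by
  have := h.trace_nab2 (fun p q => T p r s q) a
  simp only [nab2, nab4] at this ⊢
  rw [← this]
  simp only [Fin.sum_univ_three]
  ring

theorem trace_nab4_first_third (h : LeviCivita D g gi Γ) (T : Fin 3 → Fin 3 → Fin 3 → Fin 3 → A)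
    (a r s : Fin 3) :
    ∑ p, ∑ q, gi p q * nab4 D Γ T a p r q s =
      nab2 D Γ (fun r s => ∑ p, ∑ q, gi p q * T p r q s) a r s := by
  have := h.trace_nab2 (fun p q => T p r q s) a
  simp only [nab2, nab4] at this ⊢
  rw [← this]
  simp only [Fin.sum_univ_three]
  ring

theorem trace_nab4_second_fourth (h : LeviCivita D g gi Γ) (T : Fin 3 → Fin 3 → Fin 3 → Fin 3 → A)
    (a r s : Fin 3) :
    ∑ p, ∑ q, gi p q * nab4 D Γ T a r p s q =
      nab2 D Γ (fun r s => ∑ p, ∑ q, gi p q * T r p s q) a r s := by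
  have := h.trace_nab2 (fun p q => T r p s q) a
  simp only [nab2, nab4] at this ⊢
  rw [← this]
  simp only [Fin.sum_univ_three]
  ring

/-- Ricci identity. -/
theorem commutator (h : LeviCivita D g gi Γ) (T : Fin 3 → Fin 3 → A) (i j l k : Fin 3) :
    nab3 D Γ (nab2 D Γ T) i j l k - nab3 D Γ (nab2 D Γ T) j i l k =
      - ∑ m, (aRm D Γ m i j l * T m k + aRm D Γ m i j k * T l m) := by
  simp only [nab3, nab2, aRm, map_sub, map_sum, map_add, Derivation.leibniz, smul_eq_mul,
    h.comm j i, h.torsion _ j i]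
  simp only [Fin.sum_univ_three]
  ring


theorem nab2_metric (h : LeviCivita D g gi Γ) (a i j : Fin 3) : nab2 D Γ g a i j = 0 := by
  simp only [nab2, h.compat, sub_self]

theorem bianchi_up (h : LeviCivita D g gi Γ) (m a i j k : Fin 3) :
    (D a (aRm D Γ m i j k) + ∑ p, (Γ m a p * aRm D Γ p i j k - Γ p a k * aRm D Γ m i j p)) +
    (D i (aRm D Γ m j a k) + ∑ p, (Γ m i p * aRm D Γ p j a k - Γ p i k * aRm D Γ m j a p)) +
    (D j (aRm D Γ m a i k) + ∑ p, (Γ m j p * aRm D Γ p a i k - Γ p j k * aRm D Γ m a i p)) = 0 := by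
  simp only [aRm, map_sub, map_sum, map_add, Derivation.leibniz, smul_eq_mul, h.comm i a,
    h.comm j a, h.comm j i]
  simp only [Fin.sum_univ_three]
  ring

/-- First Bianchi identity. -/
theorem bianchi_first (h : LeviCivita D g gi Γ) (m i j k : Fin 3) :
    aRm D Γ m i j k + aRm D Γ m j k i + aRm D Γ m k i j = 0 := by
  simp only [aRm, h.torsion _ j i, h.torsion _ k i, h.torsion _ k j]
  simp only [Fin.sum_univ_three]
  ring

theorem aRm_antisymm (m i j k : Fin 3) : aRm D Γ m j i k = - aRm D Γ m i j k := by
  simp only [aRm, Fin.sum_univ_three]; ring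

end LeviCivita

/-- Curvature tensor `R_{ijkl}` with all indices down. -/
def aRd (D : Fin 3 → Derivation ℝ A A) (g : Matrix (Fin 3) (Fin 3) A)
    (Γ : Fin 3 → Fin 3 → Fin 3 → A) (i j k l : Fin 3) : A :=
  ∑ m, g l m * aRm D Γ m i j k

namespace LeviCivita

variable {D : Fin 3 → Derivation ℝ A A} {g gi : Matrix (Fin 3) (Fin 3) A}
  {Γ : Fin 3 → Fin 3 → Fin 3 → A}

theorem aRd_antisymm (i j k l : Fin 3) : aRd D g Γ j i k l = - aRd D g Γ i j k l := by
  simp only [aRd, aRm_antisymm _ i j, mul_neg, Finset.sum_neg_distrib]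

theorem aRd_antisymm' (h : LeviCivita D g gi Γ) (i j k l : Fin 3) :
    aRd D g Γ i j l k = - aRd D g Γ i j k l := by
  have := h.commutator g i j k l
  have h0 : ∀ a i j k, nab3 D Γ (nab2 D Γ g) a i j k = 0 := fun a i j k => by
    simp [nab3, h.nab2_metric]
  rw [h0, h0] at this
  simp only [aRd, Fin.sum_univ_three, h.symm _ l] at this ⊢
  linear_combination this

theorem aRd_bianchi_first (h : LeviCivita D g gi Γ) (i j k l : Fin 3) :
    aRd D g Γ i j k l + aRd D g Γ j k i l + aRd D g Γ k i j l = 0 := by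
  simp only [aRd, ← Finset.sum_add_distrib, ← mul_add, h.bianchi_first, mul_zero,
    Finset.sum_const_zero]

theorem aRd_pair (h : LeviCivita D g gi Γ) (i j k l : Fin 3) :
    aRd D g Γ k l i j = aRd D g Γ i j k l := by
  have h2 : (2 : ℝ) • aRd D g Γ k l i j = (2 : ℝ) • aRd D g Γ i j k l := by
    simp only [two_smul]
    have a := fun i j k l => aRd_antisymm (D := D) (g := g) (Γ := Γ) i j k l
    have a' := fun i j k l => h.aRd_antisymm' i j k l
    linear_combination -h.aRd_bianchi_first i j k l - h.aRd_bianchi_first j k l i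
      + h.aRd_bianchi_first k l i j + h.aRd_bianchi_first l i j k + a' j k i l + a' k l i j
      + a j l k i - a' j l i k - a' l i j k - a k i l j + a' k i j l - a' i j k l
  have := congrArg (fun x => (1/2 : ℝ) • x) h2
  simpa [smul_smul] using this

theorem aRic_eq (h : LeviCivita D g gi Γ) (j k : Fin 3) :
    aRic D Γ j k = ∑ i, ∑ l, gi i l * aRd D g Γ i j k l := by
  have h3 : gi * g = 1 := mul_eq_one_comm.mp h.mul_inv
  have h4 : ∀ i m, ∑ l, gi i l * g l m = if i = m then 1 else 0 := fun i m => by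
    have := congrFun (congrFun h3 i) m
    rwa [Matrix.mul_apply, Matrix.one_apply] at this
  calc aRic D Γ j k = ∑ i, ∑ m, (∑ l, gi i l * g l m) * aRm D Γ m i j k := by
        simp [aRic, h4]
    _ = _ := by simp only [aRd, Fin.sum_univ_three]; ring

theorem aRm_eq (h : LeviCivita D g gi Γ) (m i j k : Fin 3) :
    aRm D Γ m i j k = ∑ l, gi m l * aRd D g Γ i j k l := by
  have h3 : gi * g = 1 := mul_eq_one_comm.mp h.mul_inv
  have h4 : ∀ i m, ∑ l, gi i l * g l m = if i = m then 1 else 0 := fun i m => by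
    have := congrFun (congrFun h3 i) m
    rwa [Matrix.mul_apply, Matrix.one_apply] at this
  calc aRm D Γ m i j k = ∑ p, (∑ l, gi m l * g l p) * aRm D Γ p i j k := by
        simp [h4]
    _ = _ := by simp only [aRd, Fin.sum_univ_three]; ring

theorem aRic_symm (h : LeviCivita D g gi Γ) (j k : Fin 3) : aRic D Γ k j = aRic D Γ j k := by
  rw [h.aRic_eq, h.aRic_eq, Finset.sum_comm]
  refine Finset.sum_congr rfl fun i _ => Finset.sum_congr rfl fun l _ => ?_
  rw [h.symm_inv l i]
  congr 1
  rw [← h.aRd_pair, aRd_antisymm, h.aRd_antisymm', neg_neg]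

/-- Second Bianchi identity. -/
theorem bianchi_second (h : LeviCivita D g gi Γ) (a i j k l : Fin 3) :
    nab4 D Γ (aRd D g Γ) a i j k l + nab4 D Γ (aRd D g Γ) i j a k l
      + nab4 D Γ (aRd D g Γ) j a i k l = 0 := by
  have key : ∀ a i j, nab4 D Γ (aRd D g Γ) a i j k l = 
      ∑ m, g l m * (D a (aRm D Γ m i j k)
        + ∑ p, (Γ m a p * aRm D Γ p i j k - Γ p a k * aRm D Γ m i j p))
      - ∑ m, (Γ m a i * aRd D g Γ m j k l + Γ m a j * aRd D g Γ i m k l) := fun a i j => by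
    simp only [nab4, aRd, map_sum, Derivation.leibniz, smul_eq_mul, h.compat]
    simp only [Fin.sum_univ_three]
    ring
  have hb := fun m => h.bianchi_up m a i j k
  have e : ∑ m, g l m * ((D a (aRm D Γ m i j k) + ∑ p, (Γ m a p * aRm D Γ p i j k - Γ p a k * aRm D Γ m i j p)) +
    (D i (aRm D Γ m j a k) + ∑ p, (Γ m i p * aRm D Γ p j a k - Γ p i k * aRm D Γ m j a p)) +
    (D j (aRm D Γ m a i k) + ∑ p, (Γ m j p * aRm D Γ p a i k - Γ p j k * aRm D Γ m a i p))) = 0 := by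
    simp only [hb, mul_zero, Finset.sum_const_zero]
  rw [key, key, key, ← sub_eq_zero.mpr e]
  simp only [mul_add, Finset.sum_add_distrib, h.torsion _ j a, h.torsion _ i a, h.torsion _ j i]
  have s := fun q m => aRd_antisymm (D := D) (g := g) (Γ := Γ) q m k l
  simp only [s a, s i _]
  rw [← sub_eq_zero]
  have f3 : ∀ m, aRd D g Γ m j k l = - aRd D g Γ j m k l := fun m => s j m
  simp only [f3, mul_neg, Finset.sum_neg_distrib]
  ring

theorem trace_aRd (h : LeviCivita D g gi Γ) (j l : Fin 3) :
    ∑ p, ∑ q, gi p q * aRd D g Γ p j q l = - aRic D Γ j l := by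
  simp only [h.aRic_eq, h.aRd_antisymm' _ _ l, mul_neg, Finset.sum_neg_distrib]

theorem trace_aRd' (h : LeviCivita D g gi Γ) (j l : Fin 3) :
    ∑ p, ∑ q, gi p q * aRd D g Γ j p l q = - aRic D Γ j l := by
  simp only [h.aRic_eq, aRd_antisymm j, mul_neg, Finset.sum_neg_distrib, neg_neg]

theorem nab2_neg (T : Fin 3 → Fin 3 → A) (a i j : Fin 3) :
    nab2 D Γ (fun i j => - T i j) a i j = - nab2 D Γ T a i j := by
  simp only [nab2, map_neg, Fin.sum_univ_three]; ring

theorem nab2_symm {T : Fin 3 → Fin 3 → A} (hT : ∀ i j, T i j = T j i) (a i j : Fin 3) :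
    nab2 D Γ T a i j = nab2 D Γ T a j i := by
  simp only [nab2, hT i j, hT i, hT _ j, Fin.sum_univ_three]; ring

/-- Contracted second Bianchi identity. -/
theorem contracted_bianchi (h : LeviCivita D g gi Γ) (a : Fin 3) :
    D a (∑ j, ∑ k, gi j k * aRic D Γ j k) =
      2 * ∑ i, ∑ l, gi i l * nab2 D Γ (aRic D Γ) i l a := by
  have e : ∑ j, ∑ k, gi j k * ∑ i, ∑ l, gi i l *
      (nab4 D Γ (aRd D g Γ) a i j k l + nab4 D Γ (aRd D g Γ) i j a k l
      + nab4 D Γ (aRd D g Γ) j a i k l) = 0 := by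
    simp only [h.bianchi_second, mul_zero, Finset.sum_const_zero]
  have hs : ∀ i j, aRic D Γ i j = aRic D Γ j i := fun i j => (h.aRic_symm i j).symm
  have e1 : ∑ j, ∑ k, gi j k * ∑ i, ∑ l, gi i l * nab4 D Γ (aRd D g Γ) a i j k l =
      D a (∑ j, ∑ k, gi j k * aRic D Γ j k) := by
    simp only [h.trace_nab4_first_fourth, ← h.aRic_eq, h.trace_nab2]
  have e2 : ∑ i, ∑ l, gi i l * ∑ j, ∑ k, gi j k * nab4 D Γ (aRd D g Γ) i j a k l =
      - ∑ i, ∑ l, gi i l * nab2 D Γ (aRic D Γ) i l a := by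
    simp only [h.trace_nab4_first_third, h.trace_aRd, nab2_neg, mul_neg, Finset.sum_neg_distrib,
      nab2_symm hs _ a]
  have e3 : ∑ j, ∑ k, gi j k * ∑ i, ∑ l, gi i l * nab4 D Γ (aRd D g Γ) j a i k l =
      - ∑ i, ∑ l, gi i l * nab2 D Γ (aRic D Γ) i l a := by
    simp only [h.trace_nab4_second_fourth, h.trace_aRd', nab2_neg, mul_neg,
      Finset.sum_neg_distrib, nab2_symm hs _ a]
  rw [← e1]
  have e4 : ∑ j, ∑ k, gi j k * ∑ i, ∑ l, gi i l * nab4 D Γ (aRd D g Γ) i j a k l =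
      ∑ i, ∑ l, gi i l * ∑ j, ∑ k, gi j k * nab4 D Γ (aRd D g Γ) i j a k l := by
    simp only [Fin.sum_univ_three]; ring
  simp only [mul_add, Finset.sum_add_distrib] at e
  linear_combination e - e4 - e2 - e3

theorem nab1_smul_two (w : Fin 3 → A) (a k : Fin 3) :
    2 * nab1 D Γ w a k = nab1 D Γ (fun k => 2 * w k) a k := by
  have : D a (2 * w k) = 2 * D a (w k) := by rw [two_mul, map_add, two_mul]
  simp only [nab1, this, Fin.sum_univ_three]; ring

section Flow

variable {Dt : Derivation ℝ A A}

/-- Variation of the Christoffel symbols under the Ricci flow. -/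
theorem flow_gamma (h : LeviCivita D g gi Γ) (hc : ∀ i a, Dt (D i a) = D i (Dt a))
    (hf : ∀ i j, Dt (g i j) = -2 * aRic D Γ i j) (j l k : Fin 3) :
    ∑ m, g l m * Dt (Γ m j k) = -(nab2 D Γ (aRic D Γ) j l k + nab2 D Γ (aRic D Γ) k j l
      - nab2 D Γ (aRic D Γ) l j k) := by
  have hs : ∀ i j, aRic D Γ i j = aRic D Γ j i := fun i j => (h.aRic_symm i j).symm
  have key : ∀ j l k, -2 * nab2 D Γ (aRic D Γ) j l k =
      ∑ m, g k m * Dt (Γ m j l) + ∑ m, g l m * Dt (Γ m j k) := fun j l k => by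
    have e2 : ∀ x : A, D j (-2 * x) = -2 * D j x := fun x => by
      rw [neg_mul, two_mul, map_neg, map_add]; ring
    have := congrArg Dt (h.compat j l k)
    rw [hc, hf, e2] at this
    simp only [map_sum, map_add, Derivation.leibniz, smul_eq_mul, hf, h.symm _ k] at this
    simp only [nab2]
    rw [mul_sub, this]
    simp only [hs _ k]
    simp only [Fin.sum_univ_three]
    ring
  have h2 : (2 : ℝ) • ∑ m, g l m * Dt (Γ m j k) = (2 : ℝ) • -(nab2 D Γ (aRic D Γ) j l k
      + nab2 D Γ (aRic D Γ) k j l - nab2 D Γ (aRic D Γ) l j k) := by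
    have k1 := key j l k
    have k2 := key k j l
    have k3 := key l j k
    simp only [h.torsion _ k j, h.torsion _ l j, h.torsion _ l k] at k1 k2 k3
    simp only [two_smul]
    linear_combination -k1 - k2 + k3
  have := congrArg (fun x => (1/2 : ℝ) • x) h2
  simpa only [smul_smul, one_div, inv_mul_cancel₀ (two_ne_zero (α := ℝ)), one_smul] using this

/-- Variation of the curvature tensor. -/
theorem variation_curvature (h : LeviCivita D g gi Γ) (hc : ∀ i a, Dt (D i a) = D i (Dt a))
    (i j l k : Fin 3) :
    ∑ m, g l m * Dt (aRm D Γ m i j k) =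
      nab3 D Γ (fun j l k => ∑ m, g l m * Dt (Γ m j k)) i j l k
      - nab3 D Γ (fun j l k => ∑ m, g l m * Dt (Γ m j k)) j i l k := by
  simp only [nab3, aRm, map_sum, map_add, map_sub, Derivation.leibniz, smul_eq_mul, hc, h.compat,
    h.torsion _ j i]
  simp only [Fin.sum_univ_three]
  ring

theorem nab3_flow (P : Fin 3 → Fin 3 → Fin 3 → A) (i j l k : Fin 3) :
    nab3 D Γ (fun j l k => -(P j l k + P k j l - P l j k)) i j l k =
      -(nab3 D Γ P i j l k + nab3 D Γ P i k j l - nab3 D Γ P i l j k) := by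
  simp only [nab3, map_neg, map_add, map_sub, Fin.sum_univ_three]
  ring

/-- The reaction term in the evolution of the Ricci tensor. -/
def _root_.ricReaction (gi : Matrix (Fin 3) (Fin 3) A) (R : Fin 3 → Fin 3 → A)
    (Rm : Fin 3 → Fin 3 → Fin 3 → Fin 3 → A) (j k : Fin 3) : A :=
  ∑ i, ∑ l, gi i l * ∑ m, ∑ p, gi m p * (R l m * Rm i j k p) - ∑ m, ∑ p, gi m p * (R j p * R m k)

theorem trace_commutator (h : LeviCivita D g gi Γ) (j k : Fin 3) :
    ∑ i, ∑ l, gi i l * ∑ m, (aRm D Γ m i j l * aRic D Γ m k + aRm D Γ m i j k * aRic D Γ l m) =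
      ricReaction gi (aRic D Γ) (aRd D g Γ) j k := by
  have e : ∑ m, ∑ p, gi m p * (∑ i, ∑ l, gi i l * aRd D g Γ i j l p) * aRic D Γ m k =
      - ∑ m, ∑ p, gi m p * (aRic D Γ j p * aRic D Γ m k) := by
    simp only [h.trace_aRd, mul_neg, neg_mul, Finset.sum_neg_distrib, mul_assoc]
  rw [ricReaction, sub_eq_add_neg, ← e]
  simp only [h.aRm_eq]
  simp only [Fin.sum_univ_three]
  ring

theorem nab3_symm {P : Fin 3 → Fin 3 → Fin 3 → A} (hP : ∀ a i j, P a i j = P a j i)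
    (a b i j : Fin 3) : nab3 D Γ P a b i j = nab3 D Γ P a b j i := by
  simp only [nab3, hP b i j, hP _ i j, hP b i, hP b _ j, Fin.sum_univ_three]; ring

/-- Evolution of the Ricci tensor under the three-dimensional Ricci flow. -/
theorem flow_ricci (h : LeviCivita D g gi Γ) (hc : ∀ i a, Dt (D i a) = D i (Dt a))
    (hf : ∀ i j, Dt (g i j) = -2 * aRic D Γ i j) (j k : Fin 3) :
    Dt (aRic D Γ j k) = ∑ i, ∑ l, gi i l * nab3 D Γ (nab2 D Γ (aRic D Γ)) i l j k
      + ricReaction gi (aRic D Γ) (aRd D g Γ) j k + ricReaction gi (aRic D Γ) (aRd D g Γ) k j := by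
  have hs : ∀ i j, aRic D Γ i j = aRic D Γ j i := fun i j => (h.aRic_symm i j).symm
  set Q := nab3 D Γ (nab2 D Γ (aRic D Γ)) with hQ
  have h3 : gi * g = 1 := mul_eq_one_comm.mp h.mul_inv
  have h4 : ∀ i m, ∑ l, gi i l * g l m = if i = m then 1 else 0 := fun i m => by
    have := congrFun (congrFun h3 i) m
    rwa [Matrix.mul_apply, Matrix.one_apply] at this
  have e0 : Dt (aRic D Γ j k) = ∑ i, ∑ l, gi i l * ∑ m, g l m * Dt (aRm D Γ m i j k) := by
    calc Dt (aRic D Γ j k) = ∑ i, ∑ m, (∑ l, gi i l * g l m) * Dt (aRm D Γ m i j k) := by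
          simp [aRic, h4]
      _ = _ := by simp only [Fin.sum_univ_three]; ring
  have hK : (fun j l k => ∑ m, g l m * Dt (Γ m j k)) = fun j l k =>
      -(nab2 D Γ (aRic D Γ) j l k + nab2 D Γ (aRic D Γ) k j l - nab2 D Γ (aRic D Γ) l j k) := by
    funext j l k; exact h.flow_gamma hc hf j l k
  simp only [h.variation_curvature hc, hK, nab3_flow, ← hQ] at e0
  have hQs : ∀ a b i j, Q a b i j = Q a b j i := nab3_symm (nab2_symm hs)
  have hdiv : ∀ j k, 2 * ∑ i, ∑ l, gi i l * Q j i l k =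
      nab1 D Γ (fun k => D k (∑ p, ∑ q, gi p q * aRic D Γ p q)) j k := fun j k => by
    rw [hQ, h.trace_nab3, nab1_smul_two]
    simp only [h.contracted_bianchi]
  have hhess : ∀ j k, nab1 D Γ (fun k => D k (∑ p, ∑ q, gi p q * aRic D Γ p q)) j k =
      nab1 D Γ (fun k => D k (∑ p, ∑ q, gi p q * aRic D Γ p q)) k j := fun j k => by
    simp only [nab1, h.comm j k, h.torsion _ j k]
  have htr : ∑ i, ∑ l, gi i l * Q j k i l =
      nab1 D Γ (fun k => D k (∑ p, ∑ q, gi p q * aRic D Γ p q)) j k := by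
    rw [hQ, h.trace_nab3']
    simp only [h.trace_nab2]
  have hcomm : ∀ j k, ∑ i, ∑ l, gi i l * Q i j l k = ∑ i, ∑ l, gi i l * Q j i l k
      - ricReaction gi (aRic D Γ) (aRd D g Γ) j k := fun j k => by
    rw [← h.trace_commutator, ← Finset.sum_sub_distrib]
    refine Finset.sum_congr rfl fun i _ => ?_
    rw [← Finset.sum_sub_distrib]
    refine Finset.sum_congr rfl fun l _ => ?_
    rw [← mul_sub]
    congr 1
    linear_combination h.commutator (aRic D Γ) i j l k
  have hsw : ∑ i, ∑ l, gi i l * Q j l i k = ∑ i, ∑ l, gi i l * Q j i l k := by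
    rw [Finset.sum_comm]
    refine Finset.sum_congr rfl fun i _ => Finset.sum_congr rfl fun l _ => ?_
    rw [h.symm_inv l i]
  have e5 : Dt (aRic D Γ j k) = - ∑ i, ∑ l, gi i l * Q i j l k - ∑ i, ∑ l, gi i l * Q i k l j
      + ∑ i, ∑ l, gi i l * Q i l j k + ∑ i, ∑ l, gi i l * Q j i l k
      + ∑ i, ∑ l, gi i l * Q j k i l - ∑ i, ∑ l, gi i l * Q j l i k := by
    rw [e0]
    simp only [← Finset.sum_sub_distrib, ← Finset.sum_add_distrib, ← Finset.sum_neg_distrib]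
    refine Finset.sum_congr rfl fun i _ => Finset.sum_congr rfl fun l _ => ?_
    rw [hQs i k l j]; ring
  have h2 : (2 : ℝ) • Dt (aRic D Γ j k) = (2 : ℝ) • (∑ i, ∑ l, gi i l * Q i l j k
      + ricReaction gi (aRic D Γ) (aRd D g Γ) j k
      + ricReaction gi (aRic D Γ) (aRd D g Γ) k j) := by
    simp only [two_smul]
    rw [e5, hcomm, hcomm, hsw, htr]
    linear_combination -hdiv j k - hdiv k j - hhess k j
  have := congrArg (fun x => (1/2 : ℝ) • x) h2
  simpa only [smul_smul, one_div, inv_mul_cancel₀ (two_ne_zero (α := ℝ)), one_smul] using this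

theorem flow_inv (h : LeviCivita D g gi Γ) (hf : ∀ i j, Dt (g i j) = -2 * aRic D Γ i j)
    (i j : Fin 3) : Dt (gi i j) = 2 * ∑ p, ∑ q, gi i p * aRic D Γ p q * gi q j := by
  have h2 : g.map Dt * gi + g * gi.map Dt = 0 := by
    ext p q
    have := congrArg Dt (congrFun (congrFun h.mul_inv p) q)
    have h0 : Dt ((1 : Matrix (Fin 3) (Fin 3) A) p q) = 0 := by
      rw [Matrix.one_apply]; split_ifs <;> simp
    rw [h0] at this
    refine Eq.trans ?_ this
    simp only [Matrix.map_apply, Matrix.add_apply, Matrix.mul_apply, Fin.sum_univ_three, map_add,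
      Derivation.leibniz, smul_eq_mul]
    ring
  have h3 : gi * g = 1 := mul_eq_one_comm.mp h.mul_inv
  have h4 : gi.map Dt = - (gi * g.map Dt * gi) := by
    calc gi.map Dt = gi * (g.map Dt * gi + g * gi.map Dt) - gi * g.map Dt * gi := by
          rw [mul_add, ← mul_assoc gi g, h3]; noncomm_ring
      _ = _ := by rw [h2]; simp
  have := congrFun (congrFun h4 i) j
  simp only [Matrix.map_apply, Matrix.neg_apply, Matrix.mul_apply, hf, Fin.sum_univ_three]
    at this ⊢
  rw [this]; ring

/-- Evolution of the scalar curvature under the Ricci flow. -/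
theorem flow_scalar (h : LeviCivita D g gi Γ) (hc : ∀ i a, Dt (D i a) = D i (Dt a))
    (hf : ∀ i j, Dt (g i j) = -2 * aRic D Γ i j) :
    Dt (∑ p, ∑ q, gi p q * aRic D Γ p q) =
      ∑ i, ∑ l, gi i l * nab1 D Γ (fun k => D k (∑ p, ∑ q, gi p q * aRic D Γ p q)) i l
      + 2 * ∑ j, ∑ k, ∑ p, ∑ q, gi j p * gi k q * aRic D Γ j k * aRic D Γ p q := by
  have htr : ∀ i p, ∑ j, ∑ k, gi j k * aRd D g Γ i j k p = aRic D Γ i p := fun i p => by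
    rw [h.aRic_eq]
    refine Finset.sum_congr rfl fun j _ => Finset.sum_congr rfl fun k _ => ?_
    rw [aRd_antisymm, h.aRd_antisymm', neg_neg]
  have hreact : ∑ j, ∑ k, gi j k * ricReaction gi (aRic D Γ) (aRd D g Γ) j k = 0 := by
    have e1 : ∑ i, ∑ l, gi i l * ∑ m, ∑ p, gi m p * (aRic D Γ l m *
        ∑ j, ∑ k, gi j k * aRd D g Γ i j k p) = ∑ j, ∑ k, gi j k *
          ∑ i, ∑ l, gi i l * ∑ m, ∑ p, gi m p * (aRic D Γ l m * aRd D g Γ i j k p) := by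
      simp only [Fin.sum_univ_three]; ring
    simp only [ricReaction, mul_sub, Finset.sum_sub_distrib]
    rw [← e1]
    simp only [htr]
    rw [sub_eq_zero]
    refine Finset.sum_congr rfl fun i _ => Finset.sum_congr rfl fun l _ => ?_
    congr 1
    refine Finset.sum_congr rfl fun m _ => Finset.sum_congr rfl fun p _ => ?_
    rw [h.aRic_symm l m, mul_comm (aRic D Γ i p)]
  have hreact' : ∑ j, ∑ k, gi j k * ricReaction gi (aRic D Γ) (aRd D g Γ) k j = 0 := by
    rw [← hreact, Finset.sum_comm]
    simp only [h.symm_inv]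
  have hlap : ∑ p, ∑ q, gi p q * ∑ i, ∑ l, gi i l * nab3 D Γ (nab2 D Γ (aRic D Γ)) i l p q =
      ∑ i, ∑ l, gi i l * nab1 D Γ (fun k => D k (∑ p, ∑ q, gi p q * aRic D Γ p q)) i l := by
    have e1 : ∑ i, ∑ l, gi i l * ∑ p, ∑ q, gi p q * nab3 D Γ (nab2 D Γ (aRic D Γ)) i l p q =
        ∑ p, ∑ q, gi p q * ∑ i, ∑ l, gi i l * nab3 D Γ (nab2 D Γ (aRic D Γ)) i l p q := by
      simp only [Fin.sum_univ_three]; ring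
    rw [← e1]
    simp only [h.trace_nab3', h.trace_nab2]
  have hinv : ∑ p, ∑ q, aRic D Γ p q * Dt (gi p q) =
      2 * ∑ j, ∑ k, ∑ p, ∑ q, gi j p * gi k q * aRic D Γ j k * aRic D Γ p q := by
    simp only [h.flow_inv hf, Finset.mul_sum]
    refine Finset.sum_congr rfl fun p _ => Finset.sum_congr rfl fun q _ =>
      Finset.sum_congr rfl fun a _ => Finset.sum_congr rfl fun b _ => ?_
    rw [h.symm_inv b q]; ring
  have e0 : Dt (∑ p, ∑ q, gi p q * aRic D Γ p q) = ∑ p, ∑ q, gi p q * Dt (aRic D Γ p q)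
      + ∑ p, ∑ q, aRic D Γ p q * Dt (gi p q) := by
    simp only [map_sum, Derivation.leibniz, smul_eq_mul, Finset.sum_add_distrib]
  rw [e0, hinv, ← hlap]
  simp only [h.flow_ricci hc hf, mul_add, Finset.sum_add_distrib, hreact, hreact', add_zero]

end Flow

end LeviCivita
end AlgebraicCurvature

section Slab

open Topology

theorem isOpen_slab (T : ℝ) : IsOpen (univ ×ˢ Iio T : Set ((Fin 3 → ℝ) × ℝ)) :=
  isOpen_univ.prod isOpen_Iio

/-- Smooth functions on the slab `ℝ³ × (-∞, T)`. -/
def slabRing (T : ℝ) : Subalgebra ℝ ((Fin 3 → ℝ) × ℝ → ℝ) where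
  carrier := {f | ContDiffOn ℝ (⊤ : ℕ∞) f (univ ×ˢ Iio T)}
  mul_mem' hf hg := ContDiffOn.mul hf hg
  add_mem' hf hg := ContDiffOn.add hf hg
  algebraMap_mem' _ := contDiffOn_const

theorem slabRing_contDiffAt {T : ℝ} (f : slabRing T) {p : (Fin 3 → ℝ) × ℝ} (hp : p.2 < T) :
    ContDiffAt ℝ (⊤ : ℕ∞) (f : (Fin 3 → ℝ) × ℝ → ℝ) p :=
  (f.2 : ContDiffOn ℝ (⊤ : ℕ∞) _ _).contDiffAt ((isOpen_slab T).mem_nhds ⟨mem_univ _, hp⟩)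

theorem slabRing_differentiableAt {T : ℝ} (f : slabRing T) {p : (Fin 3 → ℝ) × ℝ}
    (hp : p.2 < T) : DifferentiableAt ℝ (f : (Fin 3 → ℝ) × ℝ → ℝ) p :=
  (slabRing_contDiffAt f hp).differentiableAt (by simp)

/-- Directional derivative on the ring of smooth functions on the slab. -/
def slabDeriv (T : ℝ) (e : (Fin 3 → ℝ) × ℝ) : Derivation ℝ (slabRing T) (slabRing T) :=
  Derivation.mk'
    { toFun := fun f => ⟨(univ ×ˢ Iio T).indicator fun p =>
        fderiv ℝ (f : (Fin 3 → ℝ) × ℝ → ℝ) p e, by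
        have h : ContDiffOn ℝ (⊤ : ℕ∞) (fun p => fderiv ℝ (f : (Fin 3 → ℝ) × ℝ → ℝ) p e)
            (univ ×ˢ Iio T) := by
          have := (f.2 : ContDiffOn ℝ (⊤ : ℕ∞) _ _).fderiv_of_isOpen (m := (⊤ : ℕ∞))
            (isOpen_slab T) (by simp)
          exact this.clm_apply contDiffOn_const
        exact h.congr fun p hp => indicator_of_mem hp _⟩
      map_add' := fun f g => by
        ext p
        by_cases hp : p ∈ (univ ×ˢ Iio T : Set ((Fin 3 → ℝ) × ℝ))
        · have := fderiv_add (slabRing_differentiableAt f hp.2) (slabRing_differentiableAt g hp.2)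
          simp [indicator_of_mem hp, this]
        · simp [indicator_of_notMem hp]
      map_smul' := fun c f => by
        ext p
        by_cases hp : p ∈ (univ ×ˢ Iio T : Set ((Fin 3 → ℝ) × ℝ))
        · have := fderiv_const_smul (slabRing_differentiableAt f hp.2) c
          simp [indicator_of_mem hp, this]
        · simp [indicator_of_notMem hp] }
    (fun f g => by
        ext p
        by_cases hp : p ∈ (univ ×ˢ Iio T : Set ((Fin 3 → ℝ) × ℝ))
        · have := fderiv_mul (slabRing_differentiableAt f hp.2) (slabRing_differentiableAt g hp.2)
          simp [indicator_of_mem hp, this]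
        · simp [indicator_of_notMem hp])

theorem slabDeriv_apply {T : ℝ} (e : (Fin 3 → ℝ) × ℝ) (f : slabRing T) {p : (Fin 3 → ℝ) × ℝ}
    (hp : p.2 < T) :
    (slabDeriv T e f : (Fin 3 → ℝ) × ℝ → ℝ) p = fderiv ℝ (f : (Fin 3 → ℝ) × ℝ → ℝ) p e :=
  indicator_of_mem (s := univ ×ˢ Iio T) (show p ∈ univ ×ˢ Iio T from ⟨mem_univ _, hp⟩)
    fun p => fderiv ℝ (f : (Fin 3 → ℝ) × ℝ → ℝ) p e

theorem slabDeriv_comm {T : ℝ} (e e' : (Fin 3 → ℝ) × ℝ) (f : slabRing T) :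
    slabDeriv T e (slabDeriv T e' f) = slabDeriv T e' (slabDeriv T e f) := by
  ext p
  by_cases hp : p ∈ (univ ×ˢ Iio T : Set ((Fin 3 → ℝ) × ℝ))
  · have key : ∀ e e', fderiv ℝ (slabDeriv T e' f : (Fin 3 → ℝ) × ℝ → ℝ) p e =
        fderiv ℝ (fderiv ℝ (f : (Fin 3 → ℝ) × ℝ → ℝ)) p e e' := fun e e' => by
      have h1 : (slabDeriv T e' f : (Fin 3 → ℝ) × ℝ → ℝ) =ᶠ[𝓝 p]
          fun q => fderiv ℝ (f : (Fin 3 → ℝ) × ℝ → ℝ) q e' := by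
        filter_upwards [(isOpen_slab T).mem_nhds hp] with q hq
        exact slabDeriv_apply e' f hq.2
      have h2 : DifferentiableAt ℝ (fderiv ℝ (f : (Fin 3 → ℝ) × ℝ → ℝ)) p :=
        ((slabRing_contDiffAt f hp.2).fderiv_right (m := 1) (by norm_cast)).differentiableAt
          (by simp)
      rw [h1.fderiv_eq, fderiv_clm_apply h2 (differentiableAt_const _)]
      simp
    rw [slabDeriv_apply _ _ hp.2, slabDeriv_apply _ _ hp.2, key, key]
    have := (slabRing_contDiffAt f hp.2).isSymmSndFDerivAt (by simp; norm_cast)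
    exact this e e'
  · simp [slabDeriv, indicator_of_notMem hp]

/-- Evaluation at a point. -/
def slabEval {T : ℝ} (p : (Fin 3 → ℝ) × ℝ) : slabRing T →ₐ[ℝ] ℝ :=
  (Pi.evalAlgHom ℝ (fun _ => ℝ) p).comp (slabRing T).val

theorem slabEval_apply {T : ℝ} (p : (Fin 3 → ℝ) × ℝ) (f : slabRing T) :
    slabEval p f = (f : (Fin 3 → ℝ) × ℝ → ℝ) p := rfl

theorem slabEval_ext {T : ℝ} {f g : slabRing T} (h : ∀ p, slabEval p f = slabEval p g) : f = g :=
  Subtype.ext (funext h)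

theorem slabEval_slabDeriv_of_not {T : ℝ} (e : (Fin 3 → ℝ) × ℝ) (f : slabRing T)
    {p : (Fin 3 → ℝ) × ℝ} (hp : ¬ p.2 < T) : slabEval p (slabDeriv T e f) = 0 :=
  indicator_of_notMem (s := univ ×ˢ Iio T) (fun h => hp h.2)
    fun p => fderiv ℝ (f : (Fin 3 → ℝ) × ℝ → ℝ) p e

/-- Derivation in the `i`-th spatial coordinate. -/
abbrev slabD (T : ℝ) (i : Fin 3) : Derivation ℝ (slabRing T) (slabRing T) :=
  slabDeriv T (Pi.single i 1, 0)

theorem pd_slabEval {T : ℝ} (f : slabRing T) (i : Fin 3) (x : Fin 3 → ℝ) {t : ℝ} (ht : t < T) :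
    pd (fun y => slabEval (y, t) f) i x = slabEval (x, t) (slabD T i f) := by
  have h1 : HasFDerivAt (fun y : Fin 3 → ℝ => (y, t))
      ((ContinuousLinearMap.id ℝ (Fin 3 → ℝ)).prod 0) x :=
    (hasFDerivAt_id x).prodMk (hasFDerivAt_const t x)
  have h2 := (slabRing_differentiableAt f (p := (x, t)) ht).hasFDerivAt.comp x h1
  rw [slabEval_apply, slabDeriv_apply _ _ ht, pd]
  have : (fun y => slabEval (y, t) f) = (f : (Fin 3 → ℝ) × ℝ → ℝ) ∘ fun y => (y, t) := rfl
  rw [this, h2.fderiv]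
  simp

variable {g : (Fin 3 → ℝ) → ℝ → Matrix (Fin 3) (Fin 3) ℝ} {T : ℝ}

open Classical in
/-- The metric as a matrix with entries in the ring of smooth functions on the slab. -/
def slabMetric (hg : SmoothMetricFamily g (Iio T)) : Matrix (Fin 3) (Fin 3) (slabRing T) :=
  Matrix.of fun i j => ⟨fun p => if p.2 < T then g p.1 p.2 i j else (1 : Matrix _ _ ℝ) i j,
    (hg.1 i j).congr fun _ hp => if_pos hp.2⟩

theorem slabEval_slabMetric (hg : SmoothMetricFamily g (Iio T)) (i j : Fin 3) {p : (Fin 3 → ℝ) × ℝ}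
    (hp : p.2 < T) : slabEval p (slabMetric hg i j) = g p.1 p.2 i j := if_pos hp

theorem slabEval_slabMetric_of_not (hg : SmoothMetricFamily g (Iio T)) (i j : Fin 3)
    {p : (Fin 3 → ℝ) × ℝ} (hp : ¬ p.2 < T) :
    slabEval p (slabMetric hg i j) = (1 : Matrix _ _ ℝ) i j := if_neg hp

theorem slabEval_det_ne (hg : SmoothMetricFamily g (Iio T)) (p : (Fin 3 → ℝ) × ℝ) :
    slabEval p (slabMetric hg).det ≠ 0 := by
  rw [AlgHom.map_det]
  by_cases hp : p.2 < T
  · have : (slabEval p).mapMatrix (slabMetric hg) = g p.1 p.2 := by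
      ext i j; exact slabEval_slabMetric hg i j hp
    rw [this]
    exact (hg.2 p.1 p.2 hp).2.det_pos.ne'
  · have : (slabEval p).mapMatrix (slabMetric hg) = 1 := by
      ext i j; exact slabEval_slabMetric_of_not hg i j hp
    rw [this]; simp

theorem slabMetric_det_isUnit (hg : SmoothMetricFamily g (Iio T)) :
    IsUnit (slabMetric hg).det := by
  refine IsUnit.of_mul_eq_one ⟨fun p => (slabEval p (slabMetric hg).det)⁻¹,
    ContDiffOn.inv (slabMetric hg).det.2 fun p _ => slabEval_det_ne hg p⟩ ?_
  ext p
  exact mul_inv_cancel₀ (slabEval_det_ne hg p)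

/-- The Christoffel symbols as elements of the ring of smooth functions on the slab. -/
def slabGam (hg : SmoothMetricFamily g (Iio T)) : Fin 3 → Fin 3 → Fin 3 → slabRing T :=
  aGam (slabD T) (slabMetric hg) (slabMetric hg)⁻¹

theorem slabMetric_symm (hg : SmoothMetricFamily g (Iio T)) (i j : Fin 3) :
    slabMetric hg i j = slabMetric hg j i := by
  refine slabEval_ext fun p => ?_
  by_cases hp : p.2 < T
  · rw [slabEval_slabMetric hg _ _ hp, slabEval_slabMetric hg _ _ hp]
    exact (hg.2 p.1 p.2 hp).1.apply j i
  · rw [slabEval_slabMetric_of_not hg _ _ hp, slabEval_slabMetric_of_not hg _ _ hp,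
      Matrix.one_apply, Matrix.one_apply]
    simp [eq_comm]

theorem slab_leviCivita (hg : SmoothMetricFamily g (Iio T)) :
    LeviCivita (slabD T) (slabMetric hg) (slabMetric hg)⁻¹ (slabGam hg) := by
  have hs : (slabMetric hg).IsSymm := Matrix.IsSymm.ext fun i j => slabMetric_symm hg j i
  refine leviCivita_aGam (fun i j a => slabDeriv_comm _ _ a) (slabMetric_symm hg) ?_
    (Matrix.mul_nonsing_inv _ (slabMetric_det_isUnit hg))
  intro i j
  have : ((slabMetric hg)⁻¹)ᵀ = (slabMetric hg)⁻¹ := by rw [Matrix.transpose_nonsing_inv, hs.eq]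
  exact (congrFun (congrFun this j) i)

theorem slabEval_inv (hg : SmoothMetricFamily g (Iio T)) (i j : Fin 3) {p : (Fin 3 → ℝ) × ℝ}
    (hp : p.2 < T) : slabEval p ((slabMetric hg)⁻¹ i j) = (g p.1 p.2)⁻¹ i j := by
  have h1 : (slabEval p).mapMatrix (slabMetric hg) = g p.1 p.2 := by
    ext i j; exact slabEval_slabMetric hg i j hp
  have h2 : g p.1 p.2 * (slabEval p).mapMatrix (slabMetric hg)⁻¹ = 1 := by
    rw [← h1, ← map_mul, Matrix.mul_nonsing_inv _ (slabMetric_det_isUnit hg), map_one]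
  rw [Matrix.inv_eq_right_inv h2]
  rfl

theorem slabEval_slabGam (hg : SmoothMetricFamily g (Iio T)) (k i j : Fin 3) (x : Fin 3 → ℝ)
    {t : ℝ} (ht : t < T) :
    slabEval (x, t) (slabGam hg k i j) = christoffel (fun y => g y t) x k i j := by
  have h : ∀ i j, (fun y => g y t i j) = fun y => slabEval (y, t) (slabMetric hg i j) :=
    fun i j => by funext y; exact (slabEval_slabMetric hg i j (p := (y, t)) ht).symm
  simp only [christoffel, slabGam, aGam, map_smul, map_sum, map_mul, map_sub, map_add, smul_eq_mul,
    h, pd_slabEval _ _ _ ht, slabEval_inv hg _ _ (p := (x, t)) ht]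

theorem slabEval_aRm (hg : SmoothMetricFamily g (Iio T)) (m i j k : Fin 3) (x : Fin 3 → ℝ)
    {t : ℝ} (ht : t < T) :
    slabEval (x, t) (aRm (slabD T) (slabGam hg) m i j k) =
      pd (fun y => christoffel (fun y => g y t) y m j k) i x
      - pd (fun y => christoffel (fun y => g y t) y m i k) j x
      + ∑ p, (christoffel (fun y => g y t) x m i p * christoffel (fun y => g y t) x p j k
            - christoffel (fun y => g y t) x m j p * christoffel (fun y => g y t) x p i k) := by
  simp only [← slabEval_slabGam hg _ _ _ _ ht, pd_slabEval _ _ _ ht, aRm, map_add, map_sub,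
    map_sum, map_mul]

theorem slabEval_aRic (hg : SmoothMetricFamily g (Iio T)) (j k : Fin 3) (x : Fin 3 → ℝ)
    {t : ℝ} (ht : t < T) :
    slabEval (x, t) (aRic (slabD T) (slabGam hg) j k) = ricci (fun y => g y t) x j k := by
  simp only [aRic, map_sum, slabEval_aRm hg _ _ _ _ _ ht, ricci]

theorem slabEval_aRd (hg : SmoothMetricFamily g (Iio T)) (i j k l : Fin 3) (x : Fin 3 → ℝ)
    {t : ℝ} (ht : t < T) :
    slabEval (x, t) (aRd (slabD T) (slabMetric hg) (slabGam hg) i j k l) =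
      riemann (fun y => g y t) x i j k l := by
  simp only [aRd, map_sum, map_mul, slabEval_aRm hg _ _ _ _ _ ht, riemann,
    slabEval_slabMetric hg _ _ (p := (x, t)) ht]

/-- Time derivation. -/
abbrev slabDt (T : ℝ) : Derivation ℝ (slabRing T) (slabRing T) := slabDeriv T (0, 1)

theorem hasDerivAt_slabEval (f : slabRing T) (x : Fin 3 → ℝ) {t : ℝ} (ht : t < T) :
    HasDerivAt (fun s => slabEval (x, s) f) (slabEval (x, t) (slabDt T f)) t := by
  have h1 : HasDerivAt (fun s : ℝ => (x, s)) (0, 1) t :=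
    (hasDerivAt_const t x).prodMk (hasDerivAt_id t)
  have h2 := (slabRing_differentiableAt f (p := (x, t)) ht).hasFDerivAt.comp_hasDerivAt t h1
  rw [slabEval_apply, slabDeriv_apply _ _ ht]
  exact h2

theorem slab_flow (hg : SmoothMetricFamily g (Iio T)) (hf : IsRicciFlow g (Iio T)) (i j : Fin 3) :
    slabDt T (slabMetric hg i j) = -2 * aRic (slabD T) (slabGam hg) i j := by
  refine slabEval_ext fun p => ?_
  obtain ⟨x, t⟩ := p
  by_cases ht : t < T
  · have h1 := hasDerivAt_slabEval (slabMetric hg i j) x ht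
    have h2 : HasDerivAt (fun s => g x s i j) (slabEval (x, t) (slabDt T (slabMetric hg i j))) t := by
      refine h1.congr_of_eventuallyEq ?_
      filter_upwards [Iio_mem_nhds ht] with s hs
      exact (slabEval_slabMetric hg i j (p := (x, s)) hs).symm
    have h3 := hf x t ht i j
    rw [derivWithin_of_isOpen isOpen_Iio ht, h2.deriv] at h3
    have h4 : slabEval (x, t) (2 : slabRing T) = 2 := map_ofNat _ 2
    rw [h3, map_mul, slabEval_aRic hg i j x ht, map_neg, h4]
  · have h0 : ∀ k i j, slabEval (x, t) (slabGam hg k i j) = 0 := fun k i j => by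
      simp [slabGam, aGam, slabEval_slabDeriv_of_not (p := (x, t)) _ _ ht]
    simp [aRic, aRm, slabEval_slabDeriv_of_not (p := (x, t)) _ _ ht, h0]

end Slab

section PathMetric

open Topology Filter

variable {E : Type*} [NormedAddCommGroup E] [NormedSpace ℝ E]

/-- `γ` is a `C¹` path on `[0,1]` with velocity `w`. -/
structure IsC1Path (γ w : ℝ → E) : Prop where
  cont : ContinuousOn w (Icc 0 1)
  deriv : ∀ s ∈ Icc (0 : ℝ) 1, HasDerivWithinAt γ (w s) (Icc 0 1) s

/-- Infimum of lengths of `C¹` paths for a field `H` of bilinear forms. -/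
def gDist (H : E → E →L[ℝ] E →L[ℝ] ℝ) (x y : E) : ℝ :=
  sInf {L : ℝ | ∃ γ w : ℝ → E, IsC1Path γ w ∧ γ 0 = x ∧ γ 1 = y ∧
    L = ∫ s in (0 : ℝ)..1, √(H (γ s) (w s) (w s))}

theorem IsC1Path.continuousOn {γ w : ℝ → E} (h : IsC1Path γ w) : ContinuousOn γ (Icc 0 1) :=
  fun s hs => (h.deriv s hs).continuousWithinAt

theorem IsC1Path.continuousOn_form {H : E → E →L[ℝ] E →L[ℝ] ℝ} (hH : Continuous H)
    {γ w : ℝ → E} (h : IsC1Path γ w) :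
    ContinuousOn (fun s => H (γ s) (w s) (w s)) (Icc 0 1) :=
  ((hH.comp_continuousOn h.continuousOn).clm_apply h.cont).clm_apply h.cont

theorem IsC1Path.comp {φ ψ : ℝ → ℝ} {c v : ℝ → E} (h : IsC1Path c v)
    (hφ : IsC1Path φ ψ) (hm : MapsTo φ (Icc 0 1) (Icc 0 1)) :
    IsC1Path (fun s => c (φ s)) (fun s => ψ s • v (φ s)) where
  cont := hφ.cont.smul (h.cont.comp hφ.continuousOn hm)
  deriv s hs := (h.deriv (φ s) (hm hs)).scomp s (hφ.deriv s hs) hm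

theorem gDist_set_bddBelow (H : E → E →L[ℝ] E →L[ℝ] ℝ) (x y : E) :
    BddBelow {L : ℝ | ∃ γ w : ℝ → E, IsC1Path γ w ∧ γ 0 = x ∧ γ 1 = y ∧
      L = ∫ s in (0 : ℝ)..1, √(H (γ s) (w s) (w s))} := by
  refine ⟨0, ?_⟩
  rintro L ⟨γ, w, -, -, -, rfl⟩
  exact intervalIntegral.integral_nonneg zero_le_one fun s _ => Real.sqrt_nonneg _

theorem isC1Path_segment (x y : E) : IsC1Path (fun s => x + s • (y - x)) (fun _ => y - x) where
  cont := continuousOn_const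
  deriv s _ := by
    simpa using (((hasDerivAt_id s).smul_const (y - x)).const_add x).hasDerivWithinAt

theorem gDist_nonneg (H : E → E →L[ℝ] E →L[ℝ] ℝ) (x y : E) : 0 ≤ gDist H x y := by
  refine Real.sInf_nonneg ?_
  rintro L ⟨γ, w, -, -, -, rfl⟩
  exact intervalIntegral.integral_nonneg zero_le_one fun s _ => Real.sqrt_nonneg _

theorem IsC1Path.gDist_le {H : E → E →L[ℝ] E →L[ℝ] ℝ} {γ w : ℝ → E} (h : IsC1Path γ w) :
    gDist H (γ 0) (γ 1) ≤ ∫ s in (0 : ℝ)..1, √(H (γ s) (w s) (w s)) :=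
  csInf_le (gDist_set_bddBelow H _ _) ⟨γ, w, h, rfl, rfl, rfl⟩

theorem IsC1Path.gDist_le_of_forall_le {H : E → E →L[ℝ] E →L[ℝ] ℝ} (hH : Continuous H)
    {γ w : ℝ → E} (h : IsC1Path γ w) {φ : ℝ → ℝ} (hφ : ContinuousOn φ (Icc 0 1))
    (hφ0 : ∀ s ∈ Icc (0 : ℝ) 1, 0 ≤ φ s)
    (hL : ∀ s ∈ Icc (0 : ℝ) 1, H (γ s) (w s) (w s) ≤ φ s ^ 2) :
    gDist H (γ 0) (γ 1) ≤ ∫ s in (0 : ℝ)..1, φ s := by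
  refine h.gDist_le.trans (intervalIntegral.integral_mono_on zero_le_one ?_ ?_ fun s hs => ?_)
  · refine ContinuousOn.intervalIntegrable ?_
    rw [uIcc_of_le zero_le_one]
    exact (h.continuousOn_form hH).sqrt
  · refine ContinuousOn.intervalIntegrable ?_
    rwa [uIcc_of_le zero_le_one]
  · exact Real.sqrt_le_iff.mpr ⟨hφ0 s hs, hL s hs⟩

theorem IsC1Path.gDist_subpath_le {H : E → E →L[ℝ] E →L[ℝ] ℝ} (hH : Continuous H)
    {γ w : ℝ → E} (h : IsC1Path γ w) {a b L : ℝ} (ha : 0 ≤ a) (hab : a ≤ b) (hb : b ≤ 1)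
    (hL0 : 0 ≤ L) (hL : ∀ s ∈ Icc a b, H (γ s) (w s) (w s) ≤ L ^ 2) :
    gDist H (γ a) (γ b) ≤ (b - a) * L := by
  have hm : MapsTo (fun s => a + s * (b - a)) (Icc 0 1) (Icc a b) := fun s hs =>
    ⟨by nlinarith [hs.1], by nlinarith [hs.2]⟩
  have hφ : IsC1Path (fun s => a + s * (b - a)) (fun _ => b - a) := by
    simpa using isC1Path_segment a b
  have h2 := (IsC1Path.comp h hφ
    (hm.mono_right (Icc_subset_Icc ha hb))).gDist_le_of_forall_le hH
    (φ := fun _ => (b - a) * L) continuousOn_const (fun _ _ => by nlinarith) (fun s hs => by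
      simp only [map_smul, _root_.smul_apply, smul_eq_mul]
      nlinarith [hL _ (hm hs), sq_nonneg (b - a)])
  simpa using h2

theorem IsC1Path.gDist_le_of_speed_le {H : E → E →L[ℝ] E →L[ℝ] ℝ} (hH : Continuous H)
    {γ w : ℝ → E} (h : IsC1Path γ w) {L : ℝ} 
    (hL0 : 0 ≤ L) (hL : ∀ s ∈ Icc (0 : ℝ) 1, H (γ s) (w s) (w s) ≤ L ^ 2) :
    gDist H (γ 0) (γ 1) ≤ L := by
  simpa using h.gDist_subpath_le hH le_rfl zero_le_one le_rfl hL0 hL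

/-- A point at distance less than `L` is reached by a path of speed at most `L`. -/
theorem exists_path_of_gDist_lt {H : E → E →L[ℝ] E →L[ℝ] ℝ} (hH : Continuous H)
    (hpos : ∀ x v, 0 ≤ H x v v) {x y : E} {L : ℝ} (hL : gDist H x y < L) :
    ∃ γ w : ℝ → E, IsC1Path γ w ∧ γ 0 = x ∧ γ 1 = y ∧
      ∀ s ∈ Icc (0 : ℝ) 1, H (γ s) (w s) (w s) ≤ L ^ 2 := by
  have hne : {L : ℝ | ∃ γ w : ℝ → E, IsC1Path γ w ∧ γ 0 = x ∧ γ 1 = y ∧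
      L = ∫ s in (0 : ℝ)..1, √(H (γ s) (w s) (w s))}.Nonempty :=
    ⟨_, _, _, isC1Path_segment x y, by simp, by simp, rfl⟩
  obtain ⟨_, ⟨γ, w, h, h0, h1, rfl⟩, hlt⟩ := exists_lt_of_csInf_lt hne hL
  set δ := L - ∫ s in (0 : ℝ)..1, √(H (γ s) (w s) (w s)) with hδ
  have hδ0 : 0 < δ := sub_pos.mpr hlt
  have hL0 : 0 < L := (gDist_nonneg H x y).trans_lt hL
  let q : ℝ → ℝ := fun s => √(H (γ s) (w s) (w s))
  have hq : ContinuousOn q (Icc 0 1) := (h.continuousOn_form hH).sqrt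
  let u : ℝ → ℝ := fun s => IccExtend zero_le_one ((Icc (0:ℝ) 1).domRestrict q) s + δ
  have hu : Continuous u := by
    have := (continuousOn_iff_continuous_domRestrict.mp hq)
    exact (this.Icc_extend').add continuous_const
  have huq : ∀ s ∈ Icc (0 : ℝ) 1, u s = q s + δ := fun s hs => by
    simp only [u, IccExtend_of_mem zero_le_one _ hs, domRestrict_apply]
  have hupos : ∀ s, δ ≤ u s := fun s => by
    have : 0 ≤ IccExtend zero_le_one ((Icc (0:ℝ) 1).domRestrict q) s := Real.sqrt_nonneg _
    simp only [u]; linarith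
  let W : ℝ → ℝ := fun s => ∫ r in (0 : ℝ)..s, u r
  have hW : ∀ s, HasDerivAt W (u s) s := fun s =>
    intervalIntegral.integral_hasDerivAt_right (hu.intervalIntegrable _ _)
      (hu.stronglyMeasurableAtFilter _ _) hu.continuousAt
  have hmono : StrictMono W := strictMono_of_deriv_pos fun s => by
    rw [(hW s).deriv]; exact hδ0.trans_le (hupos s)
  have hWc : Continuous W := continuous_iff_continuousAt.mpr fun s => (hW s).continuousAt
  have hW0 : W 0 = 0 := by simp [W]
  have hW1 : W 1 = L := by
    have : W 1 = ∫ s in (0 : ℝ)..1, (q s + δ) := by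
      refine intervalIntegral.integral_congr fun s hs => huq s ?_
      rwa [uIcc_of_le zero_le_one] at hs
    rw [this, intervalIntegral.integral_add]
    · simp [hδ, q]
    · refine ContinuousOn.intervalIntegrable ?_
      rwa [uIcc_of_le zero_le_one]
    · simp
  have hgrow : ∀ a b, a ≤ b → δ * (b - a) ≤ W b - W a := fun a b hab => by
    have : W b - W a = ∫ r in a..b, u r :=
      intervalIntegral.integral_interval_sub_left (hu.intervalIntegrable _ _)
        (hu.intervalIntegrable _ _)
    rw [this]
    calc δ * (b - a) = ∫ r in a..b, δ := by simp [mul_comm]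
      _ ≤ _ := intervalIntegral.integral_mono_on hab (by simp) (hu.intervalIntegrable _ _)
        fun r _ => hupos r
  have htop : Tendsto W atTop atTop := by
    refine tendsto_atTop_mono' _ ?_ (tendsto_id.const_mul_atTop hδ0)
    filter_upwards [eventually_ge_atTop 0] with b hb
    have := hgrow 0 b hb
    simp only [id]; linarith
  have hbot : Tendsto W atBot atBot := by
    refine tendsto_atBot_mono' _ ?_ (tendsto_id.const_mul_atBot hδ0)
    filter_upwards [eventually_le_atBot 0] with b hb
    have := hgrow b 0 hb
    simp only [id]; linarith
  let e := hmono.orderIsoOfSurjective W (hWc.surjective htop hbot)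
  have heW : ∀ s, e s = W s := fun s => rfl
  have hWe : ∀ s, W (e.symm s) = s := fun s => e.apply_symm_apply s
  have hsymm : ∀ s, HasDerivAt e.symm (u (e.symm s))⁻¹ s := fun s => by
    refine HasDerivAt.of_local_left_inverse (f := W) e.symm.continuous.continuousAt (hW _)
      (hδ0.trans_le (hupos _)).ne' (Eventually.of_forall hWe)
  have he0 : e.symm 0 = 0 := by rw [e.symm_apply_eq, heW, hW0]
  have heL : e.symm L = 1 := by rw [e.symm_apply_eq, heW, hW1]
  have hm : MapsTo (fun s => e.symm (L * s)) (Icc 0 1) (Icc 0 1) := fun s hs => by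
    constructor
    · rw [← he0]; exact e.symm.monotone (by nlinarith [hs.1])
    · rw [← heL]; exact e.symm.monotone (by nlinarith [hs.2])
  have hφ : IsC1Path (fun s => e.symm (L * s)) (fun s => L * (u (e.symm (L * s)))⁻¹) := by
    refine ⟨Continuous.continuousOn ?_, fun s _ => HasDerivAt.hasDerivWithinAt ?_⟩
    · have h1 : Continuous fun s => u (e.symm (L * s)) :=
        hu.comp (e.symm.continuous.comp (continuous_const.mul continuous_id))
      exact continuous_const.mul (h1.inv₀ fun s => (hδ0.trans_le (hupos _)).ne')
    · have := (hsymm (L * s)).comp s ((hasDerivAt_id s).const_mul L)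
      simpa [Function.comp_def, mul_comm] using this
  refine ⟨_, _, IsC1Path.comp h hφ hm, ?_, ?_, fun s hs => ?_⟩
  · simp [he0, h0]
  · simp [heL, h1]
  · have hs' := hm hs
    simp only at hs'
    have hu' := huq _ hs'
    set r := e.symm (L * s)
    have hq0 : 0 ≤ q r := Real.sqrt_nonneg _
    have hup : 0 < u r := hδ0.trans_le (hupos _)
    have hqs : q r ^ 2 = H (γ r) (w r) (w r) := Real.sq_sqrt (hpos _ _)
    simp only [map_smul, _root_.smul_apply, smul_eq_mul]
    rw [← hqs]
    have : (u r)⁻¹ * q r ≤ 1 := by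
      rw [inv_mul_le_iff₀ hup]; linarith
    have h0 : 0 ≤ (u r)⁻¹ * q r := by positivity
    calc L * (u r)⁻¹ * (L * (u r)⁻¹ * q r ^ 2) = L ^ 2 * ((u r)⁻¹ * q r) ^ 2 := by ring
      _ ≤ L ^ 2 * 1 := by
        refine mul_le_mul_of_nonneg_left ?_ (sq_nonneg L)
        nlinarith
      _ = L ^ 2 := mul_one _

end PathMetric

section PathMetric

open Topology Filter

theorem hasDerivAt_max_zero_sq (x : ℝ) :
    HasDerivAt (fun x : ℝ => (max 0 x) ^ 2) (2 * max 0 x) x := by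
  rcases lt_trichotomy x 0 with hx | rfl | hx
  · rw [max_eq_left hx.le, mul_zero]
    refine (hasDerivAt_const x (0 : ℝ)).congr_of_eventuallyEq ?_
    filter_upwards [Iio_mem_nhds hx] with y hy
    rw [max_eq_left (le_of_lt hy)]; simp
  · rw [max_self, mul_zero, hasDerivAt_iff_isLittleO]
    refine Asymptotics.IsBigO.trans_isLittleO (g := fun x : ℝ => x ^ 2) ?_ ?_
    · refine Asymptotics.IsBigO.of_bound 1 (Eventually.of_forall fun y => ?_)
      simp only [max_self, sub_zero, smul_zero, norm_pow, Real.norm_eq_abs, one_mul, ne_eq,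
        OfNat.ofNat_ne_zero, not_false_eq_true, zero_pow]
      refine pow_le_pow_left₀ (abs_nonneg _) ?_ 2
      rw [abs_of_nonneg (le_max_left _ _)]
      exact max_le (abs_nonneg y) (le_abs_self y)
    · simpa using Asymptotics.isLittleO_pow_id (𝕜 := ℝ) one_lt_two
  · rw [max_eq_right hx.le]
    have := hasDerivAt_pow 2 x
    refine (this.congr_of_eventuallyEq ?_).congr_deriv (by simp)
    filter_upwards [Ioi_mem_nhds hx] with y hy
    rw [max_eq_right (le_of_lt hy)]

/-- First exit time from a ball. -/
theorem exists_first_exit {X : Type*} [PseudoMetricSpace X] {γ : ℝ → X} (hγ : ContinuousOn γ (Icc 0 1)) {c : X} {r : ℝ}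
    (h0 : dist (γ 0) c < r) (hex : ∃ s ∈ Icc (0 : ℝ) 1, r ≤ dist (γ s) c) :
    ∃ τ ∈ Icc (0 : ℝ) 1, dist (γ τ) c = r ∧ ∀ s ∈ Icc 0 τ, dist (γ s) c ≤ r := by
  have hd : ContinuousOn (fun s => dist (γ s) c) (Icc 0 1) := (Continuous.dist continuous_id continuous_const).comp_continuousOn hγ
  have hK : IsCompact (Icc (0 : ℝ) 1 ∩ (fun s => dist (γ s) c) ⁻¹' Ici r) :=
    isCompact_Icc.of_isClosed_subset (hd.preimage_isClosed_of_isClosed isClosed_Icc isClosed_Ici)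
      inter_subset_left
  obtain ⟨s₀, hs₀, hs₀'⟩ := hex
  obtain ⟨τ, hτ, hmin⟩ := hK.exists_isLeast ⟨s₀, hs₀, hs₀'⟩
  have hlt : ∀ s ∈ Icc 0 τ, s ≠ τ → dist (γ s) c < r := fun s hs hne => by
    by_contra hcon
    have := hmin ⟨⟨hs.1, hs.2.trans hτ.1.2⟩, not_lt.mp hcon⟩
    exact hne (le_antisymm hs.2 this)
  have hle : dist (γ τ) c ≤ r := by
    obtain ⟨s, hs, hse⟩ := intermediate_value_Icc hτ.1.1 (hd.mono (Icc_subset_Icc le_rfl hτ.1.2))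
      ⟨h0.le, hτ.2⟩
    by_cases hne : s = τ
    · rw [← hne]; exact hse.le
    · exact absurd hse (hlt s hs hne).ne
  refine ⟨τ, hτ.1, le_antisymm hle hτ.2, fun s hs => ?_⟩
  by_cases hne : s = τ
  · rw [hne]; exact hle
  · exact (hlt s hs hne).le

variable {E : Type*} [NormedAddCommGroup E] [NormedSpace ℝ E]

theorem IsC1Path.reverse {γ w : ℝ → E} (h : IsC1Path γ w) :
    IsC1Path (fun s => γ (1 - s)) (fun s => (-1 : ℝ) • w (1 - s)) := by
  have hφ : IsC1Path (fun s : ℝ => 1 - s) (fun _ => -1) :=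
    ⟨continuousOn_const, fun s _ => by
      simpa using ((hasDerivAt_id s).const_sub 1).hasDerivWithinAt⟩
  exact IsC1Path.comp h hφ fun s hs => ⟨by linarith [hs.2], by linarith [hs.1]⟩

theorem IsC1Path.concat {γ₁ w₁ γ₂ w₂ : ℝ → E} (h₁ : IsC1Path γ₁ w₁) (h₂ : IsC1Path γ₂ w₂)
    (z : E) :
    IsC1Path (fun s => γ₁ (1 - (max 0 (1 - 2 * s)) ^ 2) + γ₂ ((max 0 (2 * s - 1)) ^ 2) - z)
      (fun s => (4 * max 0 (1 - 2 * s)) • w₁ (1 - (max 0 (1 - 2 * s)) ^ 2)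
        + (4 * max 0 (2 * s - 1)) • w₂ ((max 0 (2 * s - 1)) ^ 2)) := by
  have e₁ : IsC1Path (fun s => 1 - (max 0 (1 - 2 * s)) ^ 2) (fun s => 4 * max 0 (1 - 2 * s)) := by
    refine ⟨by fun_prop, fun s _ => HasDerivAt.hasDerivWithinAt ?_⟩
    have h1 : HasDerivAt (fun s : ℝ => 1 - 2 * s) (-2) s := by
      simpa using ((hasDerivAt_id s).const_mul 2).const_sub 1
    have := ((hasDerivAt_max_zero_sq (1 - 2 * s)).comp s h1).const_sub 1
    exact this.congr_deriv (by ring)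
  have e₂ : IsC1Path (fun s => (max 0 (2 * s - 1)) ^ 2) (fun s => 4 * max 0 (2 * s - 1)) := by
    refine ⟨by fun_prop, fun s _ => HasDerivAt.hasDerivWithinAt ?_⟩
    have h1 : HasDerivAt (fun s : ℝ => 2 * s - 1) 2 s := by
      simpa using ((hasDerivAt_id s).const_mul 2).sub_const 1
    have := (hasDerivAt_max_zero_sq (2 * s - 1)).comp s h1
    exact this.congr_deriv (by ring)
  have m₁ : MapsTo (fun s : ℝ => 1 - (max 0 (1 - 2 * s)) ^ 2) (Icc 0 1) (Icc 0 1) := fun s hs => by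
    have h1 : max 0 (1 - 2 * s) ≤ 1 := max_le zero_le_one (by linarith [hs.1])
    have h0 : 0 ≤ max 0 (1 - 2 * s) := le_max_left _ _
    constructor <;> nlinarith
  have m₂ : MapsTo (fun s : ℝ => (max 0 (2 * s - 1)) ^ 2) (Icc 0 1) (Icc 0 1) := fun s hs => by
    have h1 : max 0 (2 * s - 1) ≤ 1 := max_le zero_le_one (by linarith [hs.2])
    have h0 : 0 ≤ max 0 (2 * s - 1) := le_max_left _ _
    constructor <;> nlinarith
  have c₁ := IsC1Path.comp h₁ e₁ m₁
  have c₂ := IsC1Path.comp h₂ e₂ m₂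
  exact ⟨c₁.cont.add c₂.cont, fun s hs => ((c₁.deriv s hs).add (c₂.deriv s hs)).sub_const z⟩

variable {H : E → E →L[ℝ] E →L[ℝ] ℝ}

theorem gDist_comm_le (hH : Continuous H) (hpos : ∀ x v, 0 ≤ H x v v) (x y : E) :
    gDist H y x ≤ gDist H x y := by
  refine le_of_forall_gt_imp_ge_of_dense fun L hL => ?_
  obtain ⟨γ, w, h, rfl, rfl, hs⟩ := exists_path_of_gDist_lt hH hpos hL
  have := h.reverse.gDist_le_of_speed_le hH ((gDist_nonneg _ _ _).trans hL.le) (L := L)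
    fun s hs' => by
      simpa using hs (1 - s) ⟨by linarith [hs'.2], by linarith [hs'.1]⟩
  simpa using this

theorem gDist_comm (hH : Continuous H) (hpos : ∀ x v, 0 ≤ H x v v) (x y : E) :
    gDist H x y = gDist H y x :=
  le_antisymm (gDist_comm_le hH hpos y x) (gDist_comm_le hH hpos x y)

theorem gDist_triangle (hH : Continuous H) (hpos : ∀ x v, 0 ≤ H x v v) (x y z : E) :
    gDist H x z ≤ gDist H x y + gDist H y z := by
  refine le_of_forall_pos_le_add fun ε hε => ?_
  obtain ⟨γ₁, w₁, h₁, a₁, b₁, s₁⟩ := exists_path_of_gDist_lt hH hpos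
    (show gDist H x y < gDist H x y + ε / 2 by linarith)
  obtain ⟨γ₂, w₂, h₂, a₂, b₂, s₂⟩ := exists_path_of_gDist_lt hH hpos
    (show gDist H y z < gDist H y z + ε / 2 by linarith)
  set L₁ := gDist H x y + ε / 2
  set L₂ := gDist H y z + ε / 2
  have hL₁ : 0 ≤ L₁ := by have := gDist_nonneg H x y; positivity
  have hL₂ : 0 ≤ L₂ := by have := gDist_nonneg H y z; positivity
  have h := (h₁.concat h₂ y).gDist_le_of_forall_le hH
    (φ := fun s => 4 * max 0 (1 - 2 * s) * L₁ + 4 * max 0 (2 * s - 1) * L₂) (by fun_prop)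
    (fun s _ => by positivity) (fun s hs => by
      rcases le_total s (1 / 2) with h | h
      · have e : max 0 (2 * s - 1) = 0 := max_eq_left (by linarith)
        have h1 : max 0 (1 - 2 * s) ≤ 1 := max_le zero_le_one (by linarith [hs.1])
        have h0 : 0 ≤ max 0 (1 - 2 * s) := le_max_left _ _
        have := s₁ (1 - (max 0 (1 - 2 * s)) ^ 2) ⟨by nlinarith, by nlinarith⟩
        simp only [e, mul_zero, zero_smul, add_zero, ne_eq, OfNat.ofNat_ne_zero, not_false_eq_true,
          zero_pow, a₂, add_sub_cancel_right, map_smul, _root_.smul_apply, smul_eq_mul, zero_mul]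
        nlinarith [mul_nonneg h0 h0]
      · have e : max 0 (1 - 2 * s) = 0 := max_eq_left (by linarith)
        have h1 : max 0 (2 * s - 1) ≤ 1 := max_le zero_le_one (by linarith [hs.2])
        have h0 : 0 ≤ max 0 (2 * s - 1) := le_max_left _ _
        have := s₂ ((max 0 (2 * s - 1)) ^ 2) ⟨by nlinarith, by nlinarith⟩
        simp only [e, mul_zero, zero_smul, zero_add, ne_eq, OfNat.ofNat_ne_zero, not_false_eq_true,
          zero_pow, sub_zero, b₁, add_sub_cancel_left, map_smul, _root_.smul_apply, smul_eq_mul,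
          zero_mul]
        nlinarith [mul_nonneg h0 h0])
  have hint : ∫ s in (0 : ℝ)..1, (4 * max 0 (1 - 2 * s) * L₁ + 4 * max 0 (2 * s - 1) * L₂) =
      L₁ + L₂ := by
    have hd : ∀ s ∈ uIcc (0 : ℝ) 1, HasDerivAt (fun s => -(max 0 (1 - 2 * s)) ^ 2 * L₁
        + (max 0 (2 * s - 1)) ^ 2 * L₂)
        (4 * max 0 (1 - 2 * s) * L₁ + 4 * max 0 (2 * s - 1) * L₂) s := fun s _ => by
      have h1 : HasDerivAt (fun s : ℝ => 1 - 2 * s) (-2) s := by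
        simpa using ((hasDerivAt_id s).const_mul 2).const_sub 1
      have h2 : HasDerivAt (fun s : ℝ => 2 * s - 1) 2 s := by
        simpa using ((hasDerivAt_id s).const_mul 2).sub_const 1
      have := (((hasDerivAt_max_zero_sq (1 - 2 * s)).comp s h1).neg.mul_const L₁).add
        (((hasDerivAt_max_zero_sq (2 * s - 1)).comp s h2).mul_const L₂)
      refine HasDerivAt.congr_deriv this ?_
      ring
    rw [intervalIntegral.integral_eq_sub_of_hasDerivAt hd
      (Continuous.intervalIntegrable (by fun_prop) _ _)]
    norm_num
    rw [add_comm]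
  rw [hint] at h
  norm_num [a₁, b₁, a₂, b₂] at h
  calc gDist H x z ≤ L₁ + L₂ := h
    _ = _ := by simp only [L₁, L₂]; ring

theorem tendsto_gDist_self (hH : Continuous H) (x : E) :
    Tendsto (fun y => gDist H x y) (𝓝 x) (𝓝 0) := by
  obtain ⟨r, hr, hb⟩ : ∃ r > 0, ∀ y, dist y x < r → ‖H y‖ ≤ ‖H x‖ + 1 := by
    have hn := @continuous_norm (E →L[ℝ] E →L[ℝ] ℝ) _
    have : ∀ᶠ y in 𝓝 x, ‖H y‖ ≤ ‖H x‖ + 1 :=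
      ((hn.comp hH).tendsto x).eventually_le_const (lt_add_one ‖H x‖)
    obtain ⟨r, hr, h⟩ := Metric.eventually_nhds_iff.mp this
    exact ⟨r, hr, fun y hy => h hy⟩
  set C := ‖H x‖ + 1
  have hC : 0 ≤ C := by positivity
  have hle : ∀ y ∈ Metric.ball x r, gDist H x y ≤ √C * ‖y - x‖ := fun y hy => by
    have := (isC1Path_segment x y).gDist_le_of_speed_le hH (L := √C * ‖y - x‖) (by positivity)
      fun s hs => by
        have h1 : dist (x + s • (y - x)) x < r := by
          rw [dist_eq_norm, add_sub_cancel_left, norm_smul, Real.norm_of_nonneg hs.1]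
          calc s * ‖y - x‖ ≤ 1 * ‖y - x‖ := by gcongr; exact hs.2
            _ < r := by rw [one_mul, ← dist_eq_norm]; exact hy
        rw [mul_pow, Real.sq_sqrt hC]
        calc H _ (y - x) (y - x) ≤ ‖H (x + s • (y - x)) (y - x) (y - x)‖ := le_abs_self _
          _ ≤ ‖H (x + s • (y - x))‖ * ‖y - x‖ * ‖y - x‖ := ContinuousLinearMap.le_opNorm₂ _ _ _
          _ ≤ C * ‖y - x‖ * ‖y - x‖ := by gcongr; exact hb _ h1
          _ = _ := by ring
    simpa using this
  have h0 : Tendsto (fun y => √C * ‖y - x‖) (𝓝 x) (𝓝 0) := by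
    have : Continuous fun y => √C * ‖y - x‖ := by fun_prop
    simpa using this.tendsto x
  refine tendsto_of_tendsto_of_tendsto_of_le_of_le' tendsto_const_nhds h0
    (Eventually.of_forall fun y => gDist_nonneg _ _ _) ?_
  filter_upwards [Metric.ball_mem_nhds x hr] with y hy using hle y hy

theorem IsC1Path.norm_sub_le {γ w : ℝ → E} (h : IsC1Path γ w) {τ C : ℝ}
    (hτ : τ ∈ Icc (0 : ℝ) 1) (hC : ∀ s ∈ Icc 0 τ, ‖w s‖ ≤ C) : ‖γ τ - γ 0‖ ≤ C * τ := by
  have hsub : Icc (0 : ℝ) τ ⊆ Icc 0 1 := Icc_subset_Icc le_rfl hτ.2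
  have := norm_image_sub_le_of_norm_deriv_le_segment' (f := γ) (f' := w) (a := 0) (b := τ) (C := C)
    (fun s hs => (h.deriv s (hsub hs)).mono hsub)
    (fun s hs => hC s ⟨hs.1, hs.2.le⟩) τ ⟨hτ.1, le_rfl⟩
  simpa using this

variable [FiniteDimensional ℝ E]

theorem exists_lower_bound (hH : Continuous H) (hpos : ∀ x v, v ≠ 0 → 0 < H x v v) {K : Set E}
    (hK : IsCompact K) : ∃ c > 0, ∀ x ∈ K, ∀ v, c * ‖v‖ ^ 2 ≤ H x v v := by
  have : ProperSpace E := FiniteDimensional.proper ℝ E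
  have hS : IsCompact (K ×ˢ Metric.sphere (0 : E) 1) := hK.prod (isCompact_sphere 0 1)
  have hf : Continuous fun p : E × E => H p.1 p.2 p.2 := by fun_prop
  obtain ⟨c, hc, hcb⟩ : ∃ c > 0, ∀ p ∈ K ×ˢ Metric.sphere (0 : E) 1, c ≤ H p.1 p.2 p.2 := by
    rcases (K ×ˢ Metric.sphere (0 : E) 1).eq_empty_or_nonempty with he | hne
    · exact ⟨1, one_pos, fun p hp => by rw [he] at hp; exact hp.elim⟩
    · obtain ⟨p, hp, hmin⟩ := hS.exists_isMinOn hne hf.continuousOn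
      refine ⟨H p.1 p.2 p.2, hpos _ _ ?_, fun q hq => hmin hq⟩
      rintro h0
      have := hp.2
      simp [h0] at this
  refine ⟨c, hc, fun x hx v => ?_⟩
  rcases eq_or_ne v 0 with rfl | hv
  · simp
  · have hn : 0 < ‖v‖ := norm_pos_iff.mpr hv
    have := hcb (x, ‖v‖⁻¹ • v) ⟨hx, by simp [norm_smul, hn.ne']⟩
    simp only [map_smul, _root_.smul_apply, smul_eq_mul] at this
    have h2 := mul_le_mul_of_nonneg_right this (sq_nonneg ‖v‖)
    calc c * ‖v‖ ^ 2 ≤ _ := h2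
      _ = H x v v := by field_simp

/-- Small balls for `gDist` are bounded. -/
theorem exists_gDist_ball_bounded (hH : Continuous H) (hpos : ∀ x v, v ≠ 0 → 0 < H x v v)
    (x : E) : ∃ δ > 0, ∀ y, gDist H x y < δ → dist y x ≤ 1 := by
  have : ProperSpace E := FiniteDimensional.proper ℝ E
  have hpos' : ∀ x v, 0 ≤ H x v v := fun x v => by
    rcases eq_or_ne v 0 with rfl | hv
    · simp
    · exact (hpos x v hv).le
  obtain ⟨c, hc, hcb⟩ := exists_lower_bound hH hpos (isCompact_closedBall x 1)
  refine ⟨√c / 2, by positivity, fun y hy => ?_⟩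
  obtain ⟨γ, w, h, rfl, rfl, hs⟩ := exists_path_of_gDist_lt hH hpos' hy
  by_contra hcon
  obtain ⟨τ, hτ, hd, hin⟩ := exists_first_exit (r := 1) (c := γ 0) h.continuousOn (by simp)
    ⟨1, by simp, (not_le.mp hcon).le⟩
  have := h.norm_sub_le hτ (C := 1 / 2) fun s hs' => by
    have h1 := hcb (γ s) (hin s hs') (w s)
    have h2 := hs s ⟨hs'.1, hs'.2.trans hτ.2⟩
    have h3 : c * ‖w s‖ ^ 2 ≤ c * (1 / 2) ^ 2 := by
      calc _ ≤ _ := h1.trans h2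
        _ = _ := by rw [div_pow, Real.sq_sqrt hc.le]; ring
    exact abs_le_of_sq_le_sq' (le_of_mul_le_mul_left h3 hc) (by norm_num) |>.2
  rw [← dist_eq_norm, hd] at this
  linarith [hτ.2]

end PathMetric

section HopfRinow

open Topology Filter

variable {E : Type*} [NormedAddCommGroup E] [NormedSpace ℝ E] [FiniteDimensional ℝ E]
  {H : E → E →L[ℝ] E →L[ℝ] ℝ}

/-- The closed `gDist`-ball of radius `r` about `p` is bounded. -/
def BddBall (H : E → E →L[ℝ] E →L[ℝ] ℝ) (p : E) (r : ℝ) : Prop :=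
  ∃ R, ∀ y, gDist H p y ≤ r → ‖y‖ ≤ R

theorem bddBall_extend (hH : Continuous H) (hpos : ∀ x v, 0 ≤ H x v v) {p : E} {s a : ℝ}
    (hs : 0 < s) (ha : 0 < a) (h : ∀ q, gDist H p q ≤ a → BddBall H q (s / 2))
    (hb : BddBall H p a) : BddBall H p (a + s / 4) := by
  have : ProperSpace E := FiniteDimensional.proper ℝ E
  by_contra hcon
  simp only [BddBall, not_exists, not_forall, not_le] at hcon
  choose x hx hxn using fun m : ℕ => hcon m
  obtain ⟨R, hR⟩ := hb
  have hz : ∀ m, ∃ z, gDist H p z ≤ a ∧ gDist H z (x m) ≤ 5 * s / 16 := fun m => by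
    obtain ⟨γ, w, hγ, h0, h1, hsp⟩ := exists_path_of_gDist_lt hH hpos
      (show gDist H p (x m) < a + 5 * s / 16 by linarith [hx m])
    have hL : 0 < a + 5 * s / 16 := by positivity
    set τ := a / (a + 5 * s / 16) with hτ
    have hτ0 : 0 ≤ τ := by positivity
    have hτ1 : τ ≤ 1 := by rw [hτ, div_le_one hL]; linarith
    have e : τ * (a + 5 * s / 16) = a := div_mul_cancel₀ _ hL.ne'
    refine ⟨γ τ, ?_, ?_⟩
    · have := hγ.gDist_subpath_le hH le_rfl hτ0 hτ1 hL.le fun s hs' =>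
        hsp s ⟨hs'.1, hs'.2.trans hτ1⟩
      rw [h0] at this
      linarith
    · have := hγ.gDist_subpath_le hH hτ0 hτ1 le_rfl hL.le fun s hs' =>
        hsp s ⟨hτ0.trans hs'.1, hs'.2⟩
      rw [h1] at this
      linarith
  choose z hz1 hz2 using hz
  obtain ⟨z', -, φ, hφ, hlim⟩ := (isCompact_closedBall (0 : E) R).tendsto_subseq
    (x := z) fun m => by simpa using hR _ (hz1 m)
  have hd := (tendsto_gDist_self hH z').comp hlim
  have hpz : gDist H p z' ≤ a := by
    refine le_of_forall_pos_le_add fun ε hε => ?_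
    obtain ⟨m, hm⟩ := (hd.eventually_lt_const hε).exists
    have h1 := gDist_triangle hH hpos p (z (φ m)) z'
    rw [gDist_comm hH hpos (z (φ m)) z'] at h1
    have h2 := hz1 (φ m)
    simp only [Function.comp_apply] at hm
    linarith
  obtain ⟨R', hR'⟩ := h z' hpz
  obtain ⟨N, hN⟩ := exists_nat_gt R'
  obtain ⟨m, hm, hmN⟩ := ((hd.eventually_lt_const (show 0 < s / 8 by positivity)).and
    (eventually_ge_atTop N)).exists
  have h1 := gDist_triangle hH hpos z' (z (φ m)) (x (φ m))
  simp only [Function.comp_apply] at hm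
  have h2 := hR' (x (φ m)) (by linarith [hz2 (φ m)])
  have h3 := hxn (φ m)
  have h4 : (N : ℝ) ≤ φ m := by exact_mod_cast hmN.trans (hφ.id_le m)
  linarith

theorem exists_not_bddBall_half (hH : Continuous H) (hpos : ∀ x v, 0 ≤ H x v v) (p : E) (s : ℝ)
    (hs : 0 < s) (h : ¬ BddBall H p s) : ∃ q, gDist H p q ≤ s ∧ ¬ BddBall H q (s / 2) := by
  by_contra! hcon
  have h0 : gDist H p p ≤ 0 := by
    have := (isC1Path_segment p p).gDist_le_of_speed_le hH le_rfl (by simp)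
    simpa using this
  have h1 := bddBall_extend hH hpos hs (half_pos hs) (fun q hq => hcon q (by linarith))
    (hcon p (by linarith))
  have h2 := bddBall_extend hH hpos hs (show 0 < s / 2 + s / 4 by positivity)
    (fun q hq => hcon q (by linarith)) h1
  rw [show s / 2 + s / 4 + s / 4 = s by ring] at h2
  exact h h2

/-- Hopf–Rinow: closed balls of a complete continuous metric are bounded. -/
theorem bddBall_of_complete (hH : Continuous H) (hpos : ∀ x v, v ≠ 0 → 0 < H x v v)
    (hc : ∀ u : ℕ → E, (∀ ε > (0 : ℝ), ∃ N, ∀ p ≥ N, ∀ q ≥ N, gDist H (u p) (u q) < ε) →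
      ∃ x, ∀ ε > (0 : ℝ), ∃ N, ∀ p ≥ N, gDist H (u p) x < ε) (x₀ : E) (r : ℝ) :
    BddBall H x₀ r := by
  have hpos' : ∀ x v, 0 ≤ H x v v := fun x v => by
    rcases eq_or_ne v 0 with rfl | hv
    · simp
    · exact (hpos x v hv).le
  by_contra hcon
  set s := max r 1
  have hs : 0 < s := lt_max_of_lt_right one_pos
  replace hcon : ¬ BddBall H x₀ s := fun ⟨R, hR⟩ =>
    hcon ⟨R, fun y hy => hR y (hy.trans (le_max_left _ _))⟩
  choose! f hf1 hf2 using exists_not_bddBall_half hH hpos'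
  let q : ℕ → E := fun i => Nat.rec x₀ (fun i q => f q (s / 2 ^ i)) i
  have hq : ∀ i, ¬ BddBall H (q i) (s / 2 ^ i) := fun i => by
    induction i with
    | zero => rwa [pow_zero, div_one]
    | succ i ih =>
      have := hf2 (q i) (s / 2 ^ i) (by positivity) ih
      rwa [div_div, ← pow_succ] at this
  have hq1 : ∀ i, gDist H (q i) (q (i + 1)) ≤ s / 2 ^ i := fun i =>
    hf1 (q i) (s / 2 ^ i) (by positivity) (hq i)
  have hqk : ∀ m k, gDist H (q m) (q (m + k)) ≤ 2 * s / 2 ^ m - 2 * s / 2 ^ (m + k) := fun m k => by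
    induction k with
    | zero =>
      have := (isC1Path_segment (q m) (q m)).gDist_le_of_speed_le hH le_rfl (by simp)
      simpa using this
    | succ k ih =>
      have h1 := gDist_triangle hH hpos' (q m) (q (m + k)) (q (m + k + 1))
      have h2 := hq1 (m + k)
      have h3 : 2 * s / 2 ^ (m + (k + 1)) = s / 2 ^ (m + k) := by
        rw [← add_assoc, pow_succ]; field_simp
      have h4 : 2 * s / 2 ^ (m + k) = s / 2 ^ (m + k) + s / 2 ^ (m + k) := by ring
      rw [← add_assoc] at *
      linarith
  have hpow : ∀ ε > 0, ∃ N, ∀ m ≥ N, 2 * s / 2 ^ m < ε := fun ε hε => by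
    have : Tendsto (fun m : ℕ => 2 * s * (1 / 2 : ℝ) ^ m) atTop (𝓝 (2 * s * 0)) :=
      (tendsto_pow_atTop_nhds_zero_of_lt_one (by norm_num) (by norm_num)).const_mul _
    rw [mul_zero] at this
    obtain ⟨N, hN⟩ := eventually_atTop.mp (this.eventually_lt_const hε)
    exact ⟨N, fun m hm => by simpa [div_eq_mul_inv] using hN m hm⟩
  have hmono : ∀ N m, N ≤ m → gDist H (q N) (q m) ≤ 2 * s / 2 ^ N := fun N m h => by
    obtain ⟨k, rfl⟩ := Nat.exists_eq_add_of_le h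
    have : 0 ≤ 2 * s / 2 ^ (N + k) := by positivity
    linarith [hqk N k]
  obtain ⟨x, hx⟩ := hc q fun ε hε => by
    obtain ⟨N, hN⟩ := hpow (ε / 2) (by positivity)
    refine ⟨N, fun a ha b hb => ?_⟩
    have h1 := gDist_triangle hH hpos' (q a) (q N) (q b)
    rw [gDist_comm hH hpos' (q a) (q N)] at h1
    linarith [hmono N a ha, hmono N b hb, hN N le_rfl]
  obtain ⟨δ, hδ, hb⟩ := exists_gDist_ball_bounded hH hpos x
  obtain ⟨N, hN⟩ := hx (δ / 2) (by positivity)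
  obtain ⟨N', hN'⟩ := hpow (δ / 2) (by positivity)
  set m := max N N'
  refine hq m ⟨‖x‖ + 1, fun y hy => ?_⟩
  have h1 := gDist_triangle hH hpos' x (q m) y
  rw [gDist_comm hH hpos' x (q m)] at h1
  have h2 := hN m (le_max_left _ _)
  have h3 := hN' m (le_max_right _ _)
  have h4 : 2 * s / 2 ^ m = s / 2 ^ m + s / 2 ^ m := by ring
  have h5 : 0 < s / 2 ^ m := by positivity
  have h6 := hb y (by linarith)
  rw [dist_eq_norm] at h6
  linarith [norm_le_norm_add_norm_sub' y x]

end HopfRinow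

section TimeDependentDistance

open Topology Filter

variable {E : Type*} [NormedAddCommGroup E] [NormedSpace ℝ E]
  {H : E × ℝ → E →L[ℝ] E →L[ℝ] ℝ} {T : ℝ}

theorem continuous_slice (hH : ContinuousOn H (univ ×ˢ Iio T)) {t : ℝ} (ht : t < T) :
    Continuous fun x => H (x, t) :=
  continuousOn_univ.mp (hH.comp (by fun_prop) fun _ _ => ⟨mem_univ _, ht⟩)

theorem nonneg_of_pos_of_ne {h : E →L[ℝ] E →L[ℝ] ℝ} (hpos : ∀ v, v ≠ 0 → 0 < h v v) (v : E) :
    0 ≤ h v v := by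
  rcases eq_or_ne v 0 with rfl | hv
  · simp
  · exact (hpos v hv).le

variable [FiniteDimensional ℝ E]

theorem eventually_form_comparable (hH : ContinuousOn H (univ ×ˢ Iio T))
    (hpos : ∀ x, ∀ t < T, ∀ v, v ≠ 0 → 0 < H (x, t) v v) {K : Set E} (hK : IsCompact K) {t₀ : ℝ}
    (ht₀ : t₀ < T) {ε : ℝ} (hε : 0 < ε) :
    ∀ᶠ t in 𝓝 t₀, ∀ x ∈ K, ∀ v, H (x, t₀) v v ≤ (1 + ε) ^ 2 * H (x, t) v v := by
  obtain ⟨c, hc, hcb⟩ := exists_lower_bound (continuous_slice hH ht₀) (fun x => hpos x t₀ ht₀) hK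
  set η := c * (1 - 1 / (1 + ε) ^ 2) with hη
  have hη0 : 0 < η := by
    have : 1 / (1 + ε) ^ 2 < 1 := by
      rw [div_lt_one (by positivity)]; nlinarith
    exact mul_pos hc (by linarith)
  have hev : ∀ᶠ t in 𝓝 t₀, ∀ x ∈ K, ‖H (x, t) - H (x, t₀)‖ < η := by
    refine hK.eventually_forall_of_forall_eventually fun x _ => ?_
    have hball := @Metric.ball_mem_nhds (E →L[ℝ] E →L[ℝ] ℝ) _ (H (x, t₀)) (η / 2) (half_pos hη0)
    have h1 : ContinuousAt H (x, t₀) :=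
      hH.continuousAt ((isOpen_univ.prod isOpen_Iio).mem_nhds ⟨mem_univ _, ht₀⟩)
    have h2 := h1.eventually hball
    have e1 : Tendsto (fun z : ℝ × E => (z.2, z.1)) (𝓝 (t₀, x)) (𝓝 (x, t₀)) :=
      (continuous_snd.prodMk continuous_fst).tendsto (t₀, x)
    have e2 : Tendsto (fun z : ℝ × E => (z.2, t₀)) (𝓝 (t₀, x)) (𝓝 (x, t₀)) :=
      (continuous_snd.prodMk continuous_const).tendsto (t₀, x)
    filter_upwards [e1.eventually h2, e2.eventually h2] with z hz1 hz2
    refine (dist_eq_norm (H (z.2, z.1)) (H (z.2, t₀))).symm.trans_lt ?_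
    have := dist_triangle_right (H (z.2, z.1)) (H (z.2, t₀)) (H (x, t₀))
    linarith
  filter_upwards [hev] with t ht x hx v
  have h1 : ‖(H (x, t) - H (x, t₀)) v v‖ ≤ η * ‖v‖ * ‖v‖ :=
    (ContinuousLinearMap.le_opNorm₂ _ _ _).trans (by gcongr; exact (ht x hx).le)
  have h2 := hcb x hx v
  have h3 : H (x, t₀) v v - H (x, t) v v ≤ η * ‖v‖ ^ 2 := by
    have := (neg_abs_le _).trans' (neg_le_neg h1)
    simp only [_root_.sub_apply] at this
    nlinarith
  have h4 : η * ‖v‖ ^ 2 ≤ (1 - 1 / (1 + ε) ^ 2) * H (x, t₀) v v := by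
    have : 0 ≤ 1 - 1 / (1 + ε) ^ 2 := by
      have := (mul_pos_iff_of_pos_left hc).mp hη0
      exact this.le
    calc η * ‖v‖ ^ 2 = (1 - 1 / (1 + ε) ^ 2) * (c * ‖v‖ ^ 2) := by rw [hη]; ring
      _ ≤ _ := by gcongr
  have h5 : 1 / (1 + ε) ^ 2 * H (x, t₀) v v ≤ H (x, t) v v := by linarith
  have h6 : (0 : ℝ) < (1 + ε) ^ 2 := by positivity
  rw [div_mul_eq_mul_div, one_mul, div_le_iff₀ h6] at h5
  linarith

/-- Distances at nearby times are comparable, uniformly on balls. -/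
theorem eventually_gDist_le (hH : ContinuousOn H (univ ×ˢ Iio T))
    (hpos : ∀ x, ∀ t < T, ∀ v, v ≠ 0 → 0 < H (x, t) v v) {t₀ : ℝ} (ht₀ : t₀ < T) {x₀ : E}
    (hb : ∀ r, BddBall (fun x => H (x, t₀)) x₀ r) {ρ ε : ℝ} (hε : 0 < ε)
    (hε1 : ε ≤ 1) :
    ∃ R, ∀ᶠ t in 𝓝 t₀, ∀ x, gDist (fun x => H (x, t)) x₀ x ≤ ρ →
      ‖x‖ ≤ R ∧ gDist (fun x => H (x, t₀)) x₀ x ≤ (1 + ε) * gDist (fun x => H (x, t)) x₀ x := by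
  have : ProperSpace E := FiniteDimensional.proper ℝ E
  obtain ⟨R₀, hR₀⟩ := hb (2 * ρ + 2)
  set R := max (R₀ + 1) (‖x₀‖ + 1)
  refine ⟨R, ?_⟩
  filter_upwards [eventually_form_comparable hH hpos (isCompact_closedBall (0 : E) R) ht₀ hε,
    Iio_mem_nhds ht₀] with t ht htT x hx
  have hc := continuous_slice hH htT
  have hc₀ := continuous_slice hH ht₀
  have key : ∀ L, gDist (fun x => H (x, t)) x₀ x < L → L ≤ ρ + 1 →
      ‖x‖ ≤ R ∧ gDist (fun x => H (x, t₀)) x₀ x ≤ (1 + ε) * L := fun L hL hL1 => by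
    have hL0 : 0 ≤ L := (gDist_nonneg _ _ _).trans hL.le
    obtain ⟨γ, w, h, h0, h1, hs⟩ := exists_path_of_gDist_lt hc
      (fun x v => nonneg_of_pos_of_ne (hpos x t htT) v) hL
    have hsp : ∀ s ∈ Icc (0 : ℝ) 1, ‖γ s‖ ≤ R → H (γ s, t₀) (w s) (w s) ≤ ((1 + ε) * L) ^ 2 :=
      fun s hs' hn => by
        calc _ ≤ _ := ht (γ s) (by simpa using hn) (w s)
          _ ≤ (1 + ε) ^ 2 * L ^ 2 := by gcongr; exact hs s hs'
          _ = _ := by ring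
    by_cases hex : ∃ s ∈ Icc (0 : ℝ) 1, R ≤ dist (γ s) 0
    · exfalso
      obtain ⟨τ, hτ, hd, hin⟩ := exists_first_exit h.continuousOn (c := 0) (r := R)
        (by rw [h0, dist_zero_right]; exact (lt_add_one _).trans_le (le_max_right _ _)) hex
      have := h.gDist_subpath_le hc₀ le_rfl hτ.1 hτ.2 (L := (1 + ε) * L) (by positivity)
        fun s hs' => hsp s ⟨hs'.1, hs'.2.trans hτ.2⟩ (by simpa using hin s hs')
      rw [h0, sub_zero] at this
      have h3 : τ * ((1 + ε) * L) ≤ 2 * ρ + 2 := by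
        have : 0 ≤ (1 + ε) * L := by positivity
        nlinarith [hτ.2, hτ.1]
      have h4 := hR₀ (γ τ) (this.trans h3)
      rw [dist_zero_right] at hd
      have : R₀ + 1 ≤ R := le_max_left _ _
      linarith
    · push Not at hex
      have hn : ∀ s ∈ Icc (0 : ℝ) 1, ‖γ s‖ ≤ R := fun s hs' => by simpa using (hex s hs').le
      have := h.gDist_le_of_speed_le hc₀ (L := (1 + ε) * L) (by positivity)
        fun s hs' => hsp s hs' (hn s hs')
      rw [h0, h1] at this
      exact ⟨h1 ▸ hn 1 (by simp), this⟩
  refine ⟨(key (ρ + 1) (by linarith) le_rfl).1, ?_⟩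
  refine le_of_forall_pos_le_add fun δ hδ => ?_
  have h0 := gDist_nonneg (fun x => H (x, t)) x₀ x
  have := (key (gDist (fun x => H (x, t)) x₀ x + min (δ / 2) 1)
    (lt_add_of_pos_right _ (by positivity)) (by linarith [min_le_right (δ / 2) 1])).2
  have h2 := min_le_left (δ / 2) 1
  have h3 : 0 < min (δ / 2) 1 := by positivity
  nlinarith

/-- The space-time tube of radius `ρ` about `x₀`, with an upper bound for the distance as an
extra coordinate. -/
def distTube (H : E × ℝ → E →L[ℝ] E →L[ℝ] ℝ) (x₀ : E) (a b ρ : ℝ) : Set (E × ℝ × ℝ) :=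
  {z | z.2.1 ∈ Icc a b ∧ z.2.2 ∈ Icc 0 ρ ∧ gDist (fun x => H (x, z.2.1)) x₀ z.1 ≤ z.2.2}

theorem isCompact_distTube (hH : ContinuousOn H (univ ×ˢ Iio T))
    (hpos : ∀ x, ∀ t < T, ∀ v, v ≠ 0 → 0 < H (x, t) v v) {x₀ : E}
    (hb : ∀ t < T, ∀ r, BddBall (fun x => H (x, t)) x₀ r) {a b ρ : ℝ} (hbT : b < T) :
    IsCompact (distTube H x₀ a b ρ) := by
  have : ProperSpace E := FiniteDimensional.proper ℝ E
  have hT : ∀ t ∈ Icc a b, t < T := fun t ht => ht.2.trans_lt hbT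
  have hbd : ∃ R, ∀ t ∈ Icc a b, ∀ x, gDist (fun x => H (x, t)) x₀ x ≤ ρ → ‖x‖ ≤ R := by
    refine (isCompact_Icc (a := a) (b := b)).induction_on
      (p := fun S => ∃ R, ∀ t ∈ S, ∀ x, gDist (fun x => H (x, t)) x₀ x ≤ ρ → ‖x‖ ≤ R)
      ⟨0, by simp⟩ (fun s t hst ⟨R, hR⟩ => ⟨R, fun t ht => hR t (hst ht)⟩)
      (fun s t ⟨R, hR⟩ ⟨R', hR'⟩ => ⟨max R R', fun τ hτ x hx => hτ.elim
        (fun h => (hR τ h x hx).trans (le_max_left _ _))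
        (fun h => (hR' τ h x hx).trans (le_max_right _ _))⟩) fun t ht => ?_
    obtain ⟨R, hR⟩ := eventually_gDist_le hH hpos (hT t ht) (hb t (hT t ht)) (ρ := ρ) one_pos le_rfl
    exact ⟨_, mem_nhdsWithin_of_mem_nhds hR, R, fun τ hτ x hx => (hτ x hx).1⟩
  obtain ⟨R, hR⟩ := hbd
  refine (((isCompact_closedBall (0 : E) R).prod
    ((isCompact_Icc (a := a) (b := b)).prod (isCompact_Icc (a := 0) (b := ρ))))).of_isClosed_subset
    (IsSeqClosed.isClosed ?_) fun z hz => ⟨?_, hz.1, hz.2.1⟩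
  · intro z p hz hp
    have h1 : Tendsto (fun m => (z m).1) atTop (𝓝 p.1) := (continuous_fst.tendsto p).comp hp
    have h2 : Tendsto (fun m => (z m).2.1) atTop (𝓝 p.2.1) :=
      ((continuous_fst.comp continuous_snd).tendsto p).comp hp
    have h3 : Tendsto (fun m => (z m).2.2) atTop (𝓝 p.2.2) :=
      ((continuous_snd.comp continuous_snd).tendsto p).comp hp
    have ht : p.2.1 ∈ Icc a b := isClosed_Icc.mem_of_tendsto h2 (Eventually.of_forall fun m => (hz m).1)
    have hl : p.2.2 ∈ Icc 0 ρ :=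
      isClosed_Icc.mem_of_tendsto h3 (Eventually.of_forall fun m => (hz m).2.1)
    refine ⟨ht, hl, ?_⟩
    have hc := continuous_slice hH (hT _ ht)
    have hp' : ∀ x v, 0 ≤ H (x, p.2.1) v v :=
      fun x v => nonneg_of_pos_of_ne (hpos x _ (hT _ ht)) v
    have key : ∀ ε > 0, ε ≤ 1 → gDist (fun x => H (x, p.2.1)) x₀ p.1 ≤ (1 + ε) * p.2.2 :=
      fun ε hε hε1 => by
        obtain ⟨R', hR'⟩ := eventually_gDist_le hH hpos (hT _ ht) (hb _ (hT _ ht)) (ρ := ρ) hε hε1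
        have h4 := (tendsto_gDist_self hc p.1).comp h1
        have h5 := (h3.const_mul (1 + ε)).add h4
        rw [add_zero] at h5
        refine ge_of_tendsto h5 ?_
        filter_upwards [h2.eventually hR'] with m hm
        have h6 := (hm (z m).1 ((hz m).2.2.trans (hz m).2.1.2)).2
        have h7 := gDist_triangle hc hp' x₀ (z m).1 p.1
        rw [gDist_comm hc hp' (z m).1 p.1] at h7
        have h8 := (hz m).2.2
        have h9 : (1 + ε) * gDist (fun x => H (x, (z m).2.1)) x₀ (z m).1 ≤ (1 + ε) * (z m).2.2 := by
          gcongr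
        simp only [Function.comp_apply]
        linarith
    refine le_of_forall_pos_le_add fun δ hδ => ?_
    have hl0 : 0 ≤ p.2.2 := hl.1
    have hε : 0 < min 1 (δ / (p.2.2 + 1)) := by positivity
    have := key _ hε (min_le_left _ _)
    have h4 : min 1 (δ / (p.2.2 + 1)) * p.2.2 ≤ δ := by
      calc _ ≤ δ / (p.2.2 + 1) * (p.2.2 + 1) := by
            gcongr
            · exact min_le_right _ _
            · linarith
        _ = δ := div_mul_cancel₀ _ (by positivity)
    linarith
  · simpa using hR _ hz.1 _ (hz.2.2.trans hz.2.1.2)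

end TimeDependentDistance

section LinearODE

open scoped NNReal

/-- Coordinatewise truncation to `[-R, R]`. -/
def clipVec {ι : Type*} (R : ℝ) (v : ι → ℝ) : ι → ℝ := fun i => max (-R) (min R (v i))

theorem clipVec_lipschitz {ι : Type*} [Fintype ι] (R : ℝ) (u v : ι → ℝ) :
    ‖clipVec R u - clipVec R v‖ ≤ ‖u - v‖ := by
  refine (pi_norm_le_iff_of_nonneg (norm_nonneg _)).mpr fun i => ?_
  refine le_trans ?_ (norm_le_pi_norm (u - v) i)
  simp only [clipVec, Pi.sub_apply, Real.norm_eq_abs]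
  refine (abs_max_sub_max_le_max _ _ _ _).trans ?_
  rw [sub_self, abs_zero, max_eq_right (abs_nonneg _)]
  refine (abs_min_sub_min_le_max _ _ _ _).trans ?_
  rw [sub_self, abs_zero, max_eq_right (abs_nonneg _)]

theorem norm_clipVec_le {ι : Type*} [Fintype ι] {R : ℝ} (hR : 0 ≤ R) (v : ι → ℝ) :
    ‖clipVec R v‖ ≤ R := by
  refine (pi_norm_le_iff_of_nonneg hR).mpr fun i => ?_
  simp only [clipVec, Real.norm_eq_abs]
  exact abs_le.mpr ⟨le_max_left _ _, max_le (by linarith) (min_le_left _ _)⟩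

theorem clipVec_zero {ι : Type*} {R : ℝ} (hR : 0 ≤ R) : clipVec R (0 : ι → ℝ) = 0 := by
  ext i
  simp [clipVec, hR]

theorem clipVec_eq_self {ι : Type*} [Fintype ι] {R : ℝ} {v : ι → ℝ} (h : ‖v‖ ≤ R) :
    clipVec R v = v := by
  ext i
  have := abs_le.mp ((norm_le_pi_norm v i).trans h)
  simp only [clipVec]
  rw [min_eq_right this.2, max_eq_right this.1]

/-- Global existence for linear ordinary differential equations on `[0,1]`. -/
theorem exists_linearODE {ι : Type*} [Fintype ι] {A : ℝ → (ι → ℝ) →L[ℝ] (ι → ℝ)}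
    (hA : ∀ v, ContinuousOn (fun s => A s v) (Icc 0 1)) {K : ℝ≥0}
    (hK : ∀ s ∈ Icc (0 : ℝ) 1, ‖A s‖ ≤ K) (v₀ : ι → ℝ) :
    ∃ u : ℝ → ι → ℝ, u 0 = v₀ ∧
      ∀ s ∈ Icc (0 : ℝ) 1, HasDerivWithinAt u (A s (u s)) (Icc 0 1) s := by
  set R : ℝ≥0 := ‖v₀‖₊ * ⟨Real.exp K, (Real.exp_pos _).le⟩ with hR
  have hPL : IsPicardLindelof (fun s v => A s (clipVec R v)) (⟨0, by simp⟩ : Icc (0 : ℝ) 1) v₀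
      (K * R) 0 (K * R) K := by
    refine ⟨fun s hs => ?_, fun v _ => hA _, fun s hs v _ => ?_, by simp⟩
    · refine LipschitzOnWith.of_dist_le_mul fun u _ v _ => ?_
      rw [dist_eq_norm, dist_eq_norm, ← map_sub]
      refine ((A s).le_opNorm _).trans ?_
      gcongr
      · exact hK s hs
      · exact clipVec_lipschitz _ _ _
    · refine ((A s).le_opNorm _).trans ?_
      push_cast
      gcongr
      · exact hK s hs
      · exact norm_clipVec_le R.2 _
  obtain ⟨u, hu0, hu⟩ := hPL.exists_eq_forall_mem_Icc_hasDerivWithinAt₀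
  have hle : ∀ s ∈ Icc (0 : ℝ) 1, ‖u s‖ ≤ R := fun s hs => by
    have := norm_le_gronwallBound_of_norm_deriv_right_le (f := u)
      (f' := fun s => A s (clipVec R (u s))) (δ := ‖v₀‖) (K := K) (ε := 0) (a := 0) (b := 1)
      (fun s hs => (hu s hs).continuousWithinAt)
      (fun s hs => (hu s ⟨hs.1, hs.2.le⟩).mono_of_mem_nhdsWithin
        (Icc_mem_nhdsGE_of_mem hs)) (by rw [show u 0 = v₀ from hu0])
      (fun s hs => by
        rw [add_zero]
        refine ((A s).le_opNorm _).trans ?_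
        gcongr
        · exact hK s ⟨hs.1, hs.2.le⟩
        · have := clipVec_lipschitz R (u s) 0
          rwa [clipVec_zero (NNReal.coe_nonneg R), sub_zero, sub_zero] at this) s hs
    refine this.trans ?_
    rw [gronwallBound_ε0, hR]
    refine mul_le_mul_of_nonneg_left (Real.exp_le_exp.mpr ?_) (norm_nonneg _)
    have : (0 : ℝ) ≤ K := K.2
    nlinarith [hs.2]
  refine ⟨u, hu0, fun s hs => ?_⟩
  have := hu s hs
  rwa [clipVec_eq_self (hle s hs)] at this

end LinearODE

section UniformTaylor

open scoped ContDiff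

theorem le_of_hasDerivAt_nonneg {f f' : ℝ → ℝ}
    (hf : ∀ x ∈ Icc (0 : ℝ) 1, HasDerivAt f (f' x) x) (hf' : ∀ x ∈ Icc (0 : ℝ) 1, 0 ≤ f' x)
    {x : ℝ} (hx : x ∈ Icc (0 : ℝ) 1) : f 0 ≤ f x := by
  refine monotoneOn_of_deriv_nonneg (convex_Icc 0 1)
    (fun y hy => (hf y hy).continuousAt.continuousWithinAt)
    (fun y hy => (hf y (interior_subset hy)).differentiableAt.differentiableWithinAt)
    (fun y hy => ?_) (left_mem_Icc.mpr zero_le_one) hx hx.1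
  rw [(hf y (interior_subset hy)).deriv]
  exact hf' y (interior_subset hy)

variable {Z : Type*} [NormedAddCommGroup Z] [NormedSpace ℝ Z]

theorem hasDerivAt_fst_slice {Q : ℝ × Z → ℝ} (hQ : ContDiff ℝ ∞ Q) (z : Z) (h : ℝ) :
    HasDerivAt (fun h => Q (h, z)) (fderiv ℝ Q (h, z) (1, 0)) h := by
  have h1 : HasFDerivAt Q (fderiv ℝ Q (h, z)) (h, z) :=
    ((hQ.differentiable (by simp)) (h, z)).hasFDerivAt
  exact h1.comp_hasDerivAt h ((hasDerivAt_id h).prodMk (hasDerivAt_const h z))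

theorem contDiff_fderiv_fst {Q : ℝ × Z → ℝ} (hQ : ContDiff ℝ ∞ Q) :
    ContDiff ℝ ∞ (fun p => fderiv ℝ Q p ((1 : ℝ), (0 : Z))) :=
  (hQ.fderiv_right (by simp)).clm_apply contDiff_const

/-- Second order Taylor expansion of symmetric differences, uniformly over a compact set of
parameters. -/
theorem exists_uniform_taylor {Q : ℝ × Z → ℝ} (hQ : ContDiff ℝ ∞ Q) {Q1 : ℝ → Z → ℝ} {q2 : Z → ℝ}
    (h1 : ∀ z h, HasDerivAt (fun h => Q (h, z)) (Q1 h z) h)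
    (h2 : ∀ z, HasDerivAt (fun h => Q1 h z) (q2 z) 0) {K : Set Z} (hK : IsCompact K) :
    ∃ C, 0 ≤ C ∧ ∀ z ∈ K, ∀ h ∈ Icc (0 : ℝ) 1,
      Q (h, z) + Q (-h, z) ≤ 2 * Q (0, z) + h ^ 2 * q2 z + C * h ^ 3 := by
  set P1 : ℝ × Z → ℝ := fun p => fderiv ℝ Q p (1, 0) with hP1
  set P2 : ℝ × Z → ℝ := fun p => fderiv ℝ P1 p (1, 0) with hP2
  set P3 : ℝ × Z → ℝ := fun p => fderiv ℝ P2 p (1, 0) with hP3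
  have c1 : ContDiff ℝ ∞ P1 := contDiff_fderiv_fst hQ
  have c2 : ContDiff ℝ ∞ P2 := contDiff_fderiv_fst c1
  have c3 : ContDiff ℝ ∞ P3 := contDiff_fderiv_fst c2
  have e1 : ∀ h z, Q1 h z = P1 (h, z) := fun h z => (h1 z h).unique (hasDerivAt_fst_slice hQ z h)
  have e2 : ∀ z, q2 z = P2 (0, z) := fun z => by
    refine (h2 z).unique ?_
    simp only [e1]
    exact hasDerivAt_fst_slice c1 z 0
  obtain ⟨C0, hC0⟩ := ((isCompact_Icc (a := (-1 : ℝ)) (b := 1)).prod hK).exists_bound_of_continuousOn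
    c3.continuous.continuousOn
  set C := max C0 0 with hC
  have hb : ∀ z ∈ K, ∀ h ∈ Icc (-1 : ℝ) 1, |P3 (h, z)| ≤ C := fun z hz h hh =>
    (hC0 (h, z) ⟨hh, hz⟩).trans (le_max_left _ _)
  refine ⟨C, le_max_right _ _, fun z hz h hh => ?_⟩
  have neg : ∀ (R R' : ℝ × Z → ℝ), (∀ h, HasDerivAt (fun h => R (h, z)) (R' (h, z)) h) →
      ∀ h : ℝ, HasDerivAt (fun h => R (-h, z)) (-R' (-h, z)) h := fun R R' hR h => by
    exact ((hR (-h)).scomp h (hasDerivAt_neg h)).congr_deriv (by simp)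
  have d1 := hasDerivAt_fst_slice hQ z
  have d2 := hasDerivAt_fst_slice c1 z
  have d3 := hasDerivAt_fst_slice c2 z
  have s2 : ∀ x ∈ Icc (0 : ℝ) 1, P2 (x, z) + P2 (-x, z) ≤ 2 * P2 (0, z) + 2 * C * x := by
    intro x hx
    have := le_of_hasDerivAt_nonneg
      (f := fun x => 2 * C * x - (P2 (x, z) + P2 (-x, z)))
      (f' := fun x => 2 * C * 1 - (P3 (x, z) + -P3 (-x, z)))
      (fun y _ => ((hasDerivAt_id y).const_mul (2 * C)).sub ((d3 y).add (neg P2 P3 d3 y)))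
      (fun y hy => by
        have a1 := abs_le.mp (hb z hz y ⟨by linarith [hy.1], hy.2⟩)
        have a2 := abs_le.mp (hb z hz (-y) ⟨by linarith [hy.2], by linarith [hy.1]⟩)
        linarith [a1.2, a2.1]) hx
    simp only [neg_zero, mul_zero] at this
    linarith
  have s1 : ∀ x ∈ Icc (0 : ℝ) 1, P1 (x, z) - P1 (-x, z) ≤ 2 * x * P2 (0, z) + C * x ^ 2 := by
    intro x hx
    have := le_of_hasDerivAt_nonneg
      (f := fun x => 2 * P2 (0, z) * x + C * x ^ 2 - (P1 (x, z) - P1 (-x, z)))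
      (f' := fun x => 2 * P2 (0, z) * 1 + C * (2 * x) - (P2 (x, z) - -P2 (-x, z)))
      (fun y _ => (((hasDerivAt_id y).const_mul _).add
        (by simpa using (hasDerivAt_pow 2 y).const_mul C)).sub ((d2 y).sub (neg P1 P2 d2 y)))
      (fun y hy => by
        have := s2 y hy
        linarith) hx
    simp only [neg_zero, mul_zero] at this
    norm_num at this
    linarith
  have := le_of_hasDerivAt_nonneg
    (f := fun x => P2 (0, z) * x ^ 2 + C * x ^ 3 - (Q (x, z) + Q (-x, z)))
    (f' := fun x => P2 (0, z) * (2 * x) + C * (3 * x ^ 2) - (P1 (x, z) + -P1 (-x, z)))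
    (fun y _ => ((show HasDerivAt (fun x => P2 (0, z) * x ^ 2) (P2 (0, z) * (2 * y)) y by
        simpa using (hasDerivAt_pow 2 y).const_mul (P2 (0, z))).add
      (by simpa using (hasDerivAt_pow 3 y).const_mul C)).sub ((d1 y).add (neg Q P1 d1 y)))
    (fun y hy => by
      have := s1 y hy
      have : 0 ≤ C * y ^ 2 := mul_nonneg (le_max_right _ _) (sq_nonneg _)
      linarith) hh
  simp only [neg_zero] at this
  norm_num at this
  rw [e2]
  linarith

end UniformTaylor

section SliceGeometry

open scoped ContDiff

variable {E : Type*} [NormedAddCommGroup E] [NormedSpace ℝ E]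

/-- The endomorphism `w ↦ R(V, w)V` expressed through a connection `Γ`. -/
def jacobiOp (Γ : E → E →L[ℝ] E →L[ℝ] E) (y V w : E) : E :=
  fderiv ℝ Γ y V V w - fderiv ℝ Γ y w V V + Γ y V (Γ y V w) - Γ y (Γ y V V) w

/-- A Riemannian metric with its Levi-Civita connection and its Ricci form. -/
structure SliceGeom (ι : Type*) [Fintype ι] [DecidableEq ι] (G : E → E →L[ℝ] E →L[ℝ] ℝ)
    (Γ : E → E →L[ℝ] E →L[ℝ] E) (Rc : E → E →L[ℝ] E →L[ℝ] ℝ) : Prop where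
  smooth : ContDiff ℝ ∞ G
  smooth_conn : ContDiff ℝ ∞ Γ
  symm : ∀ y u v, G y u v = G y v u
  pos : ∀ y v, v ≠ 0 → 0 < G y v v
  torsion : ∀ y u v, Γ y u v = Γ y v u
  compat : ∀ y u a b, fderiv ℝ G y u a b = G y (Γ y u a) b + G y a (Γ y u b)
  ricci : ∀ y (e : ι → E), (∀ i j, G y (e i) (e j) = if i = j then 1 else 0) → ∀ w,
    ∑ i, G y w (jacobiOp Γ y (e i) w) = -Rc y w w

/-- Base point of the variation with data `(y, w, V, F)`. -/
def varPt (Γ : E → E →L[ℝ] E →L[ℝ] E) (h : ℝ) (z : E × E × E × E) : E :=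
  z.1 + h • z.2.2.1 - (h ^ 2 / 2) • Γ z.1 z.2.2.1 z.2.2.1

/-- Derivative of `V` along the curve, where `F` is its covariant derivative. -/
def varVel (Γ : E → E →L[ℝ] E →L[ℝ] E) (z : E × E × E × E) : E :=
  z.2.2.2 - Γ z.1 z.2.1 z.2.2.1

/-- Second order part of the velocity of the varied curves. -/
def varAcc (Γ : E → E →L[ℝ] E →L[ℝ] E) (z : E × E × E × E) : E :=
  fderiv ℝ Γ z.1 z.2.1 z.2.2.1 z.2.2.1 + Γ z.1 (varVel Γ z) z.2.2.1 + Γ z.1 z.2.2.1 (varVel Γ z)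

/-- Velocity of the varied curves. -/
def varSpeed (Γ : E → E →L[ℝ] E →L[ℝ] E) (h : ℝ) (z : E × E × E × E) : E :=
  z.2.1 + h • varVel Γ z - (h ^ 2 / 2) • varAcc Γ z

variable {ι : Type*} [Fintype ι] [DecidableEq ι] {G : E → E →L[ℝ] E →L[ℝ] ℝ} {Γ : E → E →L[ℝ] E →L[ℝ] E}
  {Rc : E → E →L[ℝ] E →L[ℝ] ℝ}

set_option maxSynthPendingDepth 3 in
theorem SliceGeom.contDiff_energy (hS : SliceGeom ι G Γ Rc) :
    ContDiff ℝ ∞ (fun p : ℝ × (E × E × E × E) =>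
      G (varPt Γ p.1 p.2) (varSpeed Γ p.1 p.2) (varSpeed Γ p.1 p.2)) := by
  have hΓ := hS.smooth_conn
  have hG := hS.smooth
  have hd : ContDiff ℝ ∞ (fderiv ℝ Γ) := hΓ.fderiv_right (by simp)
  have hd' : ContDiff ℝ ∞ (fun p : ℝ × (E × E × E × E) => fderiv ℝ Γ p.2.1) := hd.comp (by fun_prop)
  have a1 : ContDiff ℝ ∞ (fun p : ℝ × (E × E × E × E) => varVel Γ p.2) := by
    unfold varVel; fun_prop
  have a2 : ContDiff ℝ ∞ (fun p : ℝ × (E × E × E × E) => varAcc Γ p.2) := by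
    unfold varAcc; fun_prop
  have a3 : ContDiff ℝ ∞ (fun p : ℝ × (E × E × E × E) => varSpeed Γ p.1 p.2) := by
    unfold varSpeed; fun_prop
  have a4 : ContDiff ℝ ∞ (fun p : ℝ × (E × E × E × E) => varPt Γ p.1 p.2) := by
    unfold varPt; fun_prop
  fun_prop

theorem hasDerivAt_varPt (z : E × E × E × E) (h : ℝ) :
    HasDerivAt (fun h => varPt Γ h z) (z.2.2.1 - h • Γ z.1 z.2.2.1 z.2.2.1) h := by
  unfold varPt
  have h2 : HasDerivAt (fun h : ℝ => h ^ 2 / 2) h h := by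
    simpa using (hasDerivAt_pow 2 h).div_const 2
  exact ((((hasDerivAt_id h).smul_const z.2.2.1).const_add z.1).sub (h2.smul_const _)).congr_deriv
    (by simp)

theorem hasDerivAt_varSpeed (z : E × E × E × E) (h : ℝ) :
    HasDerivAt (fun h => varSpeed Γ h z) (varVel Γ z - h • varAcc Γ z) h := by
  unfold varSpeed
  have h2 : HasDerivAt (fun h : ℝ => h ^ 2 / 2) h h := by
    simpa using (hasDerivAt_pow 2 h).div_const 2
  exact ((((hasDerivAt_id h).smul_const (varVel Γ z)).const_add z.2.1).sub
    (h2.smul_const _)).congr_deriv (by simp)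

/-- First variation of the energy density. -/
theorem SliceGeom.hasDerivAt_form (hS : SliceGeom ι G Γ Rc) {c : ℝ → E} {c' : E}
    {u v : ℝ → E} {u' v' : E} {h : ℝ} (hc : HasDerivAt c c' h) (hu : HasDerivAt u u' h)
    (hv : HasDerivAt v v' h) :
    HasDerivAt (fun h => G (c h) (u h) (v h))
      (G (c h) (u' + Γ (c h) c' (u h)) (v h) + G (c h) (u h) (v' + Γ (c h) c' (v h))) h := by
  have hG := ((hS.smooth.differentiable (by simp)) (c h)).hasFDerivAt.comp_hasDerivAt h hc
  refine ((hG.clm_apply hu).clm_apply hv).congr_deriv ?_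
  simp only [_root_.add_apply, hS.compat, map_add, Function.comp]
  ring

/-- First covariant derivative of the varied velocity. -/
def varCov (Γ : E → E →L[ℝ] E →L[ℝ] E) (h : ℝ) (z : E × E × E × E) : E :=
  varVel Γ z - h • varAcc Γ z
    + Γ (varPt Γ h z) (z.2.2.1 - h • Γ z.1 z.2.2.1 z.2.2.1) (varSpeed Γ h z)

theorem SliceGeom.hasDerivAt_energy (hS : SliceGeom ι G Γ Rc) (z : E × E × E × E) (h : ℝ) :
    HasDerivAt (fun h => G (varPt Γ h z) (varSpeed Γ h z) (varSpeed Γ h z))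
      (2 * G (varPt Γ h z) (varCov Γ h z) (varSpeed Γ h z)) h := by
  refine (hS.hasDerivAt_form (hasDerivAt_varPt (Γ := Γ) z h) (hasDerivAt_varSpeed (Γ := Γ) z h)
    (hasDerivAt_varSpeed (Γ := Γ) z h)).congr_deriv ?_
  rw [hS.symm _ (varSpeed Γ h z)]
  unfold varCov
  ring

theorem SliceGeom.hasDerivAt_energy_second (hS : SliceGeom ι G Γ Rc) (z : E × E × E × E) :
    HasDerivAt (fun h => 2 * G (varPt Γ h z) (varCov Γ h z) (varSpeed Γ h z))
      (2 * G z.1 z.2.2.2 z.2.2.2 + 2 * G z.1 z.2.1 (jacobiOp Γ z.1 z.2.2.1 z.2.1)) 0 := by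
  obtain ⟨y, w, V, F⟩ := z
  set z : E × E × E × E := (y, w, V, F) with hz
  have p0 : varPt Γ 0 z = y := by simp [varPt, hz]
  have s0 : varSpeed Γ 0 z = w := by simp [varSpeed, hz]
  have v0 : varVel Γ z = F - Γ y w V := rfl
  have hΓ := ((hS.smooth_conn.differentiable (by simp)) (varPt Γ 0 z)).hasFDerivAt.comp_hasDerivAt
    (0 : ℝ) (hasDerivAt_varPt (Γ := Γ) z 0)
  have hc : HasDerivAt (fun h => varCov Γ h z)
      (-varAcc Γ z + (fderiv ℝ Γ y V V w - Γ y (Γ y V V) w + Γ y V (F - Γ y w V))) 0 := by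
    unfold varCov
    have h1 : HasDerivAt (fun h : ℝ => varVel Γ z - h • varAcc Γ z) (-varAcc Γ z) 0 := by
      simpa using ((hasDerivAt_id (0 : ℝ)).smul_const (varAcc Γ z)).const_sub (varVel Γ z)
    have h2 : HasDerivAt (fun h : ℝ => V - h • Γ y V V) (-Γ y V V) 0 := by
      simpa using ((hasDerivAt_id (0 : ℝ)).smul_const (Γ y V V)).const_sub V
    refine (h1.add ((hΓ.clm_apply h2).clm_apply
      (hasDerivAt_varSpeed (Γ := Γ) z 0))).congr_deriv ?_
    simp only [p0, s0, v0, Function.comp, zero_smul, sub_zero, map_neg, _root_.add_apply,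
      _root_.neg_apply]
    simp only [hz]
    abel
  refine ((hS.hasDerivAt_form (hasDerivAt_varPt (Γ := Γ) z 0) hc
    (hasDerivAt_varSpeed (Γ := Γ) z 0)).const_mul 2).congr_deriv ?_
  have c0 : varCov Γ 0 z = F := by
    simp only [varCov, p0, s0, v0, zero_smul, sub_zero, hS.torsion y w V]
    simp only [hz]
    abel
  have ha : varAcc Γ z = fderiv ℝ Γ y w V V + Γ y V (F - Γ y w V) + Γ y V (F - Γ y w V) := by
    simp only [varAcc, v0]
    simp only [hz, hS.torsion y _ V]
  simp only [p0, s0, c0, ha, v0, zero_smul, sub_zero]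
  rw [hS.symm y w]
  simp only [hz, jacobiOp, hS.torsion y w V, map_add, map_sub, map_neg,
    _root_.add_apply, _root_.sub_apply, _root_.neg_apply]
  ring

theorem jacobiOp_smul (c : ℝ) (y V w : E) :
    jacobiOp Γ y (c • V) w = c ^ 2 • jacobiOp Γ y V w := by
  simp only [jacobiOp, map_smul, _root_.smul_apply, smul_sub, smul_add, smul_smul, pow_two]

end SliceGeometry

section SecondVariation

open scoped ContDiff NNReal

theorem IsC1Path.gDist_sq_le {E : Type*} [NormedAddCommGroup E] [NormedSpace ℝ E]
    {H : E → E →L[ℝ] E →L[ℝ] ℝ} (hH : Continuous H) (hpos : ∀ x v, 0 ≤ H x v v)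
    {γ w : ℝ → E} (h : IsC1Path γ w) {φ : ℝ → ℝ} (hφ : ContinuousOn φ (Icc 0 1))
    (hL : ∀ s ∈ Icc (0 : ℝ) 1, H (γ s) (w s) (w s) ≤ φ s) :
    gDist H (γ 0) (γ 1) ^ 2 ≤ ∫ s in (0 : ℝ)..1, φ s := by
  have hφ0 : ∀ s ∈ Icc (0 : ℝ) 1, 0 ≤ φ s := fun s hs => (hpos _ _).trans (hL s hs)
  have hint : IntervalIntegrable φ volume 0 1 :=
    ContinuousOn.intervalIntegrable (by rwa [uIcc_of_le zero_le_one])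
  rcases (gDist_nonneg H (γ 0) (γ 1)).eq_or_lt with h0 | h0
  · rw [← h0]
    simpa using intervalIntegral.integral_nonneg zero_le_one hφ0
  set c := gDist H (γ 0) (γ 1) with hc
  have := h.gDist_le_of_forall_le hH (φ := fun s => (φ s / c + c) / 2)
    (((hφ.div_const c).add continuousOn_const).div_const 2)
    (fun s hs => by have := hφ0 s hs; positivity) (fun s hs => by
      refine (hL s hs).trans ?_
      have : φ s = φ s / c * c := by field_simp
      nlinarith [sq_nonneg (φ s / c - c)])
  rw [intervalIntegral.integral_div, intervalIntegral.integral_add (hint.div_const c) (by simp),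
    intervalIntegral.integral_div] at this
  simp only [intervalIntegral.integral_const, sub_zero, one_smul] at this
  have h2 : c ≤ (∫ s in (0 : ℝ)..1, φ s) / c := by linarith
  rw [le_div_iff₀ h0] at h2
  linarith

variable {ι : Type*} [Fintype ι]

theorem exists_parallel {Γ : (ι → ℝ) → (ι → ℝ) →L[ℝ] (ι → ℝ) →L[ℝ] (ι → ℝ)}
    (hΓ : Continuous Γ) {γ w : ℝ → ι → ℝ} (h : IsC1Path γ w) (e : ι → ℝ) :
    ∃ u : ℝ → ι → ℝ, u 1 = e ∧
      ∀ s ∈ Icc (0 : ℝ) 1, HasDerivWithinAt u (-Γ (γ s) (w s) (u s)) (Icc 0 1) s := by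
  have hm : MapsTo (fun s : ℝ => 1 - s) (Icc 0 1) (Icc 0 1) := fun s hs =>
    ⟨by linarith [hs.2], by linarith [hs.1]⟩
  have hA : ContinuousOn (fun s => Γ (γ (1 - s)) (w (1 - s))) (Icc 0 1) :=
    ((hΓ.comp_continuousOn h.continuousOn).clm_apply h.cont).comp
      (continuous_const.sub continuous_id).continuousOn hm
  obtain ⟨K, hK⟩ := isCompact_Icc.exists_bound_of_continuousOn hA
  obtain ⟨v, hv0, hv⟩ := exists_linearODE (K := ⟨max K 0, le_max_right _ _⟩)
    (fun v => hA.clm_apply continuousOn_const) (fun s hs => (hK s hs).trans (le_max_left _ _)) e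
  refine ⟨fun s => v (1 - s), by simpa using hv0, fun s hs => ?_⟩
  have := (hv (1 - s) (hm hs)).scomp s
    (((hasDerivAt_id s).const_sub 1).hasDerivWithinAt (s := Icc 0 1)) hm
  refine this.congr_deriv ?_
  simp

variable [DecidableEq ι] {G : (ι → ℝ) → (ι → ℝ) →L[ℝ] (ι → ℝ) →L[ℝ] ℝ}
  {Γ : (ι → ℝ) → (ι → ℝ) →L[ℝ] (ι → ℝ) →L[ℝ] (ι → ℝ)}
  {Rc : (ι → ℝ) → (ι → ℝ) →L[ℝ] (ι → ℝ) →L[ℝ] ℝ}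

theorem SliceGeom.parallel_form_eq (hS : SliceGeom ι G Γ Rc) {γ w u v : ℝ → ι → ℝ}
    (h : IsC1Path γ w)
    (hu : ∀ s ∈ Icc (0 : ℝ) 1, HasDerivWithinAt u (-Γ (γ s) (w s) (u s)) (Icc 0 1) s)
    (hv : ∀ s ∈ Icc (0 : ℝ) 1, HasDerivWithinAt v (-Γ (γ s) (w s) (v s)) (Icc 0 1) s)
    {s : ℝ} (hs : s ∈ Icc (0 : ℝ) 1) : G (γ s) (u s) (v s) = G (γ 1) (u 1) (v 1) := by
  have hd : ∀ s ∈ Icc (0 : ℝ) 1, HasDerivWithinAt (fun s => G (γ s) (u s) (v s)) 0 (Icc 0 1) s :=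
    fun s hs => by
      have hG := ((hS.smooth.differentiable (by simp)) (γ s)).hasFDerivAt.comp_hasDerivWithinAt s
        (h.deriv s hs)
      refine ((hG.clm_apply (hu s hs)).clm_apply (hv s hs)).congr_deriv ?_
      simp only [_root_.add_apply, hS.compat, map_neg, Function.comp, _root_.neg_apply]
      ring
  have := (convex_Icc (0 : ℝ) 1).norm_image_sub_le_of_norm_hasDerivWithin_le (C := 0) hd
    (by simp) hs (right_mem_Icc.mpr zero_le_one)
  rw [zero_mul, norm_le_zero_iff, sub_eq_zero] at this
  exact this.symm

/-- Second order approximation of the geodesic from `x` with initial velocity `e`. -/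
def quadPt {E : Type*} [NormedAddCommGroup E] [NormedSpace ℝ E] (Γ : E → E →L[ℝ] E →L[ℝ] E)
    (x e : E) (h : ℝ) : E := x + h • e - (h ^ 2 / 2) • Γ x e e

set_option maxSynthPendingDepth 3 in
/-- The variation of a path by the field `f • u`, with `u` parallel. -/
theorem SliceGeom.isC1Path_variation (hS : SliceGeom ι G Γ Rc) {γ w u : ℝ → ι → ℝ}
    (h : IsC1Path γ w)
    (hu : ∀ s ∈ Icc (0 : ℝ) 1, HasDerivWithinAt u (-Γ (γ s) (w s) (u s)) (Icc 0 1) s)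
    {f f' : ℝ → ℝ} (hf : ∀ s, HasDerivAt f (f' s) s) (hf' : Continuous f') (k : ℝ) :
    ContinuousOn (fun s => (γ s, w s, f s • u s, f' s • u s)) (Icc 0 1) ∧
    IsC1Path (fun s => varPt Γ k (γ s, w s, f s • u s, f' s • u s))
      (fun s => varSpeed Γ k (γ s, w s, f s • u s, f' s • u s)) := by
  have huc : ContinuousOn u (Icc 0 1) := fun s hs => (hu s hs).continuousWithinAt
  have hfc : Continuous f := continuous_iff_continuousAt.mpr fun s => (hf s).continuousAt
  have hz : ContinuousOn (fun s => (γ s, w s, f s • u s, f' s • u s)) (Icc 0 1) :=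
    h.continuousOn.prodMk (h.cont.prodMk
      ((hfc.continuousOn.smul huc).prodMk (hf'.continuousOn.smul huc)))
  refine ⟨hz, ?_, fun s hs => ?_⟩
  · have hd : Continuous (fderiv ℝ Γ) := hS.smooth_conn.continuous_fderiv (by simp)
    have hd' : Continuous fun z : (ι → ℝ) × (ι → ℝ) × (ι → ℝ) × (ι → ℝ) => fderiv ℝ Γ z.1 :=
      hd.comp continuous_fst
    have hΓ := hS.smooth_conn.continuous
    have : Continuous (varSpeed Γ k) := by
      have a0 : Continuous (varVel Γ) := by unfold varVel; fun_prop
      have a1 : Continuous (varAcc Γ) := by unfold varAcc; fun_prop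
      unfold varSpeed; fun_prop
    exact this.comp_continuousOn hz
  · have hV : HasDerivWithinAt (fun s => f s • u s)
        (varVel Γ (γ s, w s, f s • u s, f' s • u s)) (Icc 0 1) s := by
      refine ((hf s).hasDerivWithinAt.smul (hu s hs)).congr_deriv ?_
      simp only [varVel, map_smul, smul_neg]
      abel
    have hΓ := ((hS.smooth_conn.differentiable (by simp)) (γ s)).hasFDerivAt.comp_hasDerivWithinAt s
        (h.deriv s hs)
    have hA : HasDerivWithinAt (fun s => Γ (γ s) (f s • u s) (f s • u s))
        (varAcc Γ (γ s, w s, f s • u s, f' s • u s)) (Icc 0 1) s := by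
      refine ((hΓ.clm_apply hV).clm_apply hV).congr_deriv ?_
      simp only [varAcc, _root_.add_apply, Function.comp]
    exact (((h.deriv s hs).add (hV.const_smul k)).sub (hA.const_smul (k ^ 2 / 2)))

end SecondVariation

section SecondVariationInequality

open scoped ContDiff

variable {G : (Fin 3 → ℝ) → (Fin 3 → ℝ) →L[ℝ] (Fin 3 → ℝ) →L[ℝ] ℝ}
  {Γ : (Fin 3 → ℝ) → (Fin 3 → ℝ) →L[ℝ] (Fin 3 → ℝ) →L[ℝ] (Fin 3 → ℝ)}
  {Rc : (Fin 3 → ℝ) → (Fin 3 → ℝ) →L[ℝ] (Fin 3 → ℝ) →L[ℝ] ℝ}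

theorem le_one_add_of_mul_sq_le {a b c : ℝ} (hc : 0 < c) (h : c * a ^ 2 ≤ b) : a ≤ 1 + b / c := by
  have : a ^ 2 ≤ b / c := by rw [le_div_iff₀ hc]; linarith
  nlinarith [sq_nonneg (a - 1)]

/-- Pointwise sum of the energy densities of the seven competing paths. -/
theorem SliceGeom.density_sum_le (hS : SliceGeom (Fin 3) G Γ Rc) {y w : Fin 3 → ℝ}
    {u : Fin 3 → Fin 3 → ℝ} (hu : ∀ i j, G y (u i) (u j) = if i = j then 1 else 0)
    {a b m h CT Ct L W ν σ q : ℝ} {Qp Qm : Fin 3 → ℝ} {κ : ℝ} (hκ : 0 ≤ κ)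
    (hL : G y w w ≤ L ^ 2) (hW : ‖w‖ ≤ W) (hσ : 0 < σ) (hm0 : 0 ≤ m) (hm1 : m ≤ 1)
    (ha : a = 1 - m ^ 2) (hb : b = 2 / σ * m) (hh : h ∈ Icc (0 : ℝ) 1)
    (hκm : 0 < m → Rc y w w ≤ κ * G y w w) (hCt : 0 ≤ Ct)
    (hq : q ≤ G y w w + 2 * h ^ 2 * Rc y w w + Ct * (h ^ 2) ^ 2 * ‖w‖ ^ 2)
    (hQ : ∀ i, Qp i + Qm i ≤ 2 * G y w w + h ^ 2 * (2 * G y (b • u i) (b • u i)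
      + 2 * G y w (jacobiOp Γ y (a • u i) w)) + CT * h ^ 3)
    (hν : ν = (12 / σ + 2 * κ * L ^ 2 * σ) * b) :
    ∑ i, (Qp i + Qm i) + q ≤ 7 * L ^ 2 + h ^ 2 * ν + (3 * CT + Ct * W ^ 2) * h ^ 3 := by
  have hs := Finset.sum_le_sum fun i (_ : i ∈ Finset.univ) => hQ i
  have hR := hS.ricci y u hu w
  have e1 : ∀ i, G y (b • u i) (b • u i) = b ^ 2 := fun i => by
    simp only [map_smul, _root_.smul_apply, hu, smul_eq_mul]
    simp; ring
  have e2 : ∀ i, G y w (jacobiOp Γ y (a • u i) w) = a ^ 2 * G y w (jacobiOp Γ y (u i) w) :=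
    fun i => by rw [jacobiOp_smul, map_smul, smul_eq_mul]
  simp only [e1, e2] at hs
  have e3 : ∑ i : Fin 3, (2 * G y w w + h ^ 2 * (2 * b ^ 2 + 2 *
      (a ^ 2 * G y w (jacobiOp Γ y (u i) w))) + CT * h ^ 3)
      = 6 * G y w w + h ^ 2 * (6 * b ^ 2 + 2 * a ^ 2 * (-Rc y w w)) + 3 * CT * h ^ 3 := by
    rw [← hR]
    simp only [Fin.sum_univ_three]
    ring
  rw [e3] at hs
  have hwW : ‖w‖ ^ 2 ≤ W ^ 2 := pow_le_pow_left₀ (norm_nonneg _) hW 2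
  have h43 : (h ^ 2) ^ 2 ≤ h ^ 3 := by
    have : 0 ≤ h ^ 3 * (1 - h) := mul_nonneg (pow_nonneg hh.1 3) (by linarith [hh.2])
    nlinarith
  have t1 : Ct * (h ^ 2) ^ 2 * ‖w‖ ^ 2 ≤ Ct * W ^ 2 * h ^ 3 := by
    calc Ct * (h ^ 2) ^ 2 * ‖w‖ ^ 2 ≤ Ct * h ^ 3 * W ^ 2 := by
          have := pow_nonneg hh.1 3
          gcongr
      _ = _ := by ring
  have hq0 : 0 ≤ L ^ 2 := sq_nonneg L
  have key : 6 * b ^ 2 + 2 * (1 - a ^ 2) * Rc y w w ≤ ν := by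
    have hν' : ν = (24 / σ ^ 2 + 4 * κ * L ^ 2) * m := by
      rw [hν, hb]; field_simp; ring
    have hb2 : 6 * b ^ 2 = 24 / σ ^ 2 * m ^ 2 := by rw [hb]; field_simp; ring
    have hm2 : m ^ 2 ≤ m := by nlinarith
    have hr : 2 * (1 - a ^ 2) * Rc y w w ≤ 4 * κ * L ^ 2 * m := by
      rcases hm0.eq_or_lt with h0 | h0
      · rw [ha, ← h0]; simp
      · have h1 : 1 - a ^ 2 ≤ 2 * m := by rw [ha]; nlinarith [sq_nonneg (m ^ 2)]
        have h2 : 0 ≤ 1 - a ^ 2 := by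
          rw [ha]
          have : 0 ≤ m ^ 2 * (2 - m ^ 2) := mul_nonneg (sq_nonneg m) (by nlinarith)
          nlinarith
        have h3 : Rc y w w ≤ κ * L ^ 2 := (hκm h0).trans (by gcongr)
        have h4 : 0 ≤ κ * L ^ 2 := by positivity
        calc 2 * (1 - a ^ 2) * Rc y w w ≤ 2 * (1 - a ^ 2) * (κ * L ^ 2) := by gcongr
          _ ≤ 2 * (2 * m) * (κ * L ^ 2) := by gcongr
          _ = _ := by ring
    have : 24 / σ ^ 2 * m ^ 2 ≤ 24 / σ ^ 2 * m := by gcongr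
    rw [hν', hb2]
    linarith
  have := mul_le_mul_of_nonneg_left key (sq_nonneg h)
  linarith

/-- Combined second variation and time variation inequality for the squared distance. -/
theorem SliceGeom.second_variation (hS : SliceGeom (Fin 3) G Γ Rc) {x₀ x : Fin 3 → ℝ}
    (hb : ∀ r, BddBall G x₀ r) {e : Fin 3 → Fin 3 → ℝ}
    (he : ∀ i j, G x (e i) (e j) = if i = j then 1 else 0) {κ : ℝ} (hκ : 0 ≤ κ)
    (hRc : ∀ y, gDist G x₀ y ≤ 2 → ∀ w, Rc y w w ≤ κ * G y w w)
    {Gt : ℝ → (Fin 3 → ℝ) → (Fin 3 → ℝ) →L[ℝ] (Fin 3 → ℝ) →L[ℝ] ℝ}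
    (htc : ∀ τ, 0 ≤ τ → Continuous (Gt τ)) (htp : ∀ τ, 0 ≤ τ → ∀ y w, 0 ≤ Gt τ y w w)
    (ht : ∀ R, ∃ C, 0 ≤ C ∧ ∀ y, ‖y‖ ≤ R → ∀ τ ∈ Icc (0 : ℝ) 1, ∀ w,
      Gt τ y w w ≤ G y w w + 2 * τ * Rc y w w + C * τ ^ 2 * ‖w‖ ^ 2) :
    ∃ C, ∀ h ∈ Ioc (0 : ℝ) 1,
      ∑ i, (gDist G x₀ (quadPt Γ x (e i) h) ^ 2 + gDist G x₀ (quadPt Γ x (e i) (-h)) ^ 2)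
        + gDist (Gt (h ^ 2)) x₀ x ^ 2
      ≤ 7 * gDist G x₀ x ^ 2 + h ^ 2 * ((12 + 8 * κ) * max (gDist G x₀ x) 1) + C * h ^ 3 := by
  have hG := hS.smooth.continuous
  have hpos0 : ∀ y v, 0 ≤ G y v v := fun y v => nonneg_of_pos_of_ne (hS.pos y) v
  set l := gDist G x₀ x with hl
  have hl0 : 0 ≤ l := gDist_nonneg _ _ _
  set M := max l 1 with hM
  have hM1 : 1 ≤ M := le_max_right _ _
  have hMl : l ≤ M := le_max_left _ _
  have hM0 : 0 < M := by linarith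
  set σ := 1 / M with hσ
  have hσ0 : 0 < σ := by positivity
  have hσ1 : σ ≤ 1 := by rw [hσ, div_le_one hM0]; exact hM1
  obtain ⟨R, hR⟩ := hb (l + 1)
  obtain ⟨c, hc0, hc⟩ := exists_lower_bound hG hS.pos (isCompact_closedBall (0 : Fin 3 → ℝ) R)
  set W := 1 + (l + 1) ^ 2 / c with hW
  set U := 1 + 1 / c with hU
  have hU0 : 0 ≤ U := by positivity
  set K : Set ((Fin 3 → ℝ) × (Fin 3 → ℝ) × (Fin 3 → ℝ) × (Fin 3 → ℝ)) :=
    Metric.closedBall 0 R ×ˢ Metric.closedBall 0 W ×ˢ Metric.closedBall 0 U ×ˢ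
      Metric.closedBall 0 (2 / σ * U) with hK
  have hKc : IsCompact K := (isCompact_closedBall _ _).prod ((isCompact_closedBall _ _).prod
    ((isCompact_closedBall _ _).prod (isCompact_closedBall _ _)))
  obtain ⟨CT, -, hCT⟩ := exists_uniform_taylor hS.contDiff_energy hS.hasDerivAt_energy
    hS.hasDerivAt_energy_second hKc
  obtain ⟨Ct, hCt0, hCt⟩ := ht R
  refine ⟨7 * (2 * l + 1) + (3 * CT + Ct * W ^ 2), fun h hh => ?_⟩
  have hh3 : 0 < h ^ 3 := pow_pos hh.1 3
  have hh31 : h ^ 3 ≤ 1 := pow_le_one₀ hh.1.le hh.2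
  set L := l + h ^ 3 with hL
  have hL0 : 0 ≤ L := by positivity
  obtain ⟨γ, w, hγ, hγ0, hγ1, hspeed⟩ := exists_path_of_gDist_lt hG hpos0
    (show gDist G x₀ x < L by linarith)
  have hdist : ∀ s ∈ Icc (0 : ℝ) 1, gDist G x₀ (γ s) ≤ s * L := fun s hs => by
    have := hγ.gDist_subpath_le hG le_rfl hs.1 hs.2 hL0
      (fun r hr => hspeed r ⟨hr.1, hr.2.trans hs.2⟩)
    rwa [hγ0, sub_zero] at this
  have hγR : ∀ s ∈ Icc (0 : ℝ) 1, ‖γ s‖ ≤ R := fun s hs =>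
    hR _ ((hdist s hs).trans (by nlinarith [hs.1, hs.2]))
  have hwW : ∀ s ∈ Icc (0 : ℝ) 1, ‖w s‖ ≤ W := fun s hs =>
    le_one_add_of_mul_sq_le hc0 ((hc (γ s) (by simpa using hγR s hs) (w s)).trans
      ((hspeed s hs).trans (pow_le_pow_left₀ hL0 (by linarith) 2)))
  choose u hu1 hu using fun i => exists_parallel hS.smooth_conn.continuous hγ (e i)
  have huo : ∀ s ∈ Icc (0 : ℝ) 1, ∀ i j, G (γ s) (u i s) (u j s) = if i = j then 1 else 0 :=
    fun s hs i j => by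
      rw [hS.parallel_form_eq hγ (hu i) (hu j) hs, hγ1, hu1, hu1, he]
  have huU : ∀ s ∈ Icc (0 : ℝ) 1, ∀ i, ‖u i s‖ ≤ U := fun s hs i =>
    le_one_add_of_mul_sq_le hc0 ((hc (γ s) (by simpa using hγR s hs) (u i s)).trans
      (by rw [huo s hs]; simp))
  set m : ℝ → ℝ := fun s => max 0 (1 - s / σ) with hm
  set f : ℝ → ℝ := fun s => 1 - m s ^ 2 with hf
  set f' : ℝ → ℝ := fun s => 2 / σ * m s with hf'
  have hfd : ∀ s, HasDerivAt f (f' s) s := fun s => by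
    have h1 : HasDerivAt (fun s : ℝ => 1 - s / σ) (-(1 / σ)) s :=
      ((hasDerivAt_id s).div_const σ).const_sub 1
    have := ((hasDerivAt_max_zero_sq (1 - s / σ)).comp s h1).const_sub 1
    refine this.congr_deriv ?_
    simp only [hf', hm]; ring
  have hf'c : Continuous f' := by simp only [hf', hm]; fun_prop
  have hm0 : ∀ s, 0 ≤ m s := fun s => le_max_left _ _
  have hm1 : ∀ s ∈ Icc (0 : ℝ) 1, m s ≤ 1 := fun s hs =>
    max_le zero_le_one (by have := div_nonneg hs.1 hσ0.le; linarith)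
  have hf0 : f 0 = 0 := by simp [hf, hm]
  have hf1 : f 1 = 1 := by
    have : (1 : ℝ) ≤ 1 / σ := by rw [le_div_iff₀ hσ0]; linarith
    simp only [hf, hm]
    rw [max_eq_left (by linarith)]; ring
  set z : Fin 3 → ℝ → (Fin 3 → ℝ) × (Fin 3 → ℝ) × (Fin 3 → ℝ) × (Fin 3 → ℝ) :=
    fun i s => (γ s, w s, f s • u i s, f' s • u i s) with hz
  have hzK : ∀ i, ∀ s ∈ Icc (0 : ℝ) 1, z i s ∈ K := fun i s hs => by
    have hfs : |f s| ≤ 1 := by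
      simp only [hf]
      have h0 := hm0 s
      have h1 := hm1 s hs
      exact abs_le.mpr ⟨by nlinarith, by nlinarith⟩
    have hfs' : |f' s| ≤ 2 / σ := by
      simp only [hf']
      rw [abs_of_nonneg (mul_nonneg (by positivity) (hm0 s))]
      exact mul_le_of_le_one_right (by positivity) (hm1 s hs)
    simp only [hK, hz, mem_prod, mem_closedBall_zero_iff, norm_smul, Real.norm_eq_abs]
    refine ⟨hγR s hs, hwW s hs, ?_, ?_⟩
    · exact (mul_le_of_le_one_left (norm_nonneg _) hfs).trans (huU s hs i)
    · exact mul_le_mul hfs' (huU s hs i) (norm_nonneg _) (by positivity)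
  set Q : ℝ → Fin 3 → ℝ → ℝ := fun k i s =>
    G (varPt Γ k (z i s)) (varSpeed Γ k (z i s)) (varSpeed Γ k (z i s)) with hQ
  have hvar := fun k i => hS.isC1Path_variation hγ (hu i) hfd hf'c k
  have hQc : ∀ k i, ContinuousOn (Q k i) (Icc 0 1) := fun k i =>
    (hvar k i).2.continuousOn_form hG
  have hend : ∀ k i, gDist G x₀ (quadPt Γ x (e i) k) ^ 2 ≤ ∫ s in (0 : ℝ)..1, Q k i s :=
    fun k i => by
      have := (hvar k i).2.gDist_sq_le hG hpos0 (hQc k i) (fun s _ => le_rfl)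
      simpa [varPt, quadPt, hγ0, hγ1, hf0, hf1, hu1] using this
  set φ : ℝ → ℝ := fun s => G (γ s) (w s) (w s) + 2 * h ^ 2 * Rc (γ s) (w s) (w s)
    + Ct * (h ^ 2) ^ 2 * ‖w s‖ ^ 2 with hφ
  have hh2 : h ^ 2 ∈ Icc (0 : ℝ) 1 := ⟨sq_nonneg h, pow_le_one₀ hh.1.le hh.2⟩
  set ψ : ℝ → ℝ := fun s => Gt (h ^ 2) (γ s) (w s) (w s) with hψ
  have hψc : ContinuousOn ψ (Icc 0 1) := hγ.continuousOn_form (htc _ hh2.1)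
  have htime : gDist (Gt (h ^ 2)) x₀ x ^ 2 ≤ ∫ s in (0 : ℝ)..1, ψ s := by
    have := hγ.gDist_sq_le (htc _ hh2.1) (htp _ hh2.1) hψc (fun s _ => le_rfl)
    rwa [hγ0, hγ1] at this
  set A := 12 / σ + 2 * κ * L ^ 2 * σ with hA
  set B := 7 * L ^ 2 + (3 * CT + Ct * W ^ 2) * h ^ 3 with hB
  have hpt : ∀ s ∈ Icc (0 : ℝ) 1, ∑ i, (Q h i s + Q (-h) i s) + ψ s
      ≤ B + h ^ 2 * A * f' s := fun s hs => by
    have := hS.density_sum_le (huo s hs) (a := f s) (b := f' s) (m := m s) (h := h) (CT := CT)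
      (Ct := Ct) (L := L) (W := W) (σ := σ) (q := ψ s) (Qp := fun i => Q h i s)
      (Qm := fun i => Q (-h) i s) (κ := κ) hκ (hspeed s hs) (hwW s hs) hσ0 (hm0 s) (hm1 s hs)
      rfl rfl ⟨hh.1.le, hh.2⟩ (fun hms => hRc _ ((hdist s hs).trans ?_) _) hCt0
      (hCt _ (hγR s hs) _ hh2 _) (fun i => ?_) rfl
    · linarith
    · have h1 : 0 < 1 - s / σ := by
        by_contra hcon
        simp only [hm, max_eq_left (not_lt.mp hcon), lt_irrefl] at hms
      have h2 : s * M ≤ 1 := by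
        have : s / σ = s * M := by rw [hσ]; field_simp
        linarith
      have h3 : L ≤ 2 * M := by linarith
      nlinarith [hs.1]
    · have := hCT (z i s) (hzK i s hs) h ⟨hh.1.le, hh.2⟩
      have e0 : varPt Γ 0 (z i s) = γ s := by simp [varPt, hz]
      have e1 : varSpeed Γ 0 (z i s) = w s := by simp [varSpeed, hz]
      simp only [e0, e1] at this
      exact this
  have hi : ∀ {p : ℝ → ℝ}, ContinuousOn p (Icc 0 1) → IntervalIntegrable p volume 0 1 :=
    fun hp => ContinuousOn.intervalIntegrable (by rwa [uIcc_of_le zero_le_one])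
  have hsc : ContinuousOn (fun s => ∑ i, (Q h i s + Q (-h) i s)) (Icc 0 1) :=
    continuousOn_finsetSum _ fun i _ => (hQc h i).add (hQc (-h) i)
  have hint := intervalIntegral.integral_mono_on zero_le_one (hi (hsc.add hψc))
    (hi (continuousOn_const.add (continuousOn_const.mul hf'c.continuousOn))) hpt
  have hf'i : ∫ s in (0 : ℝ)..1, f' s = 1 := by
    rw [intervalIntegral.integral_eq_sub_of_hasDerivAt (fun s _ => hfd s)
      (hf'c.intervalIntegrable _ _), hf0, hf1, sub_zero]
  have hlhs : ∫ s in (0 : ℝ)..1, (∑ i, (Q h i s + Q (-h) i s) + ψ s)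
      = ∑ i, ((∫ s in (0 : ℝ)..1, Q h i s) + ∫ s in (0 : ℝ)..1, Q (-h) i s)
        + ∫ s in (0 : ℝ)..1, ψ s := by
    rw [intervalIntegral.integral_add (hi hsc) (hi hψc), intervalIntegral.integral_finsetSum
      (f := fun i s => Q h i s + Q (-h) i s) (fun i _ => hi ((hQc h i).add (hQc (-h) i)))]
    congr 1
    exact Finset.sum_congr rfl fun i _ =>
      intervalIntegral.integral_add (hi (hQc h i)) (hi (hQc (-h) i))
  have hrhs : ∫ s in (0 : ℝ)..1, (B + h ^ 2 * A * f' s) = B + h ^ 2 * A := by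
    rw [intervalIntegral.integral_add (by simp) ((hf'c.intervalIntegrable _ _).const_mul _),
      intervalIntegral.integral_const_mul, hf'i]
    simp
  have hint' : ∑ i, ((∫ s in (0 : ℝ)..1, Q h i s) + ∫ s in (0 : ℝ)..1, Q (-h) i s)
      + ∫ s in (0 : ℝ)..1, ψ s ≤ B + h ^ 2 * A := by
    rw [← hlhs, ← hrhs]; exact hint
  have hsum := Finset.sum_le_sum fun i (_ : i ∈ (Finset.univ : Finset (Fin 3))) =>
    add_le_add (hend h i) (hend (-h) i)
  have hAM : A ≤ (12 + 8 * κ) * M := by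
    have h1 : 12 / σ = 12 * M := by rw [hσ]; field_simp
    have h2 : L ^ 2 * σ ≤ 4 * M := by
      rw [hσ, mul_one_div, div_le_iff₀ hM0]
      nlinarith
    have h3 := mul_le_mul_of_nonneg_left h2 (mul_nonneg two_pos.le hκ)
    rw [hA, h1]
    linarith
  have hLl : L ^ 2 ≤ l ^ 2 + (2 * l + 1) * h ^ 3 := by
    have := mul_le_mul_of_nonneg_left hh31 hh3.le
    rw [hL]; linarith
  have hfin := mul_le_mul_of_nonneg_left hAM (sq_nonneg h)
  have h6 : B ≤ 7 * l ^ 2 + (7 * (2 * l + 1) + (3 * CT + Ct * W ^ 2)) * h ^ 3 := by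
    rw [hB]; linarith
  linarith

end SecondVariationInequality

section BarrierCalculus

open Filter Topology

/-- The symmetric second difference quotient converges to the second derivative. -/
theorem tendsto_symm_second_difference {f f1 : ℝ → ℝ} {f2 : ℝ}
    (hf : ∀ᶠ h in 𝓝 0, HasDerivAt f (f1 h) h) (hf1 : HasDerivAt f1 f2 0) :
    Tendsto (fun h => (f h + f (-h) - 2 * f 0) / h ^ 2) (𝓝[>] 0) (𝓝 f2) := by
  have hneg : Tendsto (fun h : ℝ => -h) (𝓝 0) (𝓝 0) := by
    simpa using (continuous_neg (G := ℝ)).tendsto 0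
  have hf' : ∀ᶠ h in 𝓝 (0 : ℝ), HasDerivAt (fun h => f h + f (-h) - 2 * f 0) (f1 h - f1 (-h)) h := by
    filter_upwards [hf, hneg.eventually hf] with h h1 h2
    exact ((h1.add (h2.scomp h (hasDerivAt_neg h))).sub_const _).congr_deriv (by simp [sub_eq_add_neg])
  refine HasDerivAt.lhopital_zero_nhdsGT (f' := fun h => f1 h - f1 (-h)) (g' := fun h => 2 * h)
    (nhdsWithin_le_nhds hf') (Eventually.of_forall fun h => by simpa using hasDerivAt_pow 2 h) ?_ ?_ ?_ ?_
  · filter_upwards [self_mem_nhdsWithin] with h hh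
    exact (mul_pos two_pos hh).ne'
  · have := hf'.self_of_nhds.continuousAt.tendsto
    have h0 : f 0 + f (-0) - 2 * f 0 = 0 := by rw [neg_zero]; ring
    rw [h0] at this
    exact this.mono_left nhdsWithin_le_nhds
  · have : ContinuousAt (fun h : ℝ => h ^ 2) 0 := by fun_prop
    simpa using this.tendsto.mono_left nhdsWithin_le_nhds
  · have h1 : HasDerivAt (fun h => (f1 h - f1 (-h)) / 2) f2 0 := by
      have h2 : HasDerivAt f1 f2 (-0) := by simpa using hf1
      refine ((hf1.sub (h2.scomp 0 (hasDerivAt_neg 0))).div_const 2).congr_deriv ?_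
      simp
    have := h1.tendsto_slope_zero_right
    refine this.congr' ?_
    filter_upwards [self_mem_nhdsWithin] with h hh
    have : h ≠ 0 := ne_of_gt hh
    simp
    field_simp

theorem tendsto_difference_quotient {f : ℝ → ℝ} {a : ℝ} (hf : HasDerivAt f a 0) :
    Tendsto (fun h => (f h - f 0) / h) (𝓝[>] 0) (𝓝 a) := by
  refine hf.tendsto_slope_zero_right.congr fun h => ?_
  simp [div_eq_inv_mul]

theorem one_div_sqrt_le {u : ℝ} (hu : 3 / 4 ≤ u) :
    1 / √u ≤ 1 - (u - 1) / 2 + (u - 1) ^ 2 / 2 := by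
  set x := u - 1 with hx
  have hux : u = 1 + x := by rw [hx]; ring
  have hx0 : -(1 / 4) ≤ x := by linarith
  have hA : 0 ≤ 1 - x / 2 + x ^ 2 / 2 := by nlinarith [sq_nonneg (x - 1 / 2)]
  rw [div_le_iff₀ (Real.sqrt_pos.mpr (by linarith))]
  have h1 : 1 ≤ (1 - x / 2 + x ^ 2 / 2) ^ 2 * u := by
    rw [hux]
    have : (1 - x / 2 + x ^ 2 / 2) ^ 2 * (1 + x) = 1 + x ^ 2 * (1 / 4 + 3 / 4 * x - x ^ 2 / 4 + x ^ 3 / 4) := by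
      ring
    rw [this]
    have : 0 ≤ 1 / 4 + 3 / 4 * x - x ^ 2 / 4 + x ^ 3 / 4 := by
      have : 0 ≤ (x + 1 / 4) * (x ^ 2 - 5 / 4 * x + 53 / 16) :=
        mul_nonneg (by linarith) (by nlinarith [sq_nonneg (x - 5 / 8)])
      nlinarith
    nlinarith [sq_nonneg x]
  have h2 : √(1 : ℝ) ≤ √((1 - x / 2 + x ^ 2 / 2) ^ 2 * u) := Real.sqrt_le_sqrt h1
  rwa [Real.sqrt_one, Real.sqrt_mul (sq_nonneg _), Real.sqrt_sq hA] at h2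

theorem barrier_lower {ρ θ l u : ℝ} (hθ : 0 ≤ θ) (hl : l ^ 2 = ρ ^ 2 * (1 - θ))
    (hu : 3 / 4 ≤ u) :
    l ^ 2 + ρ ^ 2 * θ * ((u - 1) / 2 - (u - 1) ^ 2 / 2) ≤ ρ ^ 2 * (1 - θ / √u) := by
  have h := mul_le_mul_of_nonneg_left (one_div_sqrt_le hu) (mul_nonneg (sq_nonneg ρ) hθ)
  have : ρ ^ 2 * θ * (1 / √u) = ρ ^ 2 * (θ / √u) := by ring
  rw [hl]
  nlinarith

/-- Passing to the limit in the combined second variation inequality for a barrier of the squared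
distance. -/
theorem barrier_second_order {ι : Type*} [Fintype ι] {ρ θ l β C c N : ℝ} {a b : ι → ℝ}
    {u u1 : ι → ℝ → ℝ} {ut : ℝ → ℝ} {D : ι → ℝ → ℝ} {Dt : ℝ → ℝ}
    (hθ : 0 ≤ θ) (hl : l ^ 2 = ρ ^ 2 * (1 - θ)) (hN : N = 2 * Fintype.card ι + 1)
    (hu0 : ∀ i, u i 0 = 1) (hu : ∀ i, ∀ᶠ h in 𝓝 0, HasDerivAt (u i) (u1 i h) h)
    (hu1 : ∀ i, u1 i 0 = a i) (hu2 : ∀ i, HasDerivAt (u1 i) (b i) 0)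
    (ht0 : ut 0 = 1) (ht : HasDerivAt ut (-c) 0)
    (hD : ∀ i h, 0 < u i h → ρ ^ 2 * (1 - θ / √(u i h)) ≤ D i h)
    (hDt : ∀ᶠ h in 𝓝[>] 0, 0 < ut (h ^ 2) → ρ ^ 2 * (1 - θ / √(ut (h ^ 2))) ≤ Dt h)
    (hsum : ∀ᶠ h in 𝓝[>] 0, ∑ i, (D i h + D i (-h)) + Dt h ≤ N * l ^ 2 + h ^ 2 * β + C * h ^ 3) :
    ρ ^ 2 * θ * (∑ i, (b i / 2 - a i ^ 2) - c / 2) ≤ β := by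
  have hneg : Tendsto (fun h : ℝ => -h) (𝓝 0) (𝓝 0) := by
    simpa using (continuous_neg (G := ℝ)).tendsto 0
  have hsq : Tendsto (fun h : ℝ => h ^ 2) (𝓝[>] 0) (𝓝[>] 0) := by
    refine tendsto_nhdsWithin_iff.mpr ⟨?_, ?_⟩
    · have : ContinuousAt (fun h : ℝ => h ^ 2) 0 := by fun_prop
      simpa using this.tendsto.mono_left nhdsWithin_le_nhds
    · filter_upwards [self_mem_nhdsWithin] with h hh
      exact pow_pos (show (0 : ℝ) < h from hh) 2
  have hda : ∀ i, HasDerivAt (u i) (a i) 0 := fun i => by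
    rw [← hu1 i]; exact (hu i).self_of_nhds
  have hev : ∀ i, ∀ᶠ h in 𝓝[>] (0 : ℝ), 3 / 4 ≤ u i h ∧ 3 / 4 ≤ u i (-h) := fun i => by
    have : ∀ᶠ h in 𝓝 (0 : ℝ), 3 / 4 ≤ u i h :=
      (hda i).continuousAt.eventually (Ici_mem_nhds (by rw [hu0]; norm_num))
    exact nhdsWithin_le_nhds (this.and (hneg.eventually this))
  have hevt : ∀ᶠ h in 𝓝[>] (0 : ℝ), 3 / 4 ≤ ut (h ^ 2) := by
    have : ∀ᶠ h in 𝓝 (0 : ℝ), 3 / 4 ≤ ut h :=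
      ht.continuousAt.eventually (Ici_mem_nhds (by rw [ht0]; norm_num))
    exact hsq.eventually (nhdsWithin_le_nhds this)
  have h0 : Tendsto (fun h : ℝ => h) (𝓝[>] 0) (𝓝 0) := nhdsWithin_le_nhds
  have lim1 : ∀ i, Tendsto (fun h => (u i h + u i (-h) - 2 * u i 0) / h ^ 2 / 2
      - (((u i h - u i 0) / h) ^ 2 + ((u i (-h) - u i (-0)) / h) ^ 2) / 2) (𝓝[>] 0)
      (𝓝 (b i / 2 - (a i ^ 2 + (-a i) ^ 2) / 2)) := fun i => by
    have hm : HasDerivAt (fun h => u i (-h)) (-a i) 0 := by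
      have h2 : HasDerivAt (u i) (a i) (-0) := by simpa using hda i
      exact (h2.scomp 0 (hasDerivAt_neg 0)).congr_deriv (by simp)
    exact ((tendsto_symm_second_difference (hu i) (hu2 i)).div_const 2).sub
      ((((tendsto_difference_quotient (hda i)).pow 2).add
        ((tendsto_difference_quotient hm).pow 2)).div_const 2)
  have limt : Tendsto (fun h => (ut (h ^ 2) - ut 0) / h ^ 2 / 2
      - ((ut (h ^ 2) - ut 0) / h ^ 2) ^ 2 * h * h / 2) (𝓝[>] 0) (𝓝 (-c / 2 - (-c) ^ 2 * 0 * 0 / 2)) := by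
    have := (tendsto_difference_quotient ht).comp hsq
    exact (this.div_const 2).sub ((((this.pow 2).mul h0).mul h0).div_const 2)
  have limL := ((tendsto_finsetSum Finset.univ fun i _ => lim1 i).add limt).const_mul (ρ ^ 2 * θ)
  have limR : Tendsto (fun h : ℝ => β + C * h) (𝓝[>] 0) (𝓝 (β + C * 0)) :=
    tendsto_const_nhds.add (h0.const_mul C)
  have hle : ∀ᶠ h in 𝓝[>] (0 : ℝ), ρ ^ 2 * θ * (∑ i, ((u i h + u i (-h) - 2 * u i 0) / h ^ 2 / 2
      - (((u i h - u i 0) / h) ^ 2 + ((u i (-h) - u i (-0)) / h) ^ 2) / 2)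
      + ((ut (h ^ 2) - ut 0) / h ^ 2 / 2 - ((ut (h ^ 2) - ut 0) / h ^ 2) ^ 2 * h * h / 2))
      ≤ β + C * h := by
    filter_upwards [eventually_all.mpr hev, hevt, hDt, hsum, self_mem_nhdsWithin]
      with h e1 e2 e3 e4 hh
    have hh0 : (0 : ℝ) < h := hh
    have k1 : ∀ i, 2 * l ^ 2 + ρ ^ 2 * θ * ((u i h - 1) / 2 - (u i h - 1) ^ 2 / 2)
        + ρ ^ 2 * θ * ((u i (-h) - 1) / 2 - (u i (-h) - 1) ^ 2 / 2) ≤ D i h + D i (-h) := fun i => by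
      have a1 := (barrier_lower hθ hl (e1 i).1).trans (hD i h (by linarith [(e1 i).1]))
      have a2 := (barrier_lower hθ hl (e1 i).2).trans (hD i (-h) (by linarith [(e1 i).2]))
      linarith
    have k2 := (barrier_lower hθ hl e2).trans (e3 (by linarith))
    have k3 := Finset.sum_le_sum fun i (_ : i ∈ Finset.univ) => k1 i
    have k4 : ∑ i : ι, (2 * l ^ 2 + ρ ^ 2 * θ * ((u i h - 1) / 2 - (u i h - 1) ^ 2 / 2)
        + ρ ^ 2 * θ * ((u i (-h) - 1) / 2 - (u i (-h) - 1) ^ 2 / 2))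
        = 2 * Fintype.card ι * l ^ 2 + h ^ 2 * (ρ ^ 2 * θ *
          ∑ i, ((u i h + u i (-h) - 2 * u i 0) / h ^ 2 / 2
      - (((u i h - u i 0) / h) ^ 2 + ((u i (-h) - u i (-0)) / h) ^ 2) / 2)) := by
      rw [Finset.mul_sum, Finset.mul_sum,
        show 2 * (Fintype.card ι : ℝ) * l ^ 2 = ∑ _i : ι, 2 * l ^ 2 by simp; ring,
        ← Finset.sum_add_distrib]
      refine Finset.sum_congr rfl fun i _ => ?_
      rw [neg_zero, hu0]
      field_simp
      ring
    have k5 : ρ ^ 2 * θ * ((ut (h ^ 2) - 1) / 2 - (ut (h ^ 2) - 1) ^ 2 / 2) = h ^ 2 * (ρ ^ 2 * θ *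
        ((ut (h ^ 2) - ut 0) / h ^ 2 / 2 - ((ut (h ^ 2) - ut 0) / h ^ 2) ^ 2 * h * h / 2)) := by
      rw [ht0]
      field_simp
    rw [k4] at k3
    rw [k5] at k2
    refine le_of_mul_le_mul_left ?_ (pow_pos hh0 2)
    rw [hN] at e4
    nlinarith
  have := le_of_tendsto_of_tendsto limL limR hle
  refine (le_of_eq ?_).trans (this.trans_eq (by ring))
  congr 1
  rw [sub_eq_add_neg]
  congr 1
  · exact Finset.sum_congr rfl fun i _ => by ring
  · ring

/-- First order consequence of a barrier for a squared distance of growth rate at most `2`. -/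
theorem barrier_first_order {ρ θ l a : ℝ} {u D : ℝ → ℝ} (hθ : 0 ≤ θ)
    (hl : l ^ 2 = ρ ^ 2 * (1 - θ)) (hu0 : u 0 = 1) (hu : HasDerivAt u a 0)
    (hD : ∀ h, 0 < u h → ρ ^ 2 * (1 - θ / √(u h)) ≤ D h)
    (hgr : ∀ᶠ h in 𝓝[>] 0, D h ≤ (l + 2 * h) ^ 2) : ρ ^ 2 * θ * a ≤ 8 * l := by
  have hev : ∀ᶠ h in 𝓝[>] (0 : ℝ), 3 / 4 ≤ u h :=
    nhdsWithin_le_nhds (hu.continuousAt.eventually (Ici_mem_nhds (by rw [hu0]; norm_num)))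
  have h0 : Tendsto (fun h : ℝ => h) (𝓝[>] 0) (𝓝 0) := nhdsWithin_le_nhds
  have hq := tendsto_difference_quotient hu
  have limL := ((hq.div_const 2).sub (((hq.pow 2).mul h0).div_const 2)).const_mul (ρ ^ 2 * θ)
  have limR : Tendsto (fun h : ℝ => 4 * l + 4 * h) (𝓝[>] 0) (𝓝 (4 * l + 4 * 0)) :=
    tendsto_const_nhds.add (h0.const_mul 4)
  have := le_of_tendsto_of_tendsto limL limR (by
    filter_upwards [hev, hgr, self_mem_nhdsWithin] with h e1 e2 hh
    have hh0 : (0 : ℝ) < h := hh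
    have := ((barrier_lower hθ hl e1).trans (hD h (by linarith))).trans e2
    refine le_of_mul_le_mul_left ?_ hh0
    rw [hu0]
    have e3 : h * (ρ ^ 2 * θ * ((u h - 1) / h / 2 - ((u h - 1) / h) ^ 2 * h / 2))
        = ρ ^ 2 * θ * ((u h - 1) / 2 - (u h - 1) ^ 2 / 2) := by field_simp
    rw [e3]
    nlinarith)
  linarith

end BarrierCalculus

section CovariantTaylor

open scoped ContDiff
open Topology Filter

variable {E : Type*} [NormedAddCommGroup E] [NormedSpace ℝ E]

/-- `P` and `Q` are the first and second covariant derivatives of the bilinear form `N` with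
respect to the connection `Γ`, expressed through the product rule along curves. -/
structure IsCovDeriv (Γ : E → E →L[ℝ] E →L[ℝ] E) (N : E → E →L[ℝ] E →L[ℝ] ℝ)
    (P : E → E → E → E → ℝ) (Q : E → E → E → E → E → ℝ) : Prop where
  form : ∀ {c u v : ℝ → E} {c' u' v' : E} {h : ℝ}, HasDerivAt c c' h → HasDerivAt u u' h →
    HasDerivAt v v' h → HasDerivAt (fun h => N (c h) (u h) (v h))
      (P (c h) c' (u h) (v h) + N (c h) (u' + Γ (c h) c' (u h)) (v h)
        + N (c h) (u h) (v' + Γ (c h) c' (v h))) h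
  deriv : ∀ {c w u v : ℝ → E} {c' w' u' v' : E} {h : ℝ}, HasDerivAt c c' h → HasDerivAt w w' h →
    HasDerivAt u u' h → HasDerivAt v v' h → HasDerivAt (fun h => P (c h) (w h) (u h) (v h))
      (Q (c h) c' (w h) (u h) (v h) + P (c h) (w' + Γ (c h) c' (w h)) (u h) (v h)
        + P (c h) (w h) (u' + Γ (c h) c' (u h)) (v h)
        + P (c h) (w h) (u h) (v' + Γ (c h) c' (v h))) h
  zero_left : ∀ x u v, P x 0 u v = 0
  zero_middle : ∀ x w v, P x w 0 v = 0
  zero_right : ∀ x w u, P x w u 0 = 0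

theorem SliceGeom.isCovDeriv {ι : Type*} [Fintype ι] [DecidableEq ι]
    {G : E → E →L[ℝ] E →L[ℝ] ℝ} {Γ : E → E →L[ℝ] E →L[ℝ] E} {Rc : E → E →L[ℝ] E →L[ℝ] ℝ}
    (hS : SliceGeom ι G Γ Rc) : IsCovDeriv Γ G (fun _ _ _ _ => 0) (fun _ _ _ _ _ => 0) where
  form hc hu hv := (hS.hasDerivAt_form hc hu hv).congr_deriv (by ring)
  deriv _ _ _ _ := (hasDerivAt_const _ _).congr_deriv (by ring)
  zero_left _ _ _ := rfl
  zero_middle _ _ _ := rfl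
  zero_right _ _ _ := rfl

variable {Γ : E → E →L[ℝ] E →L[ℝ] E}

theorem hasDerivAt_quadPt (x e : E) (h : ℝ) :
    HasDerivAt (quadPt Γ x e) (e - h • Γ x e e) h := by
  have h2 : HasDerivAt (fun h : ℝ => h ^ 2 / 2) h h := by
    simpa using (hasDerivAt_pow 2 h).div_const 2
  exact ((((hasDerivAt_id h).smul_const e).const_add x).sub (h2.smul_const _)).congr_deriv (by simp)

/-- Second order coefficient of parallel transport along `quadPt`. -/
def transportAcc (Γ : E → E →L[ℝ] E →L[ℝ] E) (x e v : E) : E :=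
  fderiv ℝ Γ x e e v - Γ x (Γ x e e) v - Γ x e (Γ x e v)

/-- Second order approximation of parallel transport along `quadPt`. -/
def quadVec (Γ : E → E →L[ℝ] E →L[ℝ] E) (x e v : E) (h : ℝ) : E :=
  v - h • Γ x e v - (h ^ 2 / 2) • transportAcc Γ x e v

/-- Covariant derivative of `quadVec` along `quadPt`. -/
def quadVecCov (Γ : E → E →L[ℝ] E →L[ℝ] E) (x e v : E) (h : ℝ) : E :=
  -Γ x e v - h • transportAcc Γ x e v
    + Γ (quadPt Γ x e h) (e - h • Γ x e e) (quadVec Γ x e v h)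

theorem hasDerivAt_quadVec (x e v : E) (h : ℝ) :
    HasDerivAt (quadVec Γ x e v) (-Γ x e v - h • transportAcc Γ x e v) h := by
  have h2 : HasDerivAt (fun h : ℝ => h ^ 2 / 2) h h := by
    simpa using (hasDerivAt_pow 2 h).div_const 2
  exact ((((hasDerivAt_id h).smul_const (Γ x e v)).const_sub v).sub (h2.smul_const _)).congr_deriv
    (by simp)

@[simp] theorem quadPt_zero (x e : E) : quadPt Γ x e 0 = x := by simp [quadPt]

@[simp] theorem quadVec_zero (x e v : E) : quadVec Γ x e v 0 = v := by simp [quadVec]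

@[simp] theorem quadVecCov_zero (x e v : E) : quadVecCov Γ x e v 0 = 0 := by simp [quadVecCov]

set_option maxSynthPendingDepth 3 in
theorem hasDerivAt_quadVecCov_zero (hΓ : Differentiable ℝ Γ) (x e v : E) :
    HasDerivAt (quadVecCov Γ x e v) 0 0 := by
  have h1 : HasDerivAt (fun h => Γ (quadPt Γ x e h)) _ 0 :=
    (hΓ (quadPt Γ x e 0)).hasFDerivAt.comp_hasDerivAt 0 (hasDerivAt_quadPt x e 0)
  have h2 : HasDerivAt (fun h : ℝ => e - h • Γ x e e) (-Γ x e e) 0 :=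
    (((hasDerivAt_id (0 : ℝ)).smul_const (Γ x e e)).const_sub e).congr_deriv (by simp)
  have h3 : HasDerivAt (fun h : ℝ => -Γ x e v - h • transportAcc Γ x e v)
      (-transportAcc Γ x e v) 0 :=
    (((hasDerivAt_id (0 : ℝ)).smul_const (transportAcc Γ x e v)).const_sub _).congr_deriv (by simp)
  refine (h3.add ((h1.clm_apply h2).clm_apply (hasDerivAt_quadVec x e v 0))).congr_deriv ?_
  simp [transportAcc]
  abel

/-- First derivative of a bilinear form along `quadPt` and `quadVec`. -/
def quadDeriv (Γ : E → E →L[ℝ] E →L[ℝ] E) (N : E → E →L[ℝ] E →L[ℝ] ℝ)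
    (P : E → E → E → E → ℝ) (x e v : E) (h : ℝ) : ℝ :=
  P (quadPt Γ x e h) (e - h • Γ x e e) (quadVec Γ x e v h) (quadVec Γ x e v h)
    + N (quadPt Γ x e h) (quadVecCov Γ x e v h) (quadVec Γ x e v h)
    + N (quadPt Γ x e h) (quadVec Γ x e v h) (quadVecCov Γ x e v h)

variable {N : E → E →L[ℝ] E →L[ℝ] ℝ} {P : E → E → E → E → ℝ} {Q : E → E → E → E → E → ℝ}

theorem IsCovDeriv.hasDerivAt_quad (hN : IsCovDeriv Γ N P Q) (x e v : E) (h : ℝ) :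
    HasDerivAt (fun h => N (quadPt Γ x e h) (quadVec Γ x e v h) (quadVec Γ x e v h))
      (quadDeriv Γ N P x e v h) h :=
  hN.form (hasDerivAt_quadPt x e h) (hasDerivAt_quadVec x e v h) (hasDerivAt_quadVec x e v h)

theorem quadDeriv_zero (x e v : E) : quadDeriv Γ N P x e v 0 = P x e v v := by
  simp [quadDeriv]

theorem IsCovDeriv.hasDerivAt_quadDeriv (hN : IsCovDeriv Γ N P Q) (hΓ : Differentiable ℝ Γ)
    (x e v : E) : HasDerivAt (quadDeriv Γ N P x e v) (Q x e e v v) 0 := by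
  have h2 : HasDerivAt (fun h : ℝ => e - h • Γ x e e) (-Γ x e e) 0 :=
    (((hasDerivAt_id (0 : ℝ)).smul_const (Γ x e e)).const_sub e).congr_deriv (by simp)
  have hc := hasDerivAt_quadPt (Γ := Γ) x e 0
  have hv := hasDerivAt_quadVec (Γ := Γ) x e v 0
  have hz := hasDerivAt_quadVecCov_zero hΓ x e v
  refine (((hN.deriv hc h2 hv hv).add (hN.form hc hz hv)).add (hN.form hc hv hz)).congr_deriv ?_
  simp [hN.zero_left, hN.zero_middle, hN.zero_right]

end CovariantTaylor

section BarrierPoint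

open scoped ContDiff
open Topology Filter

theorem hasDerivAt_quotient_second {s q2 : ℝ} {q q1 r r1 : ℝ → ℝ} (hs : s ≠ 0)
    (hq : ∀ h, HasDerivAt q (q1 h) h) (hq1 : HasDerivAt q1 q2 0)
    (hr : ∀ h, HasDerivAt r (r1 h) h) (hr1 : HasDerivAt r1 0 0) (hr0 : r 0 = 1) (hr10 : r1 0 = 0) :
    (∀ᶠ h in 𝓝 0, HasDerivAt (fun h => q h / (s * r h))
      ((q1 h * r h - q h * r1 h) / (s * r h ^ 2)) h) ∧
    HasDerivAt (fun h => (q1 h * r h - q h * r1 h) / (s * r h ^ 2)) (q2 / s) 0 := by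
  constructor
  · have : ∀ᶠ h in 𝓝 (0 : ℝ), r h ≠ 0 :=
      (hr 0).continuousAt.eventually_ne (by rw [hr0]; exact one_ne_zero)
    filter_upwards [this] with h hh
    refine ((hq h).div ((hr h).const_mul s) (mul_ne_zero hs hh)).congr_deriv ?_
    field_simp
  · refine ((((hq1.mul (hr 0)).sub ((hq 0).mul hr1))).div (((hr 0).pow 2).const_mul s)
      (by simp [hr0, hs])).congr_deriv ?_
    simp [hr0, hr10]
    field_simp

variable {E : Type*} [NormedAddCommGroup E] [NormedSpace ℝ E] {Γ : E → E →L[ℝ] E →L[ℝ] E}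

theorem isC1Path_quadPt (x e : E) (h : ℝ) :
    IsC1Path (fun s => quadPt Γ x e (s * h)) (fun s => h • (e - (s * h) • Γ x e e)) where
  cont := by fun_prop
  deriv s _ := by
    have h1 : HasDerivAt (fun s : ℝ => s * h) h s := by simpa using (hasDerivAt_id s).mul_const h
    exact ((hasDerivAt_quadPt x e (s * h)).scomp s h1).hasDerivWithinAt

theorem eventually_gDist_quadPt_le {G : E → E →L[ℝ] E →L[ℝ] ℝ} (hG : Continuous G) {x e : E}
    (he : G x e e = 1) : ∀ᶠ h in 𝓝[>] 0, gDist G x (quadPt Γ x e h) ≤ 2 * h := by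
  have hc : Continuous (quadPt Γ x e) :=
    continuous_iff_continuousAt.mpr fun h => (hasDerivAt_quadPt x e h).continuousAt
  have hcont : Continuous fun h : ℝ =>
      G (quadPt Γ x e h) (e - h • Γ x e e) (e - h • Γ x e e) := by fun_prop
  have hev : ∀ᶠ h in 𝓝 (0 : ℝ), G (quadPt Γ x e h) (e - h • Γ x e e) (e - h • Γ x e e) ≤ 4 :=
    hcont.continuousAt.eventually (Iic_mem_nhds (by simp [he]))
  obtain ⟨ε, hε, hb⟩ := Metric.eventually_nhds_iff.mp hev
  filter_upwards [Ioo_mem_nhdsGT hε] with h hh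
  have := (isC1Path_quadPt (Γ := Γ) x e h).gDist_le_of_speed_le hG (L := 2 * h) (by linarith [hh.1])
    fun s hs => by
      have h1 := hb (y := s * h) (by
        rw [dist_zero_right, Real.norm_eq_abs, abs_of_nonneg (mul_nonneg hs.1 hh.1.le)]
        nlinarith [hs.2, hh.1, hh.2])
      simp only [map_smul, _root_.smul_apply, smul_eq_mul]
      nlinarith [sq_nonneg h]
  simpa using this

end BarrierPoint

section LocalMaximum

open scoped ContDiff
open Topology Filter

/-- A complete Ricci flow on a space-time slab, in terms of bilinear forms. -/
structure FlowGeom (T : ℝ) (H : (Fin 3 → ℝ) × ℝ → (Fin 3 → ℝ) →L[ℝ] (Fin 3 → ℝ) →L[ℝ] ℝ)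
    (Γ : ℝ → (Fin 3 → ℝ) → (Fin 3 → ℝ) →L[ℝ] (Fin 3 → ℝ) →L[ℝ] (Fin 3 → ℝ))
    (Rc : ℝ → (Fin 3 → ℝ) → (Fin 3 → ℝ) →L[ℝ] (Fin 3 → ℝ) →L[ℝ] ℝ) : Prop where
  cont : ContinuousOn H (univ ×ˢ Iio T)
  slice : ∀ t < T, SliceGeom (Fin 3) (fun x => H (x, t)) (Γ t) (Rc t)
  bdd : ∀ t < T, ∀ x₀ r, BddBall (fun x => H (x, t)) x₀ r
  flow : ∀ t < T, ∀ x v, HasDerivAt (fun s => H (x, s) v v) (-2 * Rc t x v v) t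
  taylor : ∀ t < T, ∀ R, ∃ C, 0 ≤ C ∧ ∀ y, ‖y‖ ≤ R → ∀ τ ∈ Icc (0 : ℝ) 1, ∀ w,
    H (y, t - τ) w w ≤ H (y, t) w w + 2 * τ * Rc t y w w + C * τ ^ 2 * ‖w‖ ^ 2
  cont_ric : ContinuousOn (fun z : (Fin 3 → ℝ) × ℝ => Rc z.2 z.1) (univ ×ˢ Iio T)

/-- A time-dependent symmetric bilinear form along a Ricci flow whose reaction term is bounded below
by half the square of its least eigenvalue, wherever the latter is negative. -/
structure ReactionForm (T : ℝ) (H : (Fin 3 → ℝ) × ℝ → (Fin 3 → ℝ) →L[ℝ] (Fin 3 → ℝ) →L[ℝ] ℝ)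
    (Γ : ℝ → (Fin 3 → ℝ) → (Fin 3 → ℝ) →L[ℝ] (Fin 3 → ℝ) →L[ℝ] (Fin 3 → ℝ))
    (Rc : ℝ → (Fin 3 → ℝ) → (Fin 3 → ℝ) →L[ℝ] (Fin 3 → ℝ) →L[ℝ] ℝ)
    (N : (Fin 3 → ℝ) × ℝ → (Fin 3 → ℝ) →L[ℝ] (Fin 3 → ℝ) →L[ℝ] ℝ)
    (P : ℝ → (Fin 3 → ℝ) → (Fin 3 → ℝ) → (Fin 3 → ℝ) → (Fin 3 → ℝ) → ℝ)
    (Q : ℝ → (Fin 3 → ℝ) → (Fin 3 → ℝ) → (Fin 3 → ℝ) → (Fin 3 → ℝ) → (Fin 3 → ℝ) → ℝ)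
    (Nt : ℝ → (Fin 3 → ℝ) → (Fin 3 → ℝ) → ℝ) : Prop where
  cont : ContinuousOn N (univ ×ˢ Iio T)
  cov : ∀ t < T, IsCovDeriv (Γ t) (fun x => N (x, t)) (P t) (Q t)
  time : ∀ t < T, ∀ x v, HasDerivAt (fun s => N (x, s) v v) (Nt t x v) t
  reaction : ∀ t < T, ∀ x (e : Fin 3 → Fin 3 → ℝ),
    (∀ i j, H (x, t) (e i) (e j) = if i = j then 1 else 0) → ∀ v, H (x, t) v v = 1 →
    N (x, t) v v < 0 → (∀ w, N (x, t) v v * H (x, t) w w ≤ N (x, t) w w) →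
    (N (x, t) v v) ^ 2 / 2 ≤
      Nt t x v + 2 * N (x, t) v v * Rc t x v v - ∑ i, Q t x (e i) (e i) v v

variable {T : ℝ} {H : (Fin 3 → ℝ) × ℝ → (Fin 3 → ℝ) →L[ℝ] (Fin 3 → ℝ) →L[ℝ] ℝ}
  {Γ : ℝ → (Fin 3 → ℝ) → (Fin 3 → ℝ) →L[ℝ] (Fin 3 → ℝ) →L[ℝ] (Fin 3 → ℝ)}
  {Rc : ℝ → (Fin 3 → ℝ) → (Fin 3 → ℝ) →L[ℝ] (Fin 3 → ℝ) →L[ℝ] ℝ}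
  {N : (Fin 3 → ℝ) × ℝ → (Fin 3 → ℝ) →L[ℝ] (Fin 3 → ℝ) →L[ℝ] ℝ}
  {P : ℝ → (Fin 3 → ℝ) → (Fin 3 → ℝ) → (Fin 3 → ℝ) → (Fin 3 → ℝ) → ℝ}
  {Q : ℝ → (Fin 3 → ℝ) → (Fin 3 → ℝ) → (Fin 3 → ℝ) → (Fin 3 → ℝ) → (Fin 3 → ℝ) → ℝ}
  {Nt : ℝ → (Fin 3 → ℝ) → (Fin 3 → ℝ) → ℝ}

/-- Differential inequality at a point where the squared distance touches its barrier. -/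
theorem FlowGeom.barrier_inequality (hF : FlowGeom T H Γ Rc) (hN : ReactionForm T H Γ Rc N P Q Nt)
    {x₀ x v : Fin 3 → ℝ} {t₀ t ρ κ θ S l : ℝ} {e : Fin 3 → Fin 3 → ℝ} (ht₀ : t₀ < t) (ht : t < T)
    (he : ∀ i j, H (x, t) (e i) (e j) = if i = j then 1 else 0) (hv : H (x, t) v v = 1)
    (hSv : N (x, t) v v = S) (hS : S < 0) (hmin : ∀ w, S * H (x, t) w w ≤ N (x, t) w w)
    (hκ : 0 ≤ κ) (hRc : ∀ y, gDist (fun x => H (x, t)) x₀ y ≤ 2 → ∀ w, Rc t y w w ≤ κ * H (y, t) w w)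
    (hl : gDist (fun x => H (x, t)) x₀ x = l) (hθ : 0 < θ) (hρ : 1 ≤ ρ)
    (hlθ : l ^ 2 = ρ ^ 2 * (1 - θ))
    (hbar : ∀ s ∈ Icc t₀ t, ∀ y w, w ≠ 0 →
      0 < (s - t₀) * N (y, s) w w / ((t - t₀) * S * H (y, s) w w) →
      ρ ^ 2 * (1 - θ / √((s - t₀) * N (y, s) w w / ((t - t₀) * S * H (y, s) w w))) ≤
        gDist (fun x => H (x, s)) x₀ y ^ 2) :
    θ ^ 2 * ((t - t₀) * -S) / 2 ≤ 1 + (t - t₀) * (2 * (12 + 8 * κ) / ρ + 384 / ρ ^ 2) := by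
  have hSl := hF.slice t ht
  have hΓ : Differentiable ℝ (Γ t) := hSl.smooth_conn.differentiable (by simp)
  have hG : Continuous fun x => H (x, t) := continuous_slice hF.cont ht
  have hpos0 : ∀ y v, 0 ≤ H (y, t) v v := fun y v => nonneg_of_pos_of_ne (hSl.pos y) v
  have hl0 : 0 ≤ l := hl ▸ gDist_nonneg _ _ _
  have ht1 : 0 < t - t₀ := sub_pos.mpr ht₀
  have hρ0 : 0 < ρ := by linarith
  have hv0 : v ≠ 0 := by rintro rfl; simp at hv
  have hρθ : 0 < ρ ^ 2 * θ := by positivity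
  have hθ1 : θ ≤ 1 := by
    have : 0 ≤ ρ ^ 2 * (1 - θ) := hlθ ▸ sq_nonneg l
    have := nonneg_of_mul_nonneg_right this (by positivity)
    linarith
  have hlρ : l ≤ ρ := by
    refine le_of_sq_le_sq ?_ hρ0.le
    rw [hlθ]; nlinarith
  -- the quotient along the approximate geodesics
  set q : Fin 3 → ℝ → ℝ := fun i h => N (quadPt (Γ t) x (e i) h, t) (quadVec (Γ t) x (e i) v h)
    (quadVec (Γ t) x (e i) v h) with hq
  set r : Fin 3 → ℝ → ℝ := fun i h => H (quadPt (Γ t) x (e i) h, t) (quadVec (Γ t) x (e i) v h)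
    (quadVec (Γ t) x (e i) v h) with hr
  set q1 : Fin 3 → ℝ → ℝ := fun i => quadDeriv (Γ t) (fun x => N (x, t)) (P t) x (e i) v with hq1
  set r1 : Fin 3 → ℝ → ℝ := fun i => quadDeriv (Γ t) (fun x => H (x, t)) (fun _ _ _ _ => 0) x (e i) v
    with hr1
  have hquot := fun i => hasDerivAt_quotient_second (s := S) (q := q i) (q1 := q1 i) (r := r i)
    (r1 := r1 i) (q2 := Q t x (e i) (e i) v v) hS.ne ((hN.cov t ht).hasDerivAt_quad x (e i) v)
    ((hN.cov t ht).hasDerivAt_quadDeriv hΓ x (e i) v) (hSl.isCovDeriv.hasDerivAt_quad x (e i) v)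
    (hSl.isCovDeriv.hasDerivAt_quadDeriv hΓ x (e i) v) (by simp [hr, hv])
    (by simp [hr1, quadDeriv_zero])
  set u : Fin 3 → ℝ → ℝ := fun i h => q i h / (S * r i h) with hu
  set a : Fin 3 → ℝ := fun i => (q1 i 0 * r i 0 - q i 0 * r1 i 0) / (S * r i 0 ^ 2) with ha
  have hu0 : ∀ i, u i 0 = 1 := fun i => by simp [hu, hq, hr, hv, hSv, hS.ne]
  have hua : ∀ i, HasDerivAt (u i) (a i) 0 := fun i => (hquot i).1.self_of_nhds
  have hvne : ∀ y s w, s < T → H (y, s) w w = 0 → w = 0 := fun y s w hs h => by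
    by_contra hw
    exact ((hF.slice s hs).pos y w hw).ne' h
  have hD : ∀ i h, 0 < u i h → ρ ^ 2 * (1 - θ / √(u i h)) ≤
      gDist (fun x => H (x, t)) x₀ (quadPt (Γ t) x (e i) h) ^ 2 := fun i h hpos => by
    have hw : quadVec (Γ t) x (e i) v h ≠ 0 := fun h0 => by
      simp [hu, hq, h0] at hpos
    have heq : (t - t₀) * N (quadPt (Γ t) x (e i) h, t) (quadVec (Γ t) x (e i) v h)
        (quadVec (Γ t) x (e i) v h) / ((t - t₀) * S * H (quadPt (Γ t) x (e i) h, t)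
        (quadVec (Γ t) x (e i) v h) (quadVec (Γ t) x (e i) v h)) = u i h := by
      rw [mul_assoc, mul_div_mul_left _ _ ht1.ne']
    have := hbar t ⟨ht₀.le, le_rfl⟩ (quadPt (Γ t) x (e i) h) _ hw
    rw [heq] at this
    exact this hpos
  -- first order bound
  have hgr : ∀ i (σ : ℝ), σ ^ 2 = 1 → ∀ᶠ h in 𝓝[>] 0,
      gDist (fun x => H (x, t)) x₀ (quadPt (Γ t) x (e i) (σ * h)) ^ 2 ≤ (l + 2 * h) ^ 2 :=
    fun i σ hσ => by
      have h1 : H (x, t) (σ • e i) (σ • e i) = 1 := by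
        simp only [map_smul, _root_.smul_apply, smul_eq_mul, he, if_true]
        nlinarith
      filter_upwards [eventually_gDist_quadPt_le (Γ := Γ t) hG h1] with h hh
      have h2 : quadPt (Γ t) x (σ • e i) h = quadPt (Γ t) x (e i) (σ * h) := by
        simp only [quadPt, map_smul, _root_.smul_apply, smul_smul, mul_pow, hσ]
        congr 2
        · rw [mul_comm]
        · linear_combination (h ^ 2 / 2) * hσ
      rw [h2] at hh
      have h3 := gDist_triangle hG hpos0 x₀ x (quadPt (Γ t) x (e i) (σ * h))
      rw [hl] at h3
      exact pow_le_pow_left₀ (gDist_nonneg _ _ _) (by linarith) 2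
  have ha1 : ∀ i, a i ^ 2 ≤ 64 / (ρ ^ 2 * θ ^ 2) := fun i => by
    have p1 := barrier_first_order (u := u i) hθ.le hlθ (hu0 i) (hua i) (hD i)
      (by simpa using hgr i 1 (by norm_num))
    have hm : HasDerivAt (fun h => u i (-h)) (-a i) 0 := by
      have h2 : HasDerivAt (u i) (a i) (-0) := by simpa using hua i
      exact (h2.scomp 0 (hasDerivAt_neg 0)).congr_deriv (by simp)
    have p2 := barrier_first_order (u := fun h => u i (-h)) hθ.le hlθ (by simpa using hu0 i) hm
      (fun h => hD i (-h)) (by simpa using hgr i (-1) (by norm_num))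
    have p3 : |ρ ^ 2 * θ * a i| ≤ 8 * ρ := abs_le.mpr ⟨by linarith, by linarith⟩
    have p4 := sq_le_sq' (by linarith [abs_le.mp p3]) (abs_le.mp p3).2
    rw [le_div_iff₀ (by positivity)]
    refine le_of_mul_le_mul_left (a := ρ ^ 2) ?_ (by positivity)
    nlinarith
  -- the quotient in time
  set c : ℝ := 1 / (t - t₀) + Nt t x v / S + 2 * Rc t x v v with hc
  set ut : ℝ → ℝ := fun τ => (t - τ - t₀) * N (x, t - τ) v v / ((t - t₀) * S * H (x, t - τ) v v)
    with hut
  have hut0 : ut 0 = 1 := by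
    have := ht1.ne'
    have := hS.ne
    simp only [hut, sub_zero, hv, hSv]
    field_simp
  have hutd : HasDerivAt ut (-c) 0 := by
    have d0 : HasDerivAt (fun τ : ℝ => t - τ) (-1) 0 := by
      simpa using (hasDerivAt_id (0 : ℝ)).const_sub t
    have d1 : HasDerivAt (fun τ => N (x, t - τ) v v) (-Nt t x v) 0 := by
      have := (show HasDerivAt (fun s => N (x, s) v v) (Nt t x v) (t - 0) by
        simpa using hN.time t ht x v).scomp 0 d0
      exact this.congr_deriv (by simp)
    have d2 : HasDerivAt (fun τ => H (x, t - τ) v v) (2 * Rc t x v v) 0 := by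
      have := (show HasDerivAt (fun s => H (x, s) v v) (-2 * Rc t x v v) (t - 0) by
        simpa using hF.flow t ht x v).scomp 0 d0
      exact this.congr_deriv (by simp)
    have h1 := ht1.ne'
    have h2 := hS.ne
    refine (((d0.sub_const t₀).mul d1).div (d2.const_mul ((t - t₀) * S))
      (by simp [hv, h1, h2])).congr_deriv ?_
    simp only [Pi.mul_apply, sub_zero, hv, hSv, hc]
    field_simp
    ring
  have hsum := hSl.second_variation (hF.bdd t ht x₀) he hκ hRc (Gt := fun τ y => H (y, t - τ))
    (fun τ hτ => continuous_slice hF.cont (by linarith))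
    (fun τ hτ y w => nonneg_of_pos_of_ne ((hF.slice (t - τ) (by linarith)).pos y) w)
    (hF.taylor t ht)
  obtain ⟨C, hC⟩ := hsum
  rw [hl] at hC
  have h2nd := barrier_second_order (ι := Fin 3) (u := u) (N := 7) hθ.le hlθ
    (by norm_num) hu0 (fun i => (hquot i).1) (fun i => rfl) (fun i => (hquot i).2) hut0 hutd hD
    (Dt := fun h => gDist (fun x => H (x, t - h ^ 2)) x₀ x ^ 2)
    (by
      have : ∀ᶠ h in 𝓝 (0 : ℝ), t₀ ≤ t - h ^ 2 := by
        have hc : ContinuousAt (fun h : ℝ => t - h ^ 2) 0 := by fun_prop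
        exact hc.eventually (Ici_mem_nhds (by simpa using ht₀))
      filter_upwards [nhdsWithin_le_nhds this] with h hh hp
      exact hbar (t - h ^ 2) ⟨hh, by nlinarith [sq_nonneg h]⟩ x v hv0 hp)
    (β := (12 + 8 * κ) * max l 1) (C := C)
    (by
      filter_upwards [Ioo_mem_nhdsGT (zero_lt_one (α := ℝ))] with h hh
      exact hC h ⟨hh.1, hh.2.le⟩)
  have hreact := hN.reaction t ht x e he v hv (by rw [hSv]; exact hS) (by rw [hSv]; exact hmin)
  rw [hSv] at hreact
  have hM : max l 1 ≤ ρ := max_le hlρ hρ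
  have hβ : (12 + 8 * κ) * max l 1 ≤ (12 + 8 * κ) * ρ :=
    mul_le_mul_of_nonneg_left hM (by positivity)
  have hA : ∑ i, a i ^ 2 ≤ 192 / (ρ ^ 2 * θ ^ 2) := by
    refine (Finset.sum_le_sum fun i _ => ha1 i).trans_eq ?_
    simp
    ring
  have hsplit : ∑ i, (Q t x (e i) (e i) v v / S / 2 - a i ^ 2)
      = (∑ i, Q t x (e i) (e i) v v) / S / 2 - ∑ i, a i ^ 2 := by
    rw [Finset.sum_sub_distrib, Finset.sum_div, Finset.sum_div]
  rw [hsplit] at h2nd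
  set QS := ∑ i, Q t x (e i) (e i) v v with hQS
  set As := ∑ i, a i ^ 2 with hAs
  have hlow : -S / 2 - 1 / (t - t₀) ≤ QS / S - c := by
    have : (Nt t x v + 2 * S * Rc t x v v - QS) / -S = QS / S - Nt t x v / S - 2 * Rc t x v v := by
      have := hS.ne
      field_simp
      ring
    have h3 : -S / 2 ≤ (Nt t x v + 2 * S * Rc t x v v - QS) / -S := by
      rw [le_div_iff₀ (by linarith)]
      nlinarith
    rw [hc]
    linarith
  have hfin : ρ ^ 2 * θ * ((-S / 2 - 1 / (t - t₀)) / 2 - 192 / (ρ ^ 2 * θ ^ 2)) ≤ (12 + 8 * κ) * ρ := by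
    refine le_trans (mul_le_mul_of_nonneg_left ?_ hρθ.le) (h2nd.trans hβ)
    linarith
  have h4 : ρ ^ 2 * θ * ((-S / 2 - 1 / (t - t₀)) / 2 - 192 / (ρ ^ 2 * θ ^ 2)) =
      ρ ^ 2 / (2 * θ * (t - t₀)) * (θ ^ 2 * ((t - t₀) * -S) / 2 - θ ^ 2 - (t - t₀) * (384 / ρ ^ 2)) := by
    field_simp
    ring
  have h5 : (12 + 8 * κ) * ρ = ρ ^ 2 / (2 * θ * (t - t₀)) * ((t - t₀) * (2 * (12 + 8 * κ) / ρ) * θ) := by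
    field_simp
  rw [h4, h5] at hfin
  have h6 := le_of_mul_le_mul_left hfin (by positivity)
  have h7 : (t - t₀) * (2 * (12 + 8 * κ) / ρ) * θ ≤ (t - t₀) * (2 * (12 + 8 * κ) / ρ) * 1 := by
    gcongr
  have h8 : θ ^ 2 ≤ 1 := pow_le_one₀ hθ.le hθ1
  linarith

end LocalMaximum

section GlobalMaximum

open scoped ContDiff
open Topology Filter

theorem exists_orthonormal_form {G : (Fin 3 → ℝ) →L[ℝ] (Fin 3 → ℝ) →L[ℝ] ℝ}
    (hs : ∀ u v, G u v = G v u) (hp : ∀ v, v ≠ 0 → 0 < G v v) :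
    ∃ e : Fin 3 → Fin 3 → ℝ, ∀ i j, G (e i) (e j) = if i = j then 1 else 0 := by
  let B : LinearMap.BilinForm ℝ (Fin 3 → ℝ) := LinearMap.mk₂ ℝ (fun u v => G u v)
    (by simp) (by simp) (by simp) (by simp)
  have : Invertible (2 : ℝ) := invertibleOfNonzero two_ne_zero
  obtain ⟨b, hb⟩ := LinearMap.BilinForm.exists_orthogonal_basis (B := B)
    (show LinearMap.IsSymm B from ⟨fun u v => hs u v⟩)
  have hr : Module.finrank ℝ (Fin 3 → ℝ) = 3 := by simp
  let b' := b.reindex (finCongr hr)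
  have hb' : ∀ i j, i ≠ j → G (b' i) (b' j) = 0 := fun i j hij => by
    have := hb (i := (finCongr hr).symm i) (j := (finCongr hr).symm j) (by simpa using hij)
    simpa [b', Function.onFun, B] using this
  refine ⟨fun i => (1 / √(G (b' i) (b' i))) • b' i, fun i j => ?_⟩
  have h0 := hp _ (b'.ne_zero i)
  by_cases hij : i = j
  · subst hij
    have h1 := Real.mul_self_sqrt h0.le
    have h2 := (Real.sqrt_pos.mpr h0).ne'
    simp only [map_smul, _root_.smul_apply, smul_eq_mul, if_true]
    field_simp
    nlinarith
  · simp [hb' i j hij, hij]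

theorem form_ratio_smul {E : Type*} [NormedAddCommGroup E] [NormedSpace ℝ E]
    (A B : E →L[ℝ] E →L[ℝ] ℝ) {c : ℝ} (hc : c ≠ 0) (v : E) :
    A (c • v) (c • v) / B (c • v) (c • v) = A v v / B v v := by
  simp only [map_smul, _root_.smul_apply, smul_eq_mul, ← mul_assoc]
  exact mul_div_mul_left _ _ (mul_ne_zero hc hc)

variable {T : ℝ} {H : (Fin 3 → ℝ) × ℝ → (Fin 3 → ℝ) →L[ℝ] (Fin 3 → ℝ) →L[ℝ] ℝ}
  {Γ : ℝ → (Fin 3 → ℝ) → (Fin 3 → ℝ) →L[ℝ] (Fin 3 → ℝ) →L[ℝ] (Fin 3 → ℝ)}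
  {Rc : ℝ → (Fin 3 → ℝ) → (Fin 3 → ℝ) →L[ℝ] (Fin 3 → ℝ) →L[ℝ] ℝ}
  {N : (Fin 3 → ℝ) × ℝ → (Fin 3 → ℝ) →L[ℝ] (Fin 3 → ℝ) →L[ℝ] ℝ}
  {P : ℝ → (Fin 3 → ℝ) → (Fin 3 → ℝ) → (Fin 3 → ℝ) → (Fin 3 → ℝ) → ℝ}
  {Q : ℝ → (Fin 3 → ℝ) → (Fin 3 → ℝ) → (Fin 3 → ℝ) → (Fin 3 → ℝ) → (Fin 3 → ℝ) → ℝ}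
  {Nt : ℝ → (Fin 3 → ℝ) → (Fin 3 → ℝ) → ℝ}

theorem FlowGeom.pos (hF : FlowGeom T H Γ Rc) : ∀ x, ∀ t < T, ∀ v, v ≠ 0 → 0 < H (x, t) v v :=
  fun x t ht => (hF.slice t ht).pos x

theorem FlowGeom.continuousOn_ratio (hF : FlowGeom T H Γ Rc)
    {A : (Fin 3 → ℝ) × ℝ → (Fin 3 → ℝ) →L[ℝ] (Fin 3 → ℝ) →L[ℝ] ℝ}
    (hA : ContinuousOn A (univ ×ˢ Iio T)) {x₀ : Fin 3 → ℝ} {a b ρ : ℝ} (hb : b < T) :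
    ContinuousOn (fun p : ((Fin 3 → ℝ) × ℝ × ℝ) × (Fin 3 → ℝ) =>
      A (p.1.1, p.1.2.1) p.2 p.2 / H (p.1.1, p.1.2.1) p.2 p.2)
      (distTube H x₀ a b ρ ×ˢ Metric.sphere 0 1) := by
  have hm : MapsTo (fun p : ((Fin 3 → ℝ) × ℝ × ℝ) × (Fin 3 → ℝ) => (p.1.1, p.1.2.1))
      (distTube H x₀ a b ρ ×ˢ Metric.sphere 0 1) (univ ×ˢ Iio T) :=
    fun p hp => ⟨mem_univ _, hp.1.1.2.trans_lt hb⟩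
  have hc : Continuous fun p : ((Fin 3 → ℝ) × ℝ × ℝ) × (Fin 3 → ℝ) => (p.1.1, p.1.2.1) := by fun_prop
  have key : ∀ {B : (Fin 3 → ℝ) × ℝ → (Fin 3 → ℝ) →L[ℝ] (Fin 3 → ℝ) →L[ℝ] ℝ},
      ContinuousOn B (univ ×ˢ Iio T) → ContinuousOn
      (fun p : ((Fin 3 → ℝ) × ℝ × ℝ) × (Fin 3 → ℝ) => B (p.1.1, p.1.2.1) p.2 p.2)
      (distTube H x₀ a b ρ ×ˢ Metric.sphere 0 1) := fun hB =>
    ((hB.comp hc.continuousOn hm).clm_apply continuousOn_snd).clm_apply continuousOn_snd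
  refine (key hA).div (key hF.cont) fun p hp => ?_
  refine (hF.pos _ _ (hp.1.1.2.trans_lt hb) _ ?_).ne'
  exact ne_zero_of_mem_sphere one_ne_zero ⟨p.2, hp.2⟩

theorem FlowGeom.ricci_bound (hF : FlowGeom T H Γ Rc) (x₀ : Fin 3 → ℝ) (a : ℝ) {b : ℝ} (hb : b < T) :
    ∃ κ, 0 ≤ κ ∧ ∀ t ∈ Icc a b, ∀ y, gDist (fun x => H (x, t)) x₀ y ≤ 2 → ∀ w,
      Rc t y w w ≤ κ * H (y, t) w w := by
  have hK := (isCompact_distTube (a := a) (ρ := 2) hF.cont hF.pos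
    (fun t ht r => hF.bdd t ht x₀ r) hb).prod (isCompact_sphere (0 : Fin 3 → ℝ) 1)
  obtain ⟨B, hB⟩ := hK.bddAbove_image (hF.continuousOn_ratio hF.cont_ric hb)
  refine ⟨max B 0, le_max_right _ _, fun t ht y hy w => ?_⟩
  rcases eq_or_ne w 0 with rfl | hw
  · simp
  have hp := hF.pos y t (ht.2.trans_lt hb) w hw
  have hn : ‖w‖⁻¹ ≠ 0 := inv_ne_zero (norm_ne_zero_iff.mpr hw)
  have := hB ⟨((y, t, 2), ‖w‖⁻¹ • w), ⟨⟨ht, by norm_num, hy⟩, by simp [norm_smul, hw]⟩, rfl⟩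
  simp only at this
  rw [form_ratio_smul _ _ hn, div_le_iff₀ hp] at this
  exact this.trans (mul_le_mul_of_nonneg_right (le_max_left _ _) hp.le)

theorem neg_ratio_eq (a b : ℝ) {c s d : ℝ} (hc : c ≠ 0) (hs : s ≠ 0) (hd : d ≠ 0) :
    -(a * (b / d)) = (c * -s) * (a * b / (c * s * d)) := by
  field_simp

theorem barrier_of_product_le {ρ θ d u : ℝ} (hρ : 0 < ρ) (hθ : 0 ≤ θ) (hu : 0 < u)
    (h : d ≤ ρ → (1 - d ^ 2 / ρ ^ 2) ^ 2 * u ≤ θ ^ 2) : ρ ^ 2 * (1 - θ / √u) ≤ d ^ 2 := by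
  have hsu := Real.sqrt_pos.mpr hu
  rcases lt_or_ge ρ d with hdρ | hdρ
  · have : 0 ≤ θ / √u := by positivity
    have h3 : ρ ^ 2 ≤ d ^ 2 := pow_le_pow_left₀ hρ.le hdρ.le 2
    nlinarith [sq_nonneg ρ]
  have h6 : (1 - d ^ 2 / ρ ^ 2) * √u ≤ θ := by
    refine le_of_sq_le_sq ?_ hθ
    rw [mul_pow, Real.sq_sqrt hu.le]
    exact h hdρ
  rw [← le_div_iff₀ hsu] at h6
  have h7 : ρ ^ 2 * (1 - θ / √u) ≤ ρ ^ 2 * (d ^ 2 / ρ ^ 2) :=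
    mul_le_mul_of_nonneg_left (by linarith) (sq_nonneg ρ)
  rwa [mul_div_cancel₀ _ (by positivity)] at h7

/-- Localized lower bound at a fixed scale. -/
theorem FlowGeom.localized_bound (hF : FlowGeom T H Γ Rc) (hN : ReactionForm T H Γ Rc N P Q Nt)
    {x₀ v₀ : Fin 3 → ℝ} {t₀ t₁ κ ρ : ℝ} (h01 : t₀ < t₁) (h1 : t₁ < T) (hκ : 0 ≤ κ)
    (hRc : ∀ t ∈ Icc t₀ t₁, ∀ y, gDist (fun x => H (x, t)) x₀ y ≤ 2 → ∀ w,
      Rc t y w w ≤ κ * H (y, t) w w) (hρ : 1 ≤ ρ) (hv₀ : v₀ ≠ 0) :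
    (t₁ - t₀) * -(N (x₀, t₁) v₀ v₀ / H (x₀, t₁) v₀ v₀) ≤
      2 * (1 + (t₁ - t₀) * (2 * (12 + 8 * κ) / ρ + 384 / ρ ^ 2)) := by
  have hρ0 : 0 < ρ := by linarith
  set X : ((Fin 3 → ℝ) × ℝ × ℝ) × (Fin 3 → ℝ) → ℝ := fun p =>
    -((p.1.2.1 - t₀) * (N (p.1.1, p.1.2.1) p.2 p.2 / H (p.1.1, p.1.2.1) p.2 p.2)) with hX
  set F : ((Fin 3 → ℝ) × ℝ × ℝ) × (Fin 3 → ℝ) → ℝ := fun p =>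
    (1 - p.1.2.2 ^ 2 / ρ ^ 2) ^ 2 * max 0 (X p) with hFdef
  set K := distTube H x₀ t₀ t₁ ρ ×ˢ Metric.sphere (0 : Fin 3 → ℝ) 1 with hKdef
  have hK : IsCompact K := (isCompact_distTube (a := t₀) (ρ := ρ) hF.cont hF.pos
    (fun t ht r => hF.bdd t ht x₀ r) h1).prod (isCompact_sphere (0 : Fin 3 → ℝ) 1)
  have hmemK : ∀ y s ℓ w, s ∈ Icc t₀ t₁ → ℓ ∈ Icc 0 ρ → gDist (fun x => H (x, s)) x₀ y ≤ ℓ →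
      w ∈ Metric.sphere (0 : Fin 3 → ℝ) 1 → ((y, s, ℓ), w) ∈ K :=
    fun y s ℓ w h1 h2 h3 h4 => ⟨⟨h1, h2, h3⟩, h4⟩
  have hFc : ContinuousOn F K := by
    have hr := hF.continuousOn_ratio hN.cont (x₀ := x₀) (a := t₀) (ρ := ρ) h1
    have c1 : Continuous fun p : ((Fin 3 → ℝ) × ℝ × ℝ) × (Fin 3 → ℝ) =>
      (1 - p.1.2.2 ^ 2 / ρ ^ 2) ^ 2 := by fun_prop
    have c2 : Continuous fun p : ((Fin 3 → ℝ) × ℝ × ℝ) × (Fin 3 → ℝ) => p.1.2.1 - t₀ := by fun_prop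
    exact c1.continuousOn.mul (continuousOn_const.sup (c2.continuousOn.mul hr).neg)
  have hd0 : ∀ t < T, gDist (fun x => H (x, t)) x₀ x₀ ≤ 0 := fun t ht => by
    have hc : IsC1Path (fun _ : ℝ => x₀) (fun _ => 0) :=
      ⟨continuousOn_const, fun s _ => (hasDerivAt_const s x₀).hasDerivWithinAt⟩
    exact hc.gDist_le_of_speed_le (continuous_slice hF.cont ht) le_rfl (by simp)
  have hunit : ∀ w : Fin 3 → ℝ, w ≠ 0 → ‖w‖⁻¹ • w ∈ Metric.sphere (0 : Fin 3 → ℝ) 1 ∧ ‖w‖⁻¹ ≠ 0 :=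
    fun w hw => ⟨by simp [norm_smul, hw], inv_ne_zero (norm_ne_zero_iff.mpr hw)⟩
  have hmem : ((x₀, t₁, (0 : ℝ)), ‖v₀‖⁻¹ • v₀) ∈ K :=
    hmemK _ _ _ _ ⟨h01.le, le_rfl⟩ ⟨le_rfl, hρ0.le⟩ (hd0 t₁ h1) (hunit v₀ hv₀).1
  obtain ⟨⟨⟨x, t, ℓ⟩, v⟩, ⟨⟨htI, hℓI, hℓ⟩, hv1⟩, hmax⟩ := hK.exists_isMaxOn ⟨_, hmem⟩ hFc
  simp only at htI hℓI hℓ hv1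
  have htT : t < T := htI.2.trans_lt h1
  set Fm := F ((x, t, ℓ), v) with hFm
  have hle : ∀ s ∈ Icc t₀ t₁, ∀ y, gDist (fun x => H (x, s)) x₀ y ≤ ρ → ∀ w, w ≠ 0 →
      (1 - gDist (fun x => H (x, s)) x₀ y ^ 2 / ρ ^ 2) ^ 2 *
        (-((s - t₀) * (N (y, s) w w / H (y, s) w w))) ≤ Fm := fun s hs y hy w hw => by
    have := hmemK y s _ _ hs ⟨gDist_nonneg _ _ _, hy⟩ le_rfl (hunit w hw).1
    have h9 : F ((y, s, gDist (fun x => H (x, s)) x₀ y), ‖w‖⁻¹ • w) ≤ Fm :=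
      isMaxOn_iff.mp hmax _ this
    refine le_trans ?_ h9
    simp only [hFdef, hX]
    rw [form_ratio_smul _ _ (hunit w hw).2]
    exact mul_le_mul_of_nonneg_left (le_max_right _ _) (sq_nonneg _)
  have hstart : (t₁ - t₀) * -(N (x₀, t₁) v₀ v₀ / H (x₀, t₁) v₀ v₀) ≤ Fm := by
    refine le_trans (le_of_eq ?_) (hle t₁ ⟨h01.le, le_rfl⟩ x₀ ((hd0 t₁ h1).trans hρ0.le) v₀ hv₀)
    rw [le_antisymm (hd0 t₁ h1) (gDist_nonneg _ _ _)]
    simp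
  refine hstart.trans ?_
  have hBpos : 0 ≤ 2 * (12 + 8 * κ) / ρ + 384 / ρ ^ 2 := by positivity
  rcases le_or_gt Fm 0 with hFm0 | hFm0
  · have : 0 ≤ (t₁ - t₀) * (2 * (12 + 8 * κ) / ρ + 384 / ρ ^ 2) :=
      mul_nonneg (by linarith) hBpos
    linarith
  have hv0 : v ≠ 0 := ne_zero_of_mem_sphere one_ne_zero ⟨v, hv1⟩
  have hHv := hF.pos x t htT v hv0
  set S := N (x, t) v v / H (x, t) v v with hSdef
  have hFmS : Fm = (1 - ℓ ^ 2 / ρ ^ 2) ^ 2 * max 0 (-((t - t₀) * S)) := rfl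
  have hmaxpos : 0 < max 0 (-((t - t₀) * S)) := by
    by_contra hcon
    rw [le_antisymm (not_lt.mp hcon) (le_max_left _ _), mul_zero] at hFmS
    linarith
  have hneg : 0 < -((t - t₀) * S) := by
    rcases lt_max_iff.mp hmaxpos with h | h
    · exact absurd h (lt_irrefl 0)
    · exact h
  have htt : 0 < t - t₀ := by
    rcases (sub_nonneg.mpr htI.1).eq_or_lt with h | h
    · rw [← h] at hneg; simp at hneg
    · exact h
  have hS : S < 0 := by
    by_contra hcon
    have := mul_nonneg htt.le (not_lt.mp hcon)
    linarith
  set l := gDist (fun x => H (x, t)) x₀ x with hl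
  have hl0 : 0 ≤ l := gDist_nonneg _ _ _
  have hlρ : l ≤ ρ := hℓ.trans hℓI.2
  set θ := 1 - l ^ 2 / ρ ^ 2 with hθdef
  have hθ' : 0 ≤ 1 - ℓ ^ 2 / ρ ^ 2 := by
    rw [sub_nonneg, div_le_one (by positivity)]
    exact pow_le_pow_left₀ hℓI.1 hℓI.2 2
  have hθle : 1 - ℓ ^ 2 / ρ ^ 2 ≤ θ := by
    have : l ^ 2 ≤ ℓ ^ 2 := pow_le_pow_left₀ hl0 hℓ 2
    rw [hθdef]
    gcongr
  have hθ : 0 < θ := by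
    refine lt_of_lt_of_le (lt_of_le_of_ne hθ' fun h => ?_) hθle
    rw [← h] at hFmS
    simp at hFmS
    linarith
  have hFmA : Fm ≤ θ ^ 2 * ((t - t₀) * -S) := by
    rw [hFmS, max_eq_right hneg.le, show -((t - t₀) * S) = (t - t₀) * -S by ring]
    have : 0 ≤ (t - t₀) * -S := by linarith
    gcongr
  have hlθ : l ^ 2 = ρ ^ 2 * (1 - θ) := by
    rw [hθdef]; field_simp; ring
  -- normalize the direction
  obtain ⟨e, he⟩ := exists_orthonormal_form ((hF.slice t htT).symm x) ((hF.slice t htT).pos x)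
  set c := 1 / √(H (x, t) v v) with hc
  have hcc : c * c * H (x, t) v v = 1 := by
    have h2 := Real.mul_self_sqrt hHv.le
    have h3 := (Real.sqrt_pos.mpr hHv).ne'
    rw [hc]
    field_simp
    nlinarith
  have hn1 : H (x, t) (c • v) (c • v) = 1 := by
    simp only [map_smul, _root_.smul_apply, smul_eq_mul]
    linarith
  have hn2 : N (x, t) (c • v) (c • v) = S := by
    have hcz : c ≠ 0 := by rintro h; simp [h] at hcc
    have := form_ratio_smul (N (x, t)) (H (x, t)) hcz v
    rwa [hn1, div_one] at this
  have hfinal := hF.barrier_inequality hN (x₀ := x₀) (l := l) (ρ := ρ) (θ := θ) (κ := κ)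
    (sub_pos.mp htt) htT he hn1 hn2 hS
    (fun w => by
      rcases eq_or_ne w 0 with rfl | hw
      · simp
      have hp := hF.pos x t htT w hw
      have h3 := (hle t htI x hlρ w hw).trans hFmA
      have h4 := le_of_mul_le_mul_left h3 (by positivity)
      have h5 : (t - t₀) * S ≤ (t - t₀) * (N (x, t) w w / H (x, t) w w) := by linarith
      have h6 := le_of_mul_le_mul_left h5 htt
      rwa [le_div_iff₀ hp] at h6) hκ (hRc t htI) rfl hθ hρ hlθ
    (fun s hs y w hw hu => by
      refine barrier_of_product_le hρ0 hθ.le hu fun hdρ => ?_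
      have hsI : s ∈ Icc t₀ t₁ := ⟨hs.1, hs.2.trans htI.2⟩
      have hp := hF.pos y s (hsI.2.trans_lt h1) w hw
      have h3 := (hle s hsI y hdρ w hw).trans hFmA
      rw [neg_ratio_eq (s - t₀) (N (y, s) w w) htt.ne' hS.ne hp.ne'] at h3
      refine le_of_mul_le_mul_left (h3.trans_eq' ?_ |>.trans_eq (mul_comm _ _))
        (show 0 < (t - t₀) * -S by linarith)
      ring)
  have h8 : (t - t₀) * (2 * (12 + 8 * κ) / ρ + 384 / ρ ^ 2) ≤
      (t₁ - t₀) * (2 * (12 + 8 * κ) / ρ + 384 / ρ ^ 2) :=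
    mul_le_mul_of_nonneg_right (by linarith [htI.2]) hBpos
  linarith

/-- On an ancient complete Ricci flow a form with the reaction property is nonnegative. -/
theorem FlowGeom.form_nonneg (hF : FlowGeom T H Γ Rc) (hN : ReactionForm T H Γ Rc N P Q Nt)
    (x : Fin 3 → ℝ) {t : ℝ} (ht : t < T) (v : Fin 3 → ℝ) : 0 ≤ N (x, t) v v := by
  rcases eq_or_ne v 0 with rfl | hv
  · simp
  have hH := hF.pos x t ht v hv
  have key : ∀ t₀ < t, (t - t₀) * -(N (x, t) v v / H (x, t) v v) ≤ 2 := fun t₀ h0 => by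
    obtain ⟨κ, hκ, hRc⟩ := hF.ricci_bound x t₀ ht
    have hlim : Tendsto (fun ρ : ℝ => 2 * (1 + (t - t₀) * (2 * (12 + 8 * κ) / ρ + 384 / ρ ^ 2)))
        atTop (𝓝 (2 * (1 + (t - t₀) * (0 + 0)))) :=
      (((tendsto_const_nhds.div_atTop tendsto_id).add (tendsto_const_nhds.div_atTop
        (tendsto_pow_atTop two_ne_zero))).const_mul _ |>.const_add _ |>.const_mul _)
    have := ge_of_tendsto hlim (by
      filter_upwards [eventually_ge_atTop 1] with ρ hρ
      exact hF.localized_bound hN h0 ht hκ hRc hρ hv)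
    linarith
  by_contra hcon
  have hr : 0 < -(N (x, t) v v / H (x, t) v v) :=
    neg_pos.mpr (div_neg_of_neg_of_pos (not_le.mp hcon) hH)
  have := key (t - 3 / -(N (x, t) v v / H (x, t) v v)) (by linarith [div_pos three_pos hr])
  rw [sub_sub_cancel, div_mul_cancel₀ _ hr.ne'] at this
  norm_num at this

end GlobalMaximum

/-! ### The coordinate package of a Ricci flow -/

section Coordinates

local notation "E" => (Fin 3 → ℝ)

/-- The bilinear form with coefficients `M`. -/
def coordForm (M : Fin 3 → Fin 3 → ℝ) : E →L[ℝ] E →L[ℝ] ℝ :=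
  ∑ i, ∑ j, M i j • (ContinuousLinearMap.proj (R := ℝ) (φ := fun _ : Fin 3 => ℝ) i).smulRight
    (ContinuousLinearMap.proj (R := ℝ) (φ := fun _ : Fin 3 => ℝ) j)

/-- The vector valued bilinear map with coefficients `C k i j`. -/
def coordConn (C : Fin 3 → Fin 3 → Fin 3 → ℝ) : E →L[ℝ] E →L[ℝ] E :=
  ∑ k, ∑ i, ∑ j, C k i j •
    (ContinuousLinearMap.proj (R := ℝ) (φ := fun _ : Fin 3 => ℝ) i).smulRight
      ((ContinuousLinearMap.proj (R := ℝ) (φ := fun _ : Fin 3 => ℝ) j).smulRight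
        (Pi.single k (1 : ℝ) : E))

theorem coordForm_apply (M : Fin 3 → Fin 3 → ℝ) (u v : E) :
    coordForm M u v = ∑ i, ∑ j, M i j * u i * v j := by
  simp [coordForm, Fin.sum_univ_three]
  ring

theorem coordConn_apply (C : Fin 3 → Fin 3 → Fin 3 → ℝ) (u v : E) (k : Fin 3) :
    coordConn C u v k = ∑ i, ∑ j, C k i j * u i * v j := by
  simp [coordConn, Fin.sum_univ_three]
  fin_cases k <;> simp <;> ring

theorem coordForm_add (M M' : Fin 3 → Fin 3 → ℝ) :
    coordForm (M + M') = coordForm M + coordForm M' := by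
  ext u v
  simp only [_root_.add_apply, coordForm_apply, Pi.add_apply, Fin.sum_univ_three]
  ring

theorem coordForm_smul (c : ℝ) (M : Fin 3 → Fin 3 → ℝ) :
    coordForm (c • M) = c • coordForm M := by
  ext u v
  simp only [_root_.smul_apply, coordForm_apply, Pi.smul_apply, Fin.sum_univ_three, smul_eq_mul]
  ring

theorem coordConn_add (C C' : Fin 3 → Fin 3 → Fin 3 → ℝ) :
    coordConn (C + C') = coordConn C + coordConn C' := by
  ext u v k
  simp only [_root_.add_apply, coordConn_apply, Pi.add_apply, Fin.sum_univ_three]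
  ring

theorem coordConn_smul (c : ℝ) (C : Fin 3 → Fin 3 → Fin 3 → ℝ) :
    coordConn (c • C) = c • coordConn C := by
  ext u v k
  simp only [_root_.smul_apply, coordConn_apply, Pi.smul_apply, Fin.sum_univ_three, smul_eq_mul]
  ring

section Linear

variable {V W : Type*} [NormedAddCommGroup V] [NormedSpace ℝ V] [FiniteDimensional ℝ V]
  [NormedAddCommGroup W] [NormedSpace ℝ W] {f : V → W}

theorem exists_clm_eq (hadd : ∀ a b, f (a + b) = f a + f b)
    (hsmul : ∀ (c : ℝ) a, f (c • a) = c • f a) : ∃ L : V →L[ℝ] W, f = L :=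
  ⟨LinearMap.toContinuousLinearMap { toFun := f, map_add' := hadd, map_smul' := hsmul }, rfl⟩

theorem contDiff_of_linear (hadd : ∀ a b, f (a + b) = f a + f b)
    (hsmul : ∀ (c : ℝ) a, f (c • a) = c • f a) : ContDiff ℝ (⊤ : ℕ∞) f := by
  obtain ⟨L, rfl⟩ := exists_clm_eq hadd hsmul
  exact L.contDiff

theorem fderiv_linear_comp (hadd : ∀ a b, f (a + b) = f a + f b)
    (hsmul : ∀ (c : ℝ) a, f (c • a) = c • f a) {X : Type*} [NormedAddCommGroup X]
    [NormedSpace ℝ X] {m : X → V} {m' : X →L[ℝ] V} {x : X} (hm : HasFDerivAt m m' x) (u : X) :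
    fderiv ℝ (fun x => f (m x)) x u = f (m' u) := by
  obtain ⟨L, rfl⟩ := exists_clm_eq hadd hsmul
  exact congrArg (fun L => L u) (L.hasFDerivAt.comp x hm).fderiv

end Linear

section Slab

variable {T : ℝ}

theorem continuousOn_coordForm (F : Fin 3 → Fin 3 → slabRing T) :
    ContinuousOn (fun p : E × ℝ => coordForm fun i j => slabEval p (F i j)) (univ ×ˢ Iio T) :=
  (contDiff_of_linear (f := coordForm) (W := E →L[ℝ] E →L[ℝ] ℝ) coordForm_add coordForm_smul).continuous.comp_continuousOn <| continuousOn_pi.2 fun i => continuousOn_pi.2 fun j =>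
    ((F i j).2 : ContDiffOn ℝ (⊤ : ℕ∞) _ _).continuousOn

theorem contDiff_slabEval_slice (f : slabRing T) {t : ℝ} (ht : t < T) :
    ContDiff ℝ (⊤ : ℕ∞) fun x : E => slabEval (x, t) f :=
  contDiff_iff_contDiffAt.2 fun x =>
    (slabRing_contDiffAt f (p := (x, t)) ht).comp x (contDiffAt_id.prodMk contDiffAt_const)

theorem contDiff_coordForm (F : Fin 3 → Fin 3 → slabRing T) {t : ℝ} (ht : t < T) :
    ContDiff ℝ (⊤ : ℕ∞) fun x : E => coordForm fun i j => slabEval (x, t) (F i j) :=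
  (contDiff_of_linear (f := coordForm) (W := E →L[ℝ] E →L[ℝ] ℝ) coordForm_add coordForm_smul).comp <| contDiff_pi.2 fun i => contDiff_pi.2 fun j =>
    contDiff_slabEval_slice (F i j) ht

theorem contDiff_coordConn (C : Fin 3 → Fin 3 → Fin 3 → slabRing T) {t : ℝ} (ht : t < T) :
    ContDiff ℝ (⊤ : ℕ∞) fun x : E => coordConn fun k i j => slabEval (x, t) (C k i j) :=
  (contDiff_of_linear (f := coordConn) (W := E →L[ℝ] E →L[ℝ] E) coordConn_add coordConn_smul).comp <| contDiff_pi.2 fun k => contDiff_pi.2 fun i => contDiff_pi.2 fun j =>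
    contDiff_slabEval_slice (C k i j) ht

theorem fderiv_slabEval_slice (f : slabRing T) {t : ℝ} (ht : t < T) (x u : E) :
    fderiv ℝ (fun x : E => slabEval (x, t) f) x u = ∑ a, u a * slabEval (x, t) (slabD T a f) := by
  have hu : u = ∑ a, u a • (Pi.single a (1 : ℝ) : E) := by
    ext k
    simp [Finset.sum_apply, Pi.single_apply]
  conv_lhs => rw [hu, map_sum]
  refine Finset.sum_congr rfl fun a _ => ?_
  rw [map_smul, smul_eq_mul, ← pd_slabEval f a x ht]
  rfl

theorem fderiv_coordForm (F : Fin 3 → Fin 3 → slabRing T) {t : ℝ} (ht : t < T) (x u : E) :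
    fderiv ℝ (fun x : E => coordForm fun i j => slabEval (x, t) (F i j)) x u =
      coordForm fun i j => ∑ a, u a * slabEval (x, t) (slabD T a (F i j)) := by
  refine (fderiv_linear_comp (f := coordForm) (W := E →L[ℝ] E →L[ℝ] ℝ) coordForm_add coordForm_smul (hasFDerivAt_pi.2 fun i =>
    hasFDerivAt_pi.2 fun j => ((contDiff_slabEval_slice (F i j) ht).differentiable
      (by simp) x).hasFDerivAt) u).trans ?_
  simp only [← fderiv_slabEval_slice _ ht]
  rfl

theorem fderiv_coordConn (C : Fin 3 → Fin 3 → Fin 3 → slabRing T) {t : ℝ} (ht : t < T) (x u : E) :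
    fderiv ℝ (fun x : E => coordConn fun k i j => slabEval (x, t) (C k i j)) x u =
      coordConn fun k i j => ∑ a, u a * slabEval (x, t) (slabD T a (C k i j)) := by
  refine (fderiv_linear_comp (f := coordConn) (W := E →L[ℝ] E →L[ℝ] E) coordConn_add coordConn_smul (hasFDerivAt_pi.2 fun k =>
    hasFDerivAt_pi.2 fun i => hasFDerivAt_pi.2 fun j =>
      ((contDiff_slabEval_slice (C k i j) ht).differentiable (by simp) x).hasFDerivAt) u).trans ?_
  simp only [← fderiv_slabEval_slice _ ht]
  rfl

end Slab

theorem sum_frame_mul {M Mi : Matrix (Fin 3) (Fin 3) ℝ} (hM : M * Mi = 1) {e : Fin 3 → E}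
    (he : ∀ i j, coordForm M (e i) (e j) = if i = j then 1 else 0) (a b : Fin 3) :
    ∑ i, e i a * e i b = Mi a b := by
  have h1 : (Matrix.of e) * (M * (Matrix.of e)ᵀ) = 1 := by
    ext i j
    have h := (coordForm_apply _ _ _).symm.trans (he i j)
    simp only [Matrix.mul_apply, Matrix.of_apply, Matrix.transpose_apply, Finset.mul_sum,
      Matrix.one_apply]
    rw [← h]
    exact Finset.sum_congr rfl fun _ _ => Finset.sum_congr rfl fun _ _ => by ring
  have h2 : M * ((Matrix.of e)ᵀ * Matrix.of e) = 1 := by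
    rw [← Matrix.mul_assoc]; exact mul_eq_one_comm.1 h1
  have h3 : Mi = (Matrix.of e)ᵀ * Matrix.of e := by
    calc Mi = Mi * (M * ((Matrix.of e)ᵀ * Matrix.of e)) := by rw [h2, mul_one]
      _ = _ := by rw [← Matrix.mul_assoc, mul_eq_one_comm.1 hM, one_mul]
  rw [h3, Matrix.mul_apply]
  rfl

theorem sum_frame_form {M Mi : Matrix (Fin 3) (Fin 3) ℝ} (hM : M * Mi = 1) {e : Fin 3 → E}
    (he : ∀ i j, coordForm M (e i) (e j) = if i = j then 1 else 0) (F : Fin 3 → Fin 3 → ℝ) :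
    ∑ i, coordForm F (e i) (e i) = ∑ a, ∑ b, Mi a b * F a b := by
  simp only [coordForm_apply, ← sum_frame_mul hM he, Finset.sum_mul]
  rw [Finset.sum_comm]
  refine Finset.sum_congr rfl fun a _ => ?_
  rw [Finset.sum_comm]
  exact Finset.sum_congr rfl fun b _ => Finset.sum_congr rfl fun i _ => by ring

end Coordinates

section SliceGeometry

local notation "E" => (Fin 3 → ℝ)

variable {T : ℝ} {g : E → ℝ → Matrix (Fin 3) (Fin 3) ℝ}

/-- The bilinear form at a space-time point whose coefficients are elements of the slab ring. -/
def slabForm (F : Fin 3 → Fin 3 → slabRing T) (p : E × ℝ) : E →L[ℝ] E →L[ℝ] ℝ :=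
  coordForm fun i j => slabEval p (F i j)

/-- The connection of the metric at a space-time point. -/
def slabConn (hg : SmoothMetricFamily g (Iio T)) (t : ℝ) (x : E) : E →L[ℝ] E →L[ℝ] E :=
  coordConn fun k i j => slabEval (x, t) (slabGam hg k i j)

theorem slabForm_apply (F : Fin 3 → Fin 3 → slabRing T) (p : E × ℝ) (u v : E) :
    slabForm F p u v = ∑ i, ∑ j, slabEval p (F i j) * u i * v j :=
  coordForm_apply _ u v

theorem slabConn_apply (hg : SmoothMetricFamily g (Iio T)) (t : ℝ) (x u v : E) (k : Fin 3) :
    slabConn hg t x u v k = ∑ i, ∑ j, slabEval (x, t) (slabGam hg k i j) * u i * v j :=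
  coordConn_apply _ u v k

theorem slabForm_symm {F : Fin 3 → Fin 3 → slabRing T} (hF : ∀ i j, F i j = F j i) (p : E × ℝ)
    (u v : E) : slabForm F p u v = slabForm F p v u := by
  rw [slabForm_apply, slabForm_apply, Finset.sum_comm]
  exact Finset.sum_congr rfl fun i _ => Finset.sum_congr rfl fun j _ => by rw [hF i j]; ring

theorem slabForm_metric_pos (hg : SmoothMetricFamily g (Iio T)) {t : ℝ} (ht : t < T) (x : E)
    {v : E} (hv : v ≠ 0) : 0 < slabForm (fun i j => slabMetric hg i j) (x, t) v v := by
  have h := (hg.2 x t ht).2.dotProduct_mulVec_pos hv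
  rw [slabForm_apply]
  refine h.trans_eq ?_
  simp only [star_trivial, dotProduct, Matrix.mulVec, Finset.mul_sum]
  refine Finset.sum_congr rfl fun i _ => Finset.sum_congr rfl fun j _ => ?_
  rw [slabEval_slabMetric hg i j (p := (x, t)) ht]
  ring

theorem slabEval_mul_inv (hg : SmoothMetricFamily g (Iio T)) (p : E × ℝ) :
    (Matrix.of fun i j => slabEval p (slabMetric hg i j)) *
      (Matrix.of fun i j => slabEval p ((slabMetric hg)⁻¹ i j)) = 1 := by
  ext i j
  have h := congrArg (slabEval p) (congrFun (congrFun (slab_leviCivita hg).mul_inv i) j)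
  simp only [Matrix.mul_apply, map_sum, map_mul] at h
  rw [Matrix.mul_apply]
  refine h.trans ?_
  rw [Matrix.one_apply, Matrix.one_apply]
  split_ifs <;> simp

/-- Tracing over an orthonormal frame is tracing with the inverse metric. -/
theorem sum_frame_slabForm (hg : SmoothMetricFamily g (Iio T)) {p : E × ℝ} {e : Fin 3 → E}
    (he : ∀ i j, slabForm (fun i j => slabMetric hg i j) p (e i) (e j) = if i = j then 1 else 0)
    (F : Fin 3 → Fin 3 → ℝ) :
    ∑ i, coordForm F (e i) (e i) = ∑ a, ∑ b, slabEval p ((slabMetric hg)⁻¹ a b) * F a b :=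
  sum_frame_form (slabEval_mul_inv hg p) he F

theorem slabConn_torsion (hg : SmoothMetricFamily g (Iio T)) (t : ℝ) (x u v : E) :
    slabConn hg t x u v = slabConn hg t x v u := by
  ext k
  rw [slabConn_apply, slabConn_apply, Finset.sum_comm]
  exact Finset.sum_congr rfl fun i _ => Finset.sum_congr rfl fun j _ => by
    rw [(slab_leviCivita hg).torsion k j i]; ring

theorem fderiv_slabForm (F : Fin 3 → Fin 3 → slabRing T) {t : ℝ} (ht : t < T) (x u a b : E) :
    fderiv ℝ (fun x => slabForm F (x, t)) x u a b =
      ∑ i, ∑ j, (∑ k, u k * slabEval (x, t) (slabD T k (F i j))) * a i * b j := by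
  rw [← coordForm_apply]
  exact congrArg (fun L => L a b) (fderiv_coordForm F ht x u)

theorem fderiv_slabConn (hg : SmoothMetricFamily g (Iio T)) {t : ℝ} (ht : t < T) (x u a b : E)
    (m : Fin 3) : fderiv ℝ (slabConn hg t) x u a b m =
      ∑ i, ∑ j, (∑ k, u k * slabEval (x, t) (slabD T k (slabGam hg m i j))) * a i * b j := by
  refine Eq.trans ?_ (coordConn_apply
    (fun m i j => ∑ k, u k * slabEval (x, t) (slabD T k (slabGam hg m i j))) a b m)
  exact congrArg (fun L => L a b m) (fderiv_coordConn (slabGam hg) ht x u)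

theorem slabForm_conn_left (hg : SmoothMetricFamily g (Iio T)) (F : Fin 3 → Fin 3 → slabRing T)
    (t : ℝ) (x u a b : E) : slabForm F (x, t) (slabConn hg t x u a) b =
      ∑ i, ∑ j, (∑ k, u k * ∑ m, slabEval (x, t) (slabGam hg m k i) * slabEval (x, t) (F m j))
        * a i * b j := by
  simp only [slabForm_apply, slabConn_apply, Fin.sum_univ_three]
  ring

theorem slabForm_conn_right (hg : SmoothMetricFamily g (Iio T)) (F : Fin 3 → Fin 3 → slabRing T)
    (t : ℝ) (x u a b : E) : slabForm F (x, t) a (slabConn hg t x u b) =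
      ∑ i, ∑ j, (∑ k, u k * ∑ m, slabEval (x, t) (slabGam hg m k j) * slabEval (x, t) (F i m))
        * a i * b j := by
  simp only [slabForm_apply, slabConn_apply, Fin.sum_univ_three]
  ring

/-- The covariant derivative of a form, in coordinates. -/
theorem fderiv_slabForm_eq (hg : SmoothMetricFamily g (Iio T)) (F : Fin 3 → Fin 3 → slabRing T)
    {t : ℝ} (ht : t < T) (x u a b : E) :
    fderiv ℝ (fun x => slabForm F (x, t)) x u a b =
      (∑ i, ∑ j, (∑ k, u k * slabEval (x, t) (nab2 (slabD T) (slabGam hg) F k i j)) * a i * b j) +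
      slabForm F (x, t) (slabConn hg t x u a) b + slabForm F (x, t) a (slabConn hg t x u b) := by
  rw [fderiv_slabForm F ht, slabForm_conn_left, slabForm_conn_right, ← Finset.sum_add_distrib,
    ← Finset.sum_add_distrib]
  refine Finset.sum_congr rfl fun i _ => ?_
  rw [← Finset.sum_add_distrib, ← Finset.sum_add_distrib]
  refine Finset.sum_congr rfl fun j _ => ?_
  rw [← add_mul, ← add_mul, ← add_mul, ← add_mul, ← Finset.sum_add_distrib,
    ← Finset.sum_add_distrib]
  congr 2
  refine Finset.sum_congr rfl fun k _ => ?_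
  rw [← mul_add, ← mul_add, nab2, map_sub, map_sum]
  simp only [map_add, map_mul, Finset.sum_add_distrib]
  ring

theorem jacobiOp_slabConn (hg : SmoothMetricFamily g (Iio T)) {t : ℝ} (ht : t < T) (x v w : E)
    (m : Fin 3) : jacobiOp (slabConn hg t) x v w m =
      ∑ i, ∑ k, (∑ j, w j * slabEval (x, t) (aRm (slabD T) (slabGam hg) m i j k)) * v i * v k := by
  have h1 : slabConn hg t x v (slabConn hg t x v w) m = ∑ i, ∑ k, (∑ j, w j * ∑ p,
      slabEval (x, t) (slabGam hg m i p) * slabEval (x, t) (slabGam hg p j k)) * v i * v k := by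
    rw [slabConn_torsion hg t x v w]
    simp only [slabConn_apply, Fin.sum_univ_three]
    ring
  have h2 : slabConn hg t x (slabConn hg t x v v) w m = ∑ i, ∑ k, (∑ j, w j * ∑ p,
      slabEval (x, t) (slabGam hg m j p) * slabEval (x, t) (slabGam hg p i k)) * v i * v k := by
    rw [slabConn_torsion hg t x _ w]
    simp only [slabConn_apply, Fin.sum_univ_three]
    ring
  have h3 : fderiv ℝ (slabConn hg t) x v v w m = ∑ i, ∑ k, (∑ j, w j *
      slabEval (x, t) (slabD T i (slabGam hg m j k))) * v i * v k := by
    rw [fderiv_slabConn hg ht]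
    simp only [Fin.sum_univ_three, (slab_leviCivita hg).torsion m 1 0,
      (slab_leviCivita hg).torsion m 2 0, (slab_leviCivita hg).torsion m 2 1]
    ring
  have h4 : fderiv ℝ (slabConn hg t) x w v v m = ∑ i, ∑ k, (∑ j, w j *
      slabEval (x, t) (slabD T j (slabGam hg m i k))) * v i * v k := fderiv_slabConn hg ht ..
  rw [jacobiOp, Pi.sub_apply, Pi.add_apply, Pi.sub_apply, h1, h2, h3, h4]
  simp only [← Finset.sum_sub_distrib, ← Finset.sum_add_distrib, ← sub_mul, ← add_mul, ← mul_sub,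
    ← mul_add]
  refine Finset.sum_congr rfl fun i _ => Finset.sum_congr rfl fun k _ => ?_
  congr 2
  refine Finset.sum_congr rfl fun j _ => ?_
  rw [aRm]
  simp only [map_sub, map_add, map_sum, map_mul, Finset.sum_sub_distrib]
  ring

theorem sum_contract_comm (G : Fin 3 → Fin 3 → ℝ) (R : Fin 3 → Fin 3 → Fin 3 → Fin 3 → ℝ)
    (w v : E) :
    ∑ l, ∑ m, G l m * w l * (∑ i, ∑ k, (∑ j, w j * R m i j k) * v i * v k) =
      ∑ i, ∑ k, (∑ l, ∑ j, w l * w j * ∑ m, G l m * R m i j k) * v i * v k := by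
  simp only [Finset.mul_sum, Finset.sum_mul]
  simp only [Fin.sum_univ_three]
  ring

theorem sum_jacobiOp_slabConn (hg : SmoothMetricFamily g (Iio T)) {t : ℝ} (ht : t < T) (x : E)
    {e : Fin 3 → E}
    (he : ∀ i j, slabForm (fun i j => slabMetric hg i j) (x, t) (e i) (e j) = if i = j then 1 else 0) (w : E) :
    ∑ i, slabForm (fun i j => slabMetric hg i j) (x, t) w (jacobiOp (slabConn hg t) x (e i) w) =
      -slabForm (aRic (slabD T) (slabGam hg)) (x, t) w w := by
  have h := slab_leviCivita hg
  have h1 : ∀ v, slabForm (fun i j => slabMetric hg i j) (x, t) w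
      (jacobiOp (slabConn hg t) x v w) = coordForm (fun i k => ∑ l, ∑ j, w l * w j *
        slabEval (x, t) (aRd (slabD T) (slabMetric hg) (slabGam hg) i j k l)) v v := fun v => by
    rw [slabForm_apply, coordForm_apply]
    simp only [jacobiOp_slabConn hg ht, aRd, map_sum, map_mul]
    exact sum_contract_comm _ _ w v
  simp only [h1]
  rw [sum_frame_slabForm hg he, slabForm_apply, ← Finset.sum_neg_distrib]
  have h2 : ∀ j l, slabEval (x, t) (aRic (slabD T) (slabGam hg) j l) =
      -∑ a, ∑ b, slabEval (x, t) ((slabMetric hg)⁻¹ a b) * slabEval (x, t)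
        (aRd (slabD T) (slabMetric hg) (slabGam hg) a j b l) := fun j l => by
    have h3 := congrArg (slabEval (x, t)) (h.trace_aRd j l)
    simp only [map_neg, map_sum, map_mul] at h3
    rw [h3, neg_neg]
  simp only [h2, Fin.sum_univ_three]
  ring

end SliceGeometry

section FlowGeometry

open scoped ContDiff

local notation "E" => (Fin 3 → ℝ)

variable {T : ℝ} {g : E → ℝ → Matrix (Fin 3) (Fin 3) ℝ}

theorem sliceGeom_slab (hg : SmoothMetricFamily g (Iio T)) {t : ℝ} (ht : t < T) :
    SliceGeom (Fin 3) (fun x => slabForm (fun i j => slabMetric hg i j) (x, t)) (slabConn hg t)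
      (fun x => slabForm (aRic (slabD T) (slabGam hg)) (x, t)) where
  smooth := contDiff_coordForm _ ht
  smooth_conn := contDiff_coordConn _ ht
  symm y u v := slabForm_symm (slabMetric_symm hg) _ u v
  pos y v hv := slabForm_metric_pos hg ht y hv
  torsion y u v := slabConn_torsion hg t y u v
  compat y u a b := by
    rw [fderiv_slabForm_eq hg _ ht]
    have h : ∀ k i j, nab2 (slabD T) (slabGam hg) (fun i j => slabMetric hg i j) k i j = 0 :=
      fun k i j => (slab_leviCivita hg).nab2_metric k i j
    simp [h]
  ricci y e he w := sum_jacobiOp_slabConn hg ht y he w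

theorem hasDerivAt_slabForm (F : Fin 3 → Fin 3 → slabRing T) (x : E) {t : ℝ} (ht : t < T)
    (u v : E) : HasDerivAt (fun s => slabForm F (x, s) u v)
      (slabForm (fun i j => slabDt T (F i j)) (x, t) u v) t := by
  simp only [slabForm_apply]
  exact HasDerivAt.fun_sum fun i _ => HasDerivAt.fun_sum fun j _ =>
    ((hasDerivAt_slabEval (F i j) x ht).mul_const _).mul_const _

theorem slabForm_dt_metric (hg : SmoothMetricFamily g (Iio T)) (hf : IsRicciFlow g (Iio T))
    (p : E × ℝ) (u v : E) : slabForm (fun i j => slabDt T (slabMetric hg i j)) p u v =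
      -2 * slabForm (aRic (slabD T) (slabGam hg)) p u v := by
  simp only [slabForm_apply, slab_flow hg hf, Finset.mul_sum]
  refine Finset.sum_congr rfl fun i _ => Finset.sum_congr rfl fun j _ => ?_
  have : slabEval p (-2 * aRic (slabD T) (slabGam hg) i j) =
      -2 * slabEval p (aRic (slabD T) (slabGam hg) i j) := by
    rw [map_mul, map_neg, map_ofNat]
  rw [this]
  ring

theorem exists_slabForm_bound (F : Fin 3 → Fin 3 → slabRing T) {t : ℝ} (ht : t < T) (R : ℝ) :
    ∃ C, 0 ≤ C ∧ ∀ y : E, ‖y‖ ≤ R → ∀ s ∈ Icc (t - 1) t, ∀ w,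
      ‖slabForm F (y, s) w w‖ ≤ C * ‖w‖ ^ 2 := by
  have hK : IsCompact (Metric.closedBall (0 : E) R ×ˢ Icc (t - 1) t) :=
    (isCompact_closedBall _ _).prod isCompact_Icc
  have hc : ContinuousOn (slabForm F) (Metric.closedBall (0 : E) R ×ˢ Icc (t - 1) t) :=
    (continuousOn_coordForm F).mono fun p hp => ⟨mem_univ _, hp.2.2.trans_lt ht⟩
  have hcn : ContinuousOn (fun p => ‖slabForm F p‖) (Metric.closedBall (0 : E) R ×ˢ Icc (t - 1) t) :=
    (@continuous_norm (E →L[ℝ] E →L[ℝ] ℝ) _).comp_continuousOn hc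
  obtain ⟨C, hC⟩ := hK.bddAbove_image hcn
  refine ⟨max C 0, le_max_right _ _, fun y hy s hs w => ?_⟩
  have h := hC (mem_image_of_mem _ (show (y, s) ∈ Metric.closedBall (0 : E) R ×ˢ Icc (t - 1) t from
    ⟨by simpa using hy, hs⟩))
  calc ‖slabForm F (y, s) w w‖ ≤ ‖slabForm F (y, s)‖ * ‖w‖ * ‖w‖ :=
        ContinuousLinearMap.le_opNorm₂ _ _ _
    _ ≤ max C 0 * ‖w‖ * ‖w‖ := by gcongr; exact h.trans (le_max_left _ _)
    _ = _ := by ring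

theorem exists_slabForm_taylor (F : Fin 3 → Fin 3 → slabRing T) {t : ℝ} (ht : t < T) (R : ℝ) :
    ∃ C, 0 ≤ C ∧ ∀ y : E, ‖y‖ ≤ R → ∀ τ ∈ Icc (0 : ℝ) 1, ∀ w,
      slabForm F (y, t - τ) w w ≤ slabForm F (y, t) w w
        - τ * slabForm (fun i j => slabDt T (F i j)) (y, t) w w + C * τ ^ 2 * ‖w‖ ^ 2 := by
  obtain ⟨C, hC0, hC⟩ :=
    exists_slabForm_bound (fun i j => slabDt T (slabDt T (F i j))) ht R
  refine ⟨C, hC0, fun y hy τ hτ w => ?_⟩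
  have hsub : ∀ s ∈ Icc (t - τ) t, s ∈ Icc (t - 1) t := fun s hs => ⟨by linarith [hs.1, hτ.2], hs.2⟩
  have h1 : ∀ s ∈ Icc (t - τ) t, ‖slabForm (fun i j => slabDt T (F i j)) (y, s) w w -
      slabForm (fun i j => slabDt T (F i j)) (y, t) w w‖ ≤ C * ‖w‖ ^ 2 * τ := fun s hs => by
    refine ((convex_Icc (t - τ) t).norm_image_sub_le_of_norm_hasDerivWithin_le
      (fun r hr => (hasDerivAt_slabForm (fun i j => slabDt T (F i j)) y (hr.2.trans_lt ht)
        w w).hasDerivWithinAt) (fun r hr => hC y hy r (hsub r hr) w)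
      (right_mem_Icc.2 (by linarith [hτ.1])) hs).trans ?_
    gcongr
    rw [Real.norm_eq_abs, abs_le]
    constructor <;> linarith [hs.1, hs.2, hτ.1]
  have h2 := (convex_Icc (t - τ) t).norm_image_sub_le_of_norm_hasDerivWithin_le
    (f := fun s => slabForm F (y, s) w w - s * slabForm (fun i j => slabDt T (F i j)) (y, t) w w)
    (fun r hr => ((hasDerivAt_slabForm F y (hr.2.trans_lt ht) w w).sub
      ((hasDerivAt_id r).mul_const _)).hasDerivWithinAt)
    (fun r hr => by simpa only [one_mul] using h1 r hr)
    (right_mem_Icc.2 (by linarith [hτ.1])) (left_mem_Icc.2 (by linarith [hτ.1]))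
  have h3 : ‖t - τ - t‖ = τ := by
    rw [Real.norm_eq_abs, abs_sub_comm, abs_of_nonneg] <;> linarith [hτ.1]
  rw [h3] at h2
  have h4 := (le_abs_self _).trans h2
  linarith

theorem intervalIntegral_congr_Ioo {f f' : ℝ → ℝ} (h : ∀ s ∈ Ioo (0 : ℝ) 1, f s = f' s) :
    ∫ s in (0 : ℝ)..1, f s = ∫ s in (0 : ℝ)..1, f' s := by
  rw [intervalIntegral.integral_of_le zero_le_one, intervalIntegral.integral_of_le zero_le_one,
    integral_Ioc_eq_integral_Ioo, integral_Ioc_eq_integral_Ioo]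
  exact setIntegral_congr_fun measurableSet_Ioo h

theorem slabForm_metric_apply (hg : SmoothMetricFamily g (Iio T)) {t : ℝ} (ht : t < T)
    (x u v : E) : slabForm (fun i j => slabMetric hg i j) (x, t) u v =
      ∑ i, ∑ j, g x t i j * u i * v j := by
  simp only [slabForm_apply, slabEval_slabMetric hg _ _ (p := (x, t)) ht]

theorem IsC1Path.contDiffOn {γ w : ℝ → E} (h : IsC1Path γ w) : ContDiffOn ℝ 1 γ (Icc 0 1) := by
  rw [contDiffOn_one_iff_derivWithin (uniqueDiffOn_Icc zero_lt_one)]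
  exact ⟨fun s hs => (h.deriv s hs).differentiableWithinAt, h.cont.congr fun s hs =>
    (h.deriv s hs).derivWithin (uniqueDiffOn_Icc zero_lt_one s hs)⟩

theorem isC1Path_derivWithin {γ : ℝ → E} (h : ContDiffOn ℝ 1 γ (Icc 0 1)) :
    IsC1Path γ (derivWithin γ (Icc 0 1)) where
  cont := h.continuousOn_derivWithin (uniqueDiffOn_Icc zero_lt_one) le_rfl
  deriv s hs := (h.differentiableOn one_ne_zero s hs).hasDerivWithinAt

theorem IsC1Path.pathLength_eq (hg : SmoothMetricFamily g (Iio T)) {t : ℝ} (ht : t < T)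
    {γ w : ℝ → E} (h : IsC1Path γ w) : pathLength (fun y => g y t) γ =
      ∫ s in (0 : ℝ)..1, √(slabForm (fun i j => slabMetric hg i j) (γ s, t) (w s) (w s)) := by
  refine intervalIntegral_congr_Ioo fun s hs => ?_
  rw [((h.deriv s (Ioo_subset_Icc_self hs)).hasDerivAt (Icc_mem_nhds hs.1 hs.2)).deriv,
    slabForm_metric_apply hg ht]

theorem riemDist_eq_gDist (hg : SmoothMetricFamily g (Iio T)) {t : ℝ} (ht : t < T) (x y : E) :
    riemDist (fun y => g y t) x y =
      gDist (fun x => slabForm (fun i j => slabMetric hg i j) (x, t)) x y := by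
  refine congrArg sInf (Set.ext fun L => ⟨?_, ?_⟩)
  · rintro ⟨γ, hγ, h0, h1, rfl⟩
    exact ⟨γ, _, isC1Path_derivWithin hγ, h0, h1,
      (isC1Path_derivWithin hγ).pathLength_eq hg ht⟩
  · rintro ⟨γ, w, hγ, h0, h1, rfl⟩
    exact ⟨γ, hγ.contDiffOn, h0, h1, (hγ.pathLength_eq hg ht).symm⟩

/-- A complete ancient Ricci flow on `ℝ³` provides the geometric package. -/
theorem flowGeom_slab (hg : SmoothMetricFamily g (Iio T)) (hf : IsRicciFlow g (Iio T))
    (hc : ∀ t ∈ Iio T, riemComplete fun y => g y t) :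
    FlowGeom T (slabForm fun i j => slabMetric hg i j) (slabConn hg)
      (fun t x => slabForm (aRic (slabD T) (slabGam hg)) (x, t)) where
  cont := continuousOn_coordForm _
  slice t ht := sliceGeom_slab hg ht
  bdd t ht x₀ r := by
    refine bddBall_of_complete (sliceGeom_slab hg ht).smooth.continuous
      (sliceGeom_slab hg ht).pos (fun u hu => ?_) x₀ r
    have h := hc t ht u
    simp only [riemDist_eq_gDist hg ht] at h
    exact h hu
  flow t ht x v := (hasDerivAt_slabForm _ x ht v v).congr_deriv (slabForm_dt_metric hg hf _ v v)
  taylor t ht R := by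
    obtain ⟨C, hC, h⟩ := exists_slabForm_taylor (fun i j => slabMetric hg i j) ht R
    refine ⟨C, hC, fun y hy τ hτ w => (h y hy τ hτ w).trans_eq ?_⟩
    rw [slabForm_dt_metric hg hf]
    ring
  cont_ric := continuousOn_coordForm _

end FlowGeometry

section PinchingForm

variable {A : Type*} [CommRing A] [Algebra ℝ A]

/-- The scalar curvature over a ring with derivations. -/
def aSc (D : Fin 3 → Derivation ℝ A A) (gi : Matrix (Fin 3) (Fin 3) A)
    (Γ : Fin 3 → Fin 3 → Fin 3 → A) : A :=
  ∑ p, ∑ q, gi p q * aRic D Γ p q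

/-- The symmetric form `c R g - d Ric`. -/
def aPinch (D : Fin 3 → Derivation ℝ A A) (g gi : Matrix (Fin 3) (Fin 3) A)
    (Γ : Fin 3 → Fin 3 → Fin 3 → A) (c d : ℝ) (i j : Fin 3) : A :=
  c • (aSc D gi Γ * g i j) - d • aRic D Γ i j

namespace LeviCivita

variable {D : Fin 3 → Derivation ℝ A A} {g gi : Matrix (Fin 3) (Fin 3) A}
  {Γ : Fin 3 → Fin 3 → Fin 3 → A}

theorem nab2_aPinch (h : LeviCivita D g gi Γ) (c d : ℝ) (a i j : Fin 3) :
    nab2 D Γ (aPinch D g gi Γ c d) a i j =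
      c • (D a (aSc D gi Γ) * g i j) - d • nab2 D Γ (aRic D Γ) a i j := by
  simp only [nab2, aPinch, map_sub, Derivation.map_smul, Derivation.leibniz, h.compat,
    Fin.sum_univ_three]
  simp only [smul_eq_mul]
  simp only [Algebra.smul_def]
  ring

theorem nab3_aPinch (h : LeviCivita D g gi Γ) (c d : ℝ) (b a i j : Fin 3) :
    nab3 D Γ (nab2 D Γ (aPinch D g gi Γ c d)) b a i j =
      c • (nab1 D Γ (fun k => D k (aSc D gi Γ)) b a * g i j)
        - d • nab3 D Γ (nab2 D Γ (aRic D Γ)) b a i j := by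
  simp only [nab3, h.nab2_aPinch, nab1, map_sub, Derivation.map_smul, Derivation.leibniz,
    h.compat, Fin.sum_univ_three]
  simp only [smul_eq_mul]
  simp only [Algebra.smul_def]
  ring

theorem flow_aPinch {Dt : Derivation ℝ A A} (h : LeviCivita D g gi Γ)
    (hc : ∀ i a, Dt (D i a) = D i (Dt a))
    (hf : ∀ i j, Dt (g i j) = -2 * aRic D Γ i j) (c d : ℝ) (j k : Fin 3) :
    Dt (aPinch D g gi Γ c d j k) =
      ∑ i, ∑ l, gi i l * nab3 D Γ (nab2 D Γ (aPinch D g gi Γ c d)) i l j k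
      + c • (2 * (∑ j, ∑ k, ∑ p, ∑ q, gi j p * gi k q * aRic D Γ j k * aRic D Γ p q) * g j k
        - 2 * aSc D gi Γ * aRic D Γ j k)
      - d • (ricReaction gi (aRic D Γ) (aRd D g Γ) j k
        + ricReaction gi (aRic D Γ) (aRd D g Γ) k j) := by
  have hs := h.flow_scalar hc hf
  have hr := h.flow_ricci hc hf j k
  have e1 : ∑ i, ∑ l, gi i l * nab3 D Γ (nab2 D Γ (aPinch D g gi Γ c d)) i l j k =
      c • ((∑ i, ∑ l, gi i l * nab1 D Γ (fun k => D k (aSc D gi Γ)) i l) * g j k)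
      - d • ∑ i, ∑ l, gi i l * nab3 D Γ (nab2 D Γ (aRic D Γ)) i l j k := by
    simp only [h.nab3_aPinch, Finset.sum_mul, Finset.smul_sum, ← Finset.sum_sub_distrib]
    refine Finset.sum_congr rfl fun i _ => Finset.sum_congr rfl fun l _ => ?_
    simp only [Algebra.smul_def]
    ring
  rw [e1, aPinch, map_sub, Derivation.map_smul, Derivation.map_smul,
    Derivation.leibniz, hf, hr, aSc, hs]
  simp only [smul_eq_mul]
  simp only [Algebra.smul_def]
  ring

end LeviCivita

end PinchingForm

section SlabTensors

local notation "E" => (Fin 3 → ℝ)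

variable {T : ℝ} {g : E → ℝ → Matrix (Fin 3) (Fin 3) ℝ}

/-- The covariant derivative of a form on the slab, contracted with three vectors. -/
def slabNab2 (hg : SmoothMetricFamily g (Iio T)) (F : Fin 3 → Fin 3 → slabRing T) (t : ℝ)
    (x w u v : E) : ℝ :=
  ∑ a, ∑ i, ∑ j, slabEval (x, t) (nab2 (slabD T) (slabGam hg) F a i j) * w a * u i * v j

/-- The second covariant derivative of a form on the slab, contracted with four vectors. -/
def slabNab3 (hg : SmoothMetricFamily g (Iio T)) (F : Fin 3 → Fin 3 → slabRing T) (t : ℝ)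
    (x z w u v : E) : ℝ :=
  ∑ b, ∑ a, ∑ i, ∑ j, slabEval (x, t)
    (nab3 (slabD T) (slabGam hg) (nab2 (slabD T) (slabGam hg) F) b a i j) * z b * w a * u i * v j

theorem hasDerivAt_slabEval_comp (f : slabRing T) {t : ℝ} (ht : t < T) {c : ℝ → E} {c' : E}
    {h : ℝ} (hc : HasDerivAt c c' h) : HasDerivAt (fun h => slabEval (c h, t) f)
      (∑ b, c' b * slabEval (c h, t) (slabD T b f)) h := by
  have h1 := ((contDiff_slabEval_slice f ht).differentiable (by simp) (c h)).hasFDerivAt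
  exact (h1.comp_hasDerivAt h hc).congr_deriv (fderiv_slabEval_slice f ht _ _)

theorem isCovDeriv_form (hg : SmoothMetricFamily g (Iio T)) (F : Fin 3 → Fin 3 → slabRing T)
    {t : ℝ} (ht : t < T) {c u v : ℝ → E} {c' u' v' : E} {h : ℝ} (hc : HasDerivAt c c' h)
    (hu : HasDerivAt u u' h) (hv : HasDerivAt v v' h) :
    HasDerivAt (fun h => slabForm F (c h, t) (u h) (v h))
      (slabNab2 hg F t (c h) c' (u h) (v h)
        + slabForm F (c h, t) (u' + slabConn hg t (c h) c' (u h)) (v h)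
        + slabForm F (c h, t) (u h) (v' + slabConn hg t (c h) c' (v h))) h := by
  have h0 : HasFDerivAt (fun x => slabForm F (x, t)) _ (c h) :=
    ((contDiff_coordForm F ht).differentiable (by simp) (c h)).hasFDerivAt
  have h1 := ((h0.comp_hasDerivAt h hc).clm_apply hu).clm_apply hv
  refine h1.congr_deriv ?_
  have h2 := fderiv_slabForm_eq hg F ht (c h) c' (u h) (v h)
  have h3 : slabNab2 hg F t (c h) c' (u h) (v h) = ∑ i, ∑ j, (∑ k, c' k *
      slabEval (c h, t) (nab2 (slabD T) (slabGam hg) F k i j)) * u h i * v h j := by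
    simp only [slabNab2, Fin.sum_univ_three]
    ring
  rw [h3, map_add, _root_.add_apply, map_add, Function.comp_apply, _root_.add_apply]
  refine (congrArg (fun r => r + slabForm F (c h, t) u' (v h)
    + slabForm F (c h, t) (u h) v') h2).trans ?_
  ring

theorem contract_conn_left (G R : Fin 3 → Fin 3 → Fin 3 → ℝ) (z w u v : E) :
    ∑ m, ∑ i, ∑ j, R m i j * (∑ b, ∑ a, G m b a * z b * w a) * u i * v j =
      ∑ b, ∑ a, ∑ i, ∑ j, (∑ m, G m b a * R m i j) * z b * w a * u i * v j := by
  simp only [Fin.sum_univ_three]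
  ring

theorem contract_conn_middle (G R : Fin 3 → Fin 3 → Fin 3 → ℝ) (z w u v : E) :
    ∑ a, ∑ m, ∑ j, R a m j * w a * (∑ b, ∑ i, G m b i * z b * u i) * v j =
      ∑ b, ∑ a, ∑ i, ∑ j, (∑ m, G m b i * R a m j) * z b * w a * u i * v j := by
  simp only [Fin.sum_univ_three]
  ring

theorem contract_conn_right (G R : Fin 3 → Fin 3 → Fin 3 → ℝ) (z w u v : E) :
    ∑ a, ∑ i, ∑ m, R a i m * w a * u i * (∑ b, ∑ j, G m b j * z b * v j) =
      ∑ b, ∑ a, ∑ i, ∑ j, (∑ m, G m b j * R a i m) * z b * w a * u i * v j := by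
  simp only [Fin.sum_univ_three]
  ring

theorem slabNab3_eq (hg : SmoothMetricFamily g (Iio T)) (F : Fin 3 → Fin 3 → slabRing T) (t : ℝ)
    (x z w u v : E) : slabNab3 hg F t x z w u v =
      ∑ b, ∑ a, ∑ i, ∑ j, slabEval (x, t) (slabD T b (nab2 (slabD T) (slabGam hg) F a i j))
        * z b * w a * u i * v j
      - slabNab2 hg F t x (slabConn hg t x z w) u v
      - slabNab2 hg F t x w (slabConn hg t x z u) v
      - slabNab2 hg F t x w u (slabConn hg t x z v) := by
  simp only [slabNab2, slabConn_apply]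
  rw [contract_conn_left, contract_conn_middle, contract_conn_right]
  simp only [slabNab3, ← Finset.sum_sub_distrib]
  refine Finset.sum_congr rfl fun b _ => Finset.sum_congr rfl fun a _ =>
    Finset.sum_congr rfl fun i _ => Finset.sum_congr rfl fun j _ => ?_
  rw [nab3, map_sub, map_sum]
  simp only [map_add, map_mul, Finset.sum_add_distrib]
  ring

theorem slabNab2_add_left (hg : SmoothMetricFamily g (Iio T)) (F : Fin 3 → Fin 3 → slabRing T)
    (t : ℝ) (x w w' u v : E) :
    slabNab2 hg F t x (w + w') u v = slabNab2 hg F t x w u v + slabNab2 hg F t x w' u v := by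
  simp only [slabNab2, Pi.add_apply, mul_add, add_mul, Finset.sum_add_distrib]

theorem slabNab2_add_middle (hg : SmoothMetricFamily g (Iio T)) (F : Fin 3 → Fin 3 → slabRing T)
    (t : ℝ) (x w u u' v : E) :
    slabNab2 hg F t x w (u + u') v = slabNab2 hg F t x w u v + slabNab2 hg F t x w u' v := by
  simp only [slabNab2, Pi.add_apply, mul_add, add_mul, Finset.sum_add_distrib]

theorem slabNab2_add_right (hg : SmoothMetricFamily g (Iio T)) (F : Fin 3 → Fin 3 → slabRing T)
    (t : ℝ) (x w u v v' : E) :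
    slabNab2 hg F t x w u (v + v') = slabNab2 hg F t x w u v + slabNab2 hg F t x w u v' := by
  simp only [slabNab2, Pi.add_apply, mul_add, Finset.sum_add_distrib]

theorem isCovDeriv_slab (hg : SmoothMetricFamily g (Iio T)) (F : Fin 3 → Fin 3 → slabRing T)
    {t : ℝ} (ht : t < T) :
    IsCovDeriv (slabConn hg t) (fun x => slabForm F (x, t)) (slabNab2 hg F t)
      (slabNab3 hg F t) where
  form hc hu hv := isCovDeriv_form hg F ht hc hu hv
  deriv {c w u v c' w' u' v' h} hc hw hu hv := by
    have h1 := HasDerivAt.fun_sum (u := Finset.univ) fun a _ =>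
      HasDerivAt.fun_sum (u := Finset.univ) fun i _ =>
      HasDerivAt.fun_sum (u := Finset.univ) fun j _ =>
        (((hasDerivAt_slabEval_comp (nab2 (slabD T) (slabGam hg) F a i j) ht hc).fun_mul
          (hasDerivAt_pi.1 hw a)).fun_mul (hasDerivAt_pi.1 hu i)).fun_mul (hasDerivAt_pi.1 hv j)
    refine h1.congr_deriv ?_
    have h2 : ∑ b, ∑ a, ∑ i, ∑ j, slabEval (c h, t) (slabD T b
        (nab2 (slabD T) (slabGam hg) F a i j)) * c' b * w h a * u h i * v h j =
        ∑ a, ∑ i, ∑ j, (∑ b, c' b * slabEval (c h, t) (slabD T b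
          (nab2 (slabD T) (slabGam hg) F a i j))) * w h a * u h i * v h j := by
      rw [Finset.sum_comm]
      refine Finset.sum_congr rfl fun a _ => ?_
      rw [Finset.sum_comm]
      refine Finset.sum_congr rfl fun i _ => ?_
      rw [Finset.sum_comm]
      refine Finset.sum_congr rfl fun j _ => ?_
      simp only [Finset.sum_mul]
      exact Finset.sum_congr rfl fun b _ => by ring
    rw [slabNab3_eq, slabNab2_add_left, slabNab2_add_middle, slabNab2_add_right, h2]
    simp only [add_mul, Finset.sum_add_distrib]
    simp only [slabNab2]
    ring
  zero_left x u v := by simp [slabNab2]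
  zero_middle x w v := by simp [slabNab2]
  zero_right x w u := by simp [slabNab2]

/-- Tracing the second covariant derivative over an orthonormal frame. -/
theorem sum_frame_slabNab3 (hg : SmoothMetricFamily g (Iio T)) (F : Fin 3 → Fin 3 → slabRing T)
    {t : ℝ} {x : E} {e : Fin 3 → E}
    (he : ∀ i j, slabForm (fun i j => slabMetric hg i j) (x, t) (e i) (e j) =
      if i = j then 1 else 0) (v : E) :
    ∑ i, slabNab3 hg F t x (e i) (e i) v v =
      slabForm (fun j k => ∑ i, ∑ l, (slabMetric hg)⁻¹ i l *
        nab3 (slabD T) (slabGam hg) (nab2 (slabD T) (slabGam hg) F) i l j k) (x, t) v v := by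
  have h1 : ∀ w, slabNab3 hg F t x w w v v = coordForm (fun b a => ∑ i, ∑ j, slabEval (x, t)
      (nab3 (slabD T) (slabGam hg) (nab2 (slabD T) (slabGam hg) F) b a i j) * v i * v j) w w :=
    fun w => by
      simp only [slabNab3, coordForm_apply, Finset.sum_mul]
      refine Finset.sum_congr rfl fun b _ => Finset.sum_congr rfl fun a _ =>
        Finset.sum_congr rfl fun i _ => Finset.sum_congr rfl fun j _ => by ring
  simp only [h1]
  rw [sum_frame_slabForm hg he, slabForm_apply]
  simp only [map_sum, map_mul, Finset.mul_sum, Finset.sum_mul]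
  simp only [Fin.sum_univ_three]
  ring

end SlabTensors

section Frames

local notation "E" => (Fin 3 → ℝ)

variable {M : Fin 3 → Fin 3 → ℝ} {Mi : Matrix (Fin 3) (Fin 3) ℝ} {e : Fin 3 → Fin 3 → ℝ}

theorem sum_frame_expand (hM : Matrix.of M * Mi = 1)
    (he : ∀ i j, coordForm M (e i) (e j) = if i = j then 1 else 0) (v : E) :
    ∑ i, coordForm M v (e i) • e i = v := by
  ext b
  have h : ∀ c, ∑ d, M c d * Mi d b = if c = b then 1 else 0 := fun c => by
    have := congrFun (congrFun hM c) b
    rwa [Matrix.mul_apply, Matrix.one_apply] at this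
  have h1 : (∑ i, coordForm M v (e i) • e i) b = ∑ c, v c * ∑ d, M c d * ∑ i, e i d * e i b := by
    simp only [Finset.sum_apply, Pi.smul_apply, smul_eq_mul, coordForm_apply, Fin.sum_univ_three]
    ring
  simp only [h1, sum_frame_mul hM he, h]
  simp

theorem coordForm_frame_sum (F : Fin 3 → Fin 3 → ℝ) (e : Fin 3 → E) (a b : Fin 3 → ℝ) :
    coordForm F (∑ i, a i • e i) (∑ i, b i • e i) =
      ∑ i, ∑ j, coordForm F (e i) (e j) * a i * b j := by
  simp only [Fin.sum_univ_three, map_add, map_smul, _root_.add_apply, _root_.smul_apply,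
    smul_eq_mul]
  ring

theorem coordForm_orthonormal_sum
    (he : ∀ i j, coordForm M (e i) (e j) = if i = j then 1 else 0) (a b : Fin 3 → ℝ) :
    coordForm M (∑ i, a i • e i) (∑ i, b i • e i) = ∑ i, a i * b i := by
  rw [coordForm_frame_sum]
  simp [he]

theorem exists_frame_extension (hM : Matrix.of M * Mi = 1)
    (he : ∀ i j, coordForm M (e i) (e j) = if i = j then 1 else 0) {v : E}
    (hv : coordForm M v v = 1) :
    ∃ f : Fin 3 → E, (∀ i j, coordForm M (f i) (f j) = if i = j then 1 else 0) ∧ f 2 = v := by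
  set a : EuclideanSpace ℝ (Fin 3) := WithLp.toLp 2 fun i => coordForm M v (e i) with ha
  have hva : ∑ i, a i • e i = v := sum_frame_expand hM he v
  have ha1 : ∑ i, a i * a i = 1 := by
    rw [← coordForm_orthonormal_sum he, hva, hv]
  have hon : Orthonormal ℝ (({2} : Set (Fin 3)).domRestrict fun _ => a) := by
    refine ⟨fun _ => ?_, fun i j hij => absurd (Subsingleton.elim i j) hij⟩
    have : ‖a‖ ^ 2 = 1 := by
      rw [EuclideanSpace.real_norm_sq_eq, ← ha1]
      exact Finset.sum_congr rfl fun i _ => sq _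
    exact (pow_eq_one_iff_of_nonneg (norm_nonneg a) two_ne_zero).1 this
  obtain ⟨b, hb⟩ := hon.exists_orthonormalBasis_extension_of_card_eq (by simp)
  refine ⟨fun i => ∑ j, b i j • e j, fun i j => ?_, ?_⟩
  · rw [coordForm_orthonormal_sum he, ← orthonormal_iff_ite.1 b.orthonormal i j,
      PiLp.inner_apply]
    exact Finset.sum_congr rfl fun k _ => by simp [mul_comm]
  · simp only [hb 2 rfl, hva]

theorem sum_frame_mul_form (hM : Matrix.of M * Mi = 1)
    (he : ∀ i j, coordForm M (e i) (e j) = if i = j then 1 else 0) (F G : Fin 3 → Fin 3 → ℝ) :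
    ∑ a, ∑ b, coordForm F (e a) (e b) * coordForm G (e a) (e b) =
      ∑ i, ∑ l, Mi i l * ∑ m, ∑ p, Mi m p * (F l m * G i p) := by
  have h1 : ∀ u : E, ∑ b, coordForm F u (e b) * coordForm G u (e b) =
      coordForm (fun i l => ∑ m, ∑ p, Mi m p * (F l m * G i p)) u u := fun u => by
    have h2 : ∀ w : E, coordForm F u w * coordForm G u w =
        coordForm (fun m p => (∑ l, F l m * u l) * ∑ i, G i p * u i) w w := fun w => by
      simp only [coordForm_apply, Fin.sum_univ_three]
      ring
    simp only [h2]
    rw [sum_frame_form hM he]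
    simp only [coordForm_apply, Fin.sum_univ_three]
    ring
  simp only [h1]
  exact sum_frame_form hM he _

/-- A covariant four-tensor evaluated on four vectors. -/
def form4 (Rm : Fin 3 → Fin 3 → Fin 3 → Fin 3 → ℝ) (u v w z : E) : ℝ :=
  ∑ i, ∑ j, ∑ k, ∑ l, Rm i j k l * u i * v j * w k * z l

variable {Rm : Fin 3 → Fin 3 → Fin 3 → Fin 3 → ℝ}

theorem form4_antisymm (h : ∀ i j k l, Rm j i k l = -Rm i j k l) (u v w z : E) :
    form4 Rm v u w z = -form4 Rm u v w z := by
  rw [form4, Finset.sum_comm, form4]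
  simp only [← Finset.sum_neg_distrib]
  refine Finset.sum_congr rfl fun i _ => Finset.sum_congr rfl fun j _ =>
    Finset.sum_congr rfl fun k _ => Finset.sum_congr rfl fun l _ => ?_
  rw [h i j k l]
  ring

theorem form4_antisymm' (h : ∀ i j k l, Rm i j l k = -Rm i j k l) (u v w z : E) :
    form4 Rm u v z w = -form4 Rm u v w z := by
  simp only [form4, ← Finset.sum_neg_distrib]
  refine Finset.sum_congr rfl fun i _ => Finset.sum_congr rfl fun j _ => ?_
  rw [Finset.sum_comm]
  refine Finset.sum_congr rfl fun k _ => Finset.sum_congr rfl fun l _ => ?_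
  rw [h i j k l]
  ring

theorem form4_eq_coordForm (u v w z : E) :
    form4 Rm u v w z = coordForm (fun i l => ∑ j, ∑ k, Rm i j k l * v j * w k) u z := by
  simp only [form4, coordForm_apply, Fin.sum_univ_three]
  ring

theorem form4_pair (h : ∀ i j k l, Rm k l i j = Rm i j k l) (u v w z : E) :
    form4 Rm w z u v = form4 Rm u v w z := by
  have h1 : form4 Rm w z u v = form4 (fun i j k l => Rm k l i j) u v w z := by
    simp only [form4, Fin.sum_univ_three]
    ring
  rw [h1]
  simp only [h]

theorem sum_frame_form4 (hM : Matrix.of M * Mi = 1)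
    (he : ∀ i j, coordForm M (e i) (e j) = if i = j then 1 else 0) {R : Fin 3 → Fin 3 → ℝ}
    (hR : ∀ j k, R j k = ∑ i, ∑ l, Mi i l * Rm i j k l) (u v : E) :
    coordForm R u v = ∑ a, form4 Rm (e a) u v (e a) := by
  simp only [form4_eq_coordForm]
  rw [sum_frame_form hM he]
  simp only [coordForm_apply, hR, Fin.sum_univ_three]
  ring

theorem coordForm_ricReaction (hM : Matrix.of M * Mi = 1)
    (he : ∀ i j, coordForm M (e i) (e j) = if i = j then 1 else 0) {R : Fin 3 → Fin 3 → ℝ}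
    (hs : ∀ i j, R i j = R j i) (v : E) :
    coordForm (ricReaction Mi R Rm) v v =
      ∑ a, ∑ b, coordForm R (e a) (e b) * form4 Rm (e a) v v (e b)
        - ∑ a, coordForm R v (e a) ^ 2 := by
  simp only [form4_eq_coordForm]
  rw [sum_frame_mul_form hM he]
  have h1 : ∀ w : E, coordForm R v w ^ 2 =
      coordForm (fun m p => (∑ k, R m k * v k) * ∑ j, R j p * v j) w w := fun w => by
    simp only [coordForm_apply, Fin.sum_univ_three, hs 1 0, hs 2 0, hs 2 1]
    ring
  simp only [h1]
  rw [sum_frame_form hM he]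
  simp only [coordForm_apply, ricReaction, Fin.sum_univ_three]
  ring

end Frames

/-- The reaction inequality in an orthonormal frame whose last vector is a top eigenvector of
the Ricci tensor. -/
theorem pinching_algebra {k p q b x y s : ℝ} (hk : 2 ≤ k) (hp : p = x + y)
    (hq : q = x * y - b ^ 2) (hb : b ^ 2 ≤ (x - s) * (y - s))
    (hneg : p + k * s < 0) (hprev : 0 ≤ p + (k - 1) * s) :
    (2 * (p + k * s)) ^ 2 / 2 ≤ 4 * (p ^ 2 + (k - 2) * q + k * s ^ 2 + p * s) := by
  have hs : s < 0 := by linarith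
  have h1 : s * p - s ^ 2 ≤ q := by rw [hq, hp]; linarith
  have h2 : (k - 2) * (s * p - s ^ 2) ≤ (k - 2) * q :=
    mul_le_mul_of_nonneg_left h1 (by linarith)
  have hp0 : 0 ≤ p := by nlinarith
  have h3 : 0 ≤ p * (p + (k - 1) * s) := mul_nonneg hp0 hprev
  have h4 : (p + k * s) ^ 2 ≤ s ^ 2 := by
    have : s ≤ p + k * s := by linarith
    nlinarith
  nlinarith [sq_nonneg s]

/-- The reaction term of `k R g - 2 (k - 1) Ric` in an orthonormal frame. -/
theorem pinching_reaction {rm : Fin 3 → Fin 3 → Fin 3 → Fin 3 → ℝ} {r : Fin 3 → Fin 3 → ℝ}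
    (h1 : ∀ i j k l, rm j i k l = -rm i j k l) (h2 : ∀ i j k l, rm i j l k = -rm i j k l)
    (h3 : ∀ i j k l, rm k l i j = rm i j k l) (hr : ∀ j k, r j k = ∑ a, rm a j k a) {k S : ℝ}
    (hk : k = 1 ∨ 2 ≤ k ∧ 0 ≤ (k - 1) * S - 2 * (k - 2) * r 2 2) (hS : S = ∑ a, r a a)
    (hneg : k * S - 2 * (k - 1) * r 2 2 < 0)
    (hmin : ∀ w : Fin 3 → ℝ, (k - 1) * ∑ i, ∑ j, r i j * w i * w j ≤
      (k - 1) * (r 2 2 * ∑ i, w i * w i)) :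
    (k * S - 2 * (k - 1) * r 2 2) ^ 2 / 2 ≤
      k * (2 * (∑ a, ∑ b, r a b ^ 2) - 2 * S * r 2 2)
        - 4 * (k - 1) * (∑ a, ∑ b, r a b * rm a 2 2 b - ∑ a, r 2 a ^ 2)
        + 2 * (k * S - 2 * (k - 1) * r 2 2) * r 2 2 := by
  have z1 : ∀ i k l, rm i i k l = 0 := fun i k l => by linarith [h1 i i k l]
  have z2 : ∀ i j k, rm i j k k = 0 := fun i j k => by linarith [h2 i j k k]
  have rs : ∀ j k, r j k = r k j := fun j k => by
    rw [hr, hr]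
    exact Finset.sum_congr rfl fun a _ => by linarith [h3 k a a j, h1 a k a j, h2 a k a j]
  have r22 : r 2 2 = rm 0 2 2 0 + rm 1 2 2 1 := by
    rw [hr, Fin.sum_univ_three, z1]; ring
  have r00 : r 0 0 = rm 0 1 1 0 + rm 0 2 2 0 := by
    rw [hr, Fin.sum_univ_three, z1, h1 0 1, h2 0 1 1 0, h1 0 2, h2 0 2 2 0]; ring
  have r11 : r 1 1 = rm 0 1 1 0 + rm 1 2 2 1 := by
    rw [hr, Fin.sum_univ_three, z1, h1 1 2, h2 1 2 2 1]; ring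
  have r01 : r 0 1 = rm 0 2 2 1 := by
    rw [hr, Fin.sum_univ_three, z1, z2, h1 0 2, h2 0 2 2 1]; ring
  have e10 : rm 1 2 2 0 = rm 0 2 2 1 := by
    rw [h3 2 0 1 2, h1 0 2, h2 0 2 2 1]; ring
  rcases hk with rfl | ⟨hk, hprev⟩
  · simp only [Fin.sum_univ_three] at hS ⊢
    rw [hS]
    nlinarith [sq_nonneg (r 0 0 - r 1 1), sq_nonneg (r 0 0 - r 2 2), sq_nonneg (r 1 1 - r 2 2),
      sq_nonneg (r 0 1), sq_nonneg (r 0 2), sq_nonneg (r 1 0), sq_nonneg (r 1 2),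
      sq_nonneg (r 2 0), sq_nonneg (r 2 1), sq_nonneg (r 0 0 + r 1 1 + r 2 2)]
  · have hm : ∀ w : Fin 3 → ℝ, ∑ i, ∑ j, r i j * w i * w j ≤ r 2 2 * ∑ i, w i * w i :=
      fun w => le_of_mul_le_mul_left (hmin w) (by linarith)
    simp only [Fin.sum_univ_three, rs 1 0, rs 2 0, rs 2 1] at hm
    have d02 := discrim_le_zero (a := r 2 2 - r 0 0) (b := -2 * r 0 2) (c := 0) fun x => by
      have := hm ![x, 0, 1]
      simp at this
      linarith
    have d12 := discrim_le_zero (a := r 2 2 - r 1 1) (b := -2 * r 1 2) (c := 0) fun x => by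
      have := hm ![0, x, 1]
      simp at this
      linarith
    have d01 := discrim_le_zero (a := r 2 2 - r 0 0) (b := -2 * r 0 1) (c := r 2 2 - r 1 1)
      fun x => by
        have := hm ![x, 1, 0]
        simp at this
        linarith
    rw [discrim] at d02 d12 d01
    have r02 : r 0 2 = 0 := by nlinarith
    have r12 : r 1 2 = 0 := by nlinarith
    simp only [Fin.sum_univ_three, rs 1 0, rs 2 0, rs 2 1, r02, r12, r00, r11, r22, r01,
      e10] at *
    subst hS
    have key := pinching_algebra (k := k) (p := rm 0 2 2 0 + rm 1 2 2 1)
      (q := rm 0 2 2 0 * rm 1 2 2 1 - rm 0 2 2 1 ^ 2) (b := rm 0 2 2 1) (x := rm 0 2 2 0)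
      (y := rm 1 2 2 1) (s := rm 0 1 1 0) hk rfl rfl (by linarith) (by linarith) (by linarith)
    rw [z1 2 2 2]
    convert key using 1 <;> ring

section Pinching

local notation "E" => (Fin 3 → ℝ)

variable {T : ℝ} {g : E → ℝ → Matrix (Fin 3) (Fin 3) ℝ}

theorem slabForm_aPinch (hg : SmoothMetricFamily g (Iio T)) (c d : ℝ) (p : E × ℝ) (u v : E) :
    slabForm (aPinch (slabD T) (slabMetric hg) (slabMetric hg)⁻¹ (slabGam hg) c d) p u v =
      c * (slabEval p (aSc (slabD T) (slabMetric hg)⁻¹ (slabGam hg)) *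
        slabForm (fun i j => slabMetric hg i j) p u v)
      - d * slabForm (aRic (slabD T) (slabGam hg)) p u v := by
  simp only [slabForm_apply, aPinch, map_sub, map_smul, map_mul, smul_eq_mul,
    Fin.sum_univ_three]
  ring

/-- The curvature tensor at a space-time point, on four vectors. -/
def slabCurv (hg : SmoothMetricFamily g (Iio T)) (p : E × ℝ) (u v w z : E) : ℝ :=
  form4 (fun i j k l => slabEval p (aRd (slabD T) (slabMetric hg) (slabGam hg) i j k l)) u v w z

theorem slabForm_dt_aPinch (hg : SmoothMetricFamily g (Iio T)) (hf : IsRicciFlow g (Iio T))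
    (c d t : ℝ) (x v : E) {e : Fin 3 → E}
    (he : ∀ i j, slabForm (fun i j => slabMetric hg i j) (x, t) (e i) (e j) =
      if i = j then 1 else 0) :
    slabForm (fun i j => slabDt T (aPinch (slabD T) (slabMetric hg) (slabMetric hg)⁻¹
        (slabGam hg) c d i j)) (x, t) v v =
      ∑ i, slabNab3 hg (aPinch (slabD T) (slabMetric hg) (slabMetric hg)⁻¹ (slabGam hg) c d) t x
        (e i) (e i) v v
      + c * (2 * (∑ a, ∑ b, slabForm (aRic (slabD T) (slabGam hg)) (x, t) (e a) (e b) ^ 2) *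
          slabForm (fun i j => slabMetric hg i j) (x, t) v v
        - 2 * slabEval (x, t) (aSc (slabD T) (slabMetric hg)⁻¹ (slabGam hg)) *
          slabForm (aRic (slabD T) (slabGam hg)) (x, t) v v)
      - 2 * d * (∑ a, ∑ b, slabForm (aRic (slabD T) (slabGam hg)) (x, t) (e a) (e b) *
          slabCurv hg (x, t) (e a) v v (e b)
        - ∑ a, slabForm (aRic (slabD T) (slabGam hg)) (x, t) v (e a) ^ 2) := by
  have hL := slab_leviCivita hg
  have hM := slabEval_mul_inv hg (x, t)
  have hr := coordForm_ricReaction (Rm := fun i j k l => slabEval (x, t)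
    (aRd (slabD T) (slabMetric hg) (slabGam hg) i j k l)) hM he
    (R := fun i j => slabEval (x, t) (aRic (slabD T) (slabGam hg) i j))
    (fun i j => by rw [hL.aRic_symm]) v
  have hn : ∑ a, ∑ b, slabForm (aRic (slabD T) (slabGam hg)) (x, t) (e a) (e b) ^ 2 =
      slabEval (x, t) (∑ j, ∑ k, ∑ p, ∑ q, (slabMetric hg)⁻¹ j p * (slabMetric hg)⁻¹ k q *
        aRic (slabD T) (slabGam hg) j k * aRic (slabD T) (slabGam hg) p q) := by
    have h1 := sum_frame_mul_form hM he
      (fun i j => slabEval (x, t) (aRic (slabD T) (slabGam hg) i j))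
      (fun i j => slabEval (x, t) (aRic (slabD T) (slabGam hg) i j))
    simp only [← sq] at h1
    refine h1.trans ?_
    simp only [map_sum, map_mul, Matrix.of_apply]
    simp only [Fin.sum_univ_three, hL.symm_inv 1 0, hL.symm_inv 2 0, hL.symm_inv 2 1]
    ring
  rw [sum_frame_slabNab3 hg _ he, hn]
  have hr' : slabForm (ricReaction (slabMetric hg)⁻¹ (aRic (slabD T) (slabGam hg))
      (aRd (slabD T) (slabMetric hg) (slabGam hg))) (x, t) v v =
      ∑ a, ∑ b, slabForm (aRic (slabD T) (slabGam hg)) (x, t) (e a) (e b) *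
          slabCurv hg (x, t) (e a) v v (e b)
        - ∑ a, slabForm (aRic (slabD T) (slabGam hg)) (x, t) v (e a) ^ 2 := by
    refine Eq.trans ?_ hr
    simp only [slabForm_apply, coordForm_apply, ricReaction, map_sub, map_sum, map_mul,
      Matrix.of_apply]
  rw [← hr']
  simp only [hL.flow_aPinch (fun i a => slabDeriv_comm _ _ a) (slab_flow hg hf) c d]
  simp only [slabForm_apply, map_add, map_sub, map_smul, map_mul, smul_eq_mul,
    map_ofNat, Fin.sum_univ_three (M := ℝ)]
  ring

theorem slabCurv_antisymm (hg : SmoothMetricFamily g (Iio T)) (p : E × ℝ) (u v w z : E) :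
    slabCurv hg p v u w z = -slabCurv hg p u v w z :=
  form4_antisymm (fun i j k l => by rw [LeviCivita.aRd_antisymm, map_neg]) u v w z

theorem slabCurv_antisymm' (hg : SmoothMetricFamily g (Iio T)) (p : E × ℝ) (u v w z : E) :
    slabCurv hg p u v z w = -slabCurv hg p u v w z :=
  form4_antisymm' (fun i j k l => by rw [(slab_leviCivita hg).aRd_antisymm', map_neg]) u v w z

theorem slabCurv_pair (hg : SmoothMetricFamily g (Iio T)) (p : E × ℝ) (u v w z : E) :
    slabCurv hg p w z u v = slabCurv hg p u v w z :=
  form4_pair (fun i j k l => by rw [(slab_leviCivita hg).aRd_pair]) u v w z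

theorem slabForm_aRic_eq_sum (hg : SmoothMetricFamily g (Iio T)) {p : E × ℝ} {e : Fin 3 → E}
    (he : ∀ i j, slabForm (fun i j => slabMetric hg i j) p (e i) (e j) = if i = j then 1 else 0)
    (u v : E) : slabForm (aRic (slabD T) (slabGam hg)) p u v =
      ∑ a, slabCurv hg p (e a) u v (e a) :=
  sum_frame_form4 (slabEval_mul_inv hg p) he (fun j k => by
    rw [(slab_leviCivita hg).aRic_eq]
    simp only [map_sum, map_mul, Matrix.of_apply]) u v

theorem slabEval_aSc_eq_sum (hg : SmoothMetricFamily g (Iio T)) {p : E × ℝ} {e : Fin 3 → E}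
    (he : ∀ i j, slabForm (fun i j => slabMetric hg i j) p (e i) (e j) = if i = j then 1 else 0) :
    slabEval p (aSc (slabD T) (slabMetric hg)⁻¹ (slabGam hg)) =
      ∑ a, slabForm (aRic (slabD T) (slabGam hg)) p (e a) (e a) := by
  rw [aSc]
  simp only [map_sum, map_mul]
  exact (sum_frame_slabForm hg he _).symm

theorem reactionForm_aPinch (hg : SmoothMetricFamily g (Iio T)) (hf : IsRicciFlow g (Iio T))
    {k : ℝ} (hk : k = 1 ∨ 2 ≤ k ∧ ∀ x, ∀ t < T, ∀ v, 0 ≤ slabForm (aPinch (slabD T)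
      (slabMetric hg) (slabMetric hg)⁻¹ (slabGam hg) (k - 1) (2 * (k - 2))) (x, t) v v) :
    ReactionForm T (slabForm fun i j => slabMetric hg i j) (slabConn hg)
      (fun t x => slabForm (aRic (slabD T) (slabGam hg)) (x, t))
      (slabForm (aPinch (slabD T) (slabMetric hg) (slabMetric hg)⁻¹ (slabGam hg)
        k (2 * (k - 1))))
      (slabNab2 hg (aPinch (slabD T) (slabMetric hg) (slabMetric hg)⁻¹ (slabGam hg)
        k (2 * (k - 1))))
      (slabNab3 hg (aPinch (slabD T) (slabMetric hg) (slabMetric hg)⁻¹ (slabGam hg)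
        k (2 * (k - 1))))
      (fun t x v => slabForm (fun i j => slabDt T (aPinch (slabD T) (slabMetric hg)
        (slabMetric hg)⁻¹ (slabGam hg) k (2 * (k - 1)) i j)) (x, t) v v) where
  cont := continuousOn_coordForm _
  cov t ht := isCovDeriv_slab hg _ ht
  time t ht x v := hasDerivAt_slabForm _ x ht v v
  reaction t ht x e he v hv hneg hmin := by
    obtain ⟨f, hfr, rfl⟩ := exists_frame_extension (slabEval_mul_inv hg (x, t)) he hv
    have hfr' : ∀ i j, slabForm (fun i j => slabMetric hg i j) (x, t) (f i) (f j) =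
      if i = j then 1 else 0 := hfr
    have hq : ∀ F, ∑ i, slabNab3 hg F t x (e i) (e i) (f 2) (f 2) =
        ∑ i, slabNab3 hg F t x (f i) (f i) (f 2) (f 2) := fun F => by
      rw [sum_frame_slabNab3 hg _ he, sum_frame_slabNab3 hg _ hfr']
    rw [hq, slabForm_dt_aPinch hg hf _ _ t x _ hfr']
    simp only [slabForm_aPinch, hv] at hneg hmin hk ⊢
    have key := pinching_reaction (rm := fun a b c d => slabCurv hg (x, t) (f a) (f b) (f c) (f d))
      (r := fun a b => slabForm (aRic (slabD T) (slabGam hg)) (x, t) (f a) (f b)) (k := k)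
      (fun _ _ _ _ => slabCurv_antisymm hg _ _ _ _ _)
      (fun _ _ _ _ => slabCurv_antisymm' hg _ _ _ _ _)
      (fun _ _ _ _ => slabCurv_pair hg _ _ _ _ _)
      (fun _ _ => slabForm_aRic_eq_sum hg hfr' _ _)
      (S := slabEval (x, t) (aSc (slabD T) (slabMetric hg)⁻¹ (slabGam hg)))
      (hk.imp_right fun h => ⟨h.1, by linarith [hv ▸ h.2 x t ht (f 2)]⟩)
      (slabEval_aSc_eq_sum hg hfr') (by linarith) (fun w => by
        have h1 := hmin (∑ i, w i • f i)
        have h2 : slabForm (fun i j => slabMetric hg i j) (x, t) (∑ i, w i • f i)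
          (∑ i, w i • f i) = ∑ i, w i * w i := coordForm_orthonormal_sum hfr w w
        have h3 : slabForm (aRic (slabD T) (slabGam hg)) (x, t) (∑ i, w i • f i)
          (∑ i, w i • f i) = _ := coordForm_frame_sum _ f w w
        rw [h2, h3] at h1
        simp only [slabForm] at h1 ⊢
        linarith)
    refine Eq.trans_le ?_ (key.trans_eq ?_)
    · ring
    · ring

/-- Nonnegativity of the pinching forms along an ancient solution. -/
theorem aPinch_nonneg (hg : SmoothMetricFamily g (Iio T)) (hf : IsRicciFlow g (Iio T))
    (hc : ∀ t ∈ Iio T, riemComplete fun y => g y t) (m : ℕ) : ∀ x, ∀ t < T, ∀ v,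
      0 ≤ slabForm (aPinch (slabD T) (slabMetric hg) (slabMetric hg)⁻¹ (slabGam hg)
        (m + 1) (2 * m)) (x, t) v v := by
  have hF := flowGeom_slab hg hf hc
  induction m with
  | zero =>
    intro x t ht v
    have h := hF.form_nonneg (reactionForm_aPinch hg hf (Or.inl rfl)) x ht v
    simpa using h
  | succ m ih =>
    intro x t ht v
    have h := hF.form_nonneg (reactionForm_aPinch hg hf (k := m + 2)
      (Or.inr ⟨by linarith [(Nat.cast_nonneg m : (0 : ℝ) ≤ m)], fun x t ht v => by
        rw [show (m + 2 - 1 : ℝ) = m + 1 by ring, add_sub_cancel_right]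
        exact ih x t ht v⟩)) x ht v
    rwa [show (m + 2 : ℝ) = (m + 1 : ℕ) + 1 by push_cast; ring, add_sub_cancel_right] at h

theorem ric_le_half_scalar (hg : SmoothMetricFamily g (Iio T)) (hf : IsRicciFlow g (Iio T))
    (hc : ∀ t ∈ Iio T, riemComplete fun y => g y t) (x : E) {t : ℝ} (ht : t < T) (v : E) :
    2 * slabForm (aRic (slabD T) (slabGam hg)) (x, t) v v ≤
      slabEval (x, t) (aSc (slabD T) (slabMetric hg)⁻¹ (slabGam hg)) *
        slabForm (fun i j => slabMetric hg i j) (x, t) v v := by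
  set a := slabForm (aRic (slabD T) (slabGam hg)) (x, t) v v
  set b := slabEval (x, t) (aSc (slabD T) (slabMetric hg)⁻¹ (slabGam hg)) *
    slabForm (fun i j => slabMetric hg i j) (x, t) v v
  have h : ∀ m : ℕ, m * (2 * a - b) ≤ b := fun m => by
    have := aPinch_nonneg hg hf hc m x t ht v
    rw [slabForm_aPinch] at this
    linarith
  by_contra! hlt
  obtain ⟨m, hm⟩ := exists_nat_gt (b / (2 * a - b))
  rw [div_lt_iff₀ (by linarith)] at hm
  linarith [h m]

theorem exists_unit_orthogonal (hg : SmoothMetricFamily g (Iio T)) {t : ℝ} (ht : t < T)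
    (x u v : E) : ∃ w, slabForm (fun i j => slabMetric hg i j) (x, t) w w = 1 ∧
      slabForm (fun i j => slabMetric hg i j) (x, t) u w = 0 ∧
      slabForm (fun i j => slabMetric hg i j) (x, t) v w = 0 := by
  set G := slabForm (fun i j => slabMetric hg i j) (x, t)
  let L : E →ₗ[ℝ] ℝ × ℝ := (G u).toLinearMap.prod (G v).toLinearMap
  have hL : LinearMap.ker L ≠ ⊥ := L.ker_ne_bot_of_finrank_lt (by simp)
  obtain ⟨w, hw, hw0⟩ := (Submodule.ne_bot_iff _).1 hL
  have hp : 0 < G w w := slabForm_metric_pos hg ht x hw0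
  have h1 : G u w = 0 := congrArg Prod.fst (LinearMap.mem_ker.1 hw)
  have h2 : G v w = 0 := congrArg Prod.snd (LinearMap.mem_ker.1 hw)
  refine ⟨(1 / √(G w w)) • w, ?_, by simp [h1], by simp [h2]⟩
  have h3 := Real.mul_self_sqrt hp.le
  have h4 := (Real.sqrt_pos.2 hp).ne'
  simp only [map_smul, _root_.smul_apply, smul_eq_mul]
  field_simp
  linarith

theorem form4_add_smul {Rm : Fin 3 → Fin 3 → Fin 3 → Fin 3 → ℝ}
    (h1 : ∀ u v w z, form4 Rm v u w z = -form4 Rm u v w z)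
    (h2 : ∀ u v w z, form4 Rm u v z w = -form4 Rm u v w z) (p q : E) (a b c d : ℝ) :
    form4 Rm (a • p + b • q) (c • p + d • q) (c • p + d • q) (a • p + b • q) =
      (a * d - b * c) ^ 2 * form4 Rm p q q p := by
  have e1 : ∀ (a b : ℝ) (p q v w z : E), form4 Rm (a • p + b • q) v w z =
      a * form4 Rm p v w z + b * form4 Rm q v w z := fun a b p q v w z => by
    simp only [form4, Pi.add_apply, Pi.smul_apply, smul_eq_mul, Fin.sum_univ_three]; ring
  have z1 : ∀ u w z, form4 Rm u u w z = 0 := fun u w z => by linarith [h1 u u w z]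
  have z2 : ∀ u v w, form4 Rm u v w w = 0 := fun u v w => by linarith [h2 u v w w]
  have e2 : ∀ (a b : ℝ) (p q v w z : E), form4 Rm v (a • p + b • q) w z =
      a * form4 Rm v p w z + b * form4 Rm v q w z := fun a b p q v w z => by
    rw [h1, e1, h1 v p, h1 v q]; ring
  have e3 : ∀ (a b : ℝ) (p q v w z : E), form4 Rm v w (a • p + b • q) z =
      a * form4 Rm v w p z + b * form4 Rm v w q z := fun a b p q v w z => by
    simp only [form4, Pi.add_apply, Pi.smul_apply, smul_eq_mul, Fin.sum_univ_three]; ring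
  have e4 : ∀ (a b : ℝ) (p q v w z : E), form4 Rm v w z (a • p + b • q) =
      a * form4 Rm v w z p + b * form4 Rm v w z q := fun a b p q v w z => by
    rw [h2, e3, h2 v w z p, h2 v w z q]; ring
  simp only [e1, e2, e3, e4, z1, z2]
  rw [h1 p q p q, h1 p q q p, h2 p q q p]
  ring

theorem slabCurv_nonneg (hg : SmoothMetricFamily g (Iio T)) (hf : IsRicciFlow g (Iio T))
    (hc : ∀ t ∈ Iio T, riemComplete fun y => g y t) (x : E) {t : ℝ} (ht : t < T) (u v : E) :
    0 ≤ slabCurv hg (x, t) u v v u := by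
  obtain ⟨w, hw, huw, hvw⟩ := exists_unit_orthogonal hg ht x u v
  obtain ⟨e, he⟩ := exists_orthonormal_form (G := slabForm (fun i j => slabMetric hg i j) (x, t))
    (fun u v => slabForm_symm (fun i j => slabMetric_symm hg i j) (x, t) u v)
    (fun v hv => slabForm_metric_pos hg ht x hv)
  obtain ⟨f, hfr, rfl⟩ := exists_frame_extension (slabEval_mul_inv hg (x, t)) he hw
  have hfr' : ∀ i j, slabForm (fun i j => slabMetric hg i j) (x, t) (f i) (f j) =
    if i = j then 1 else 0 := hfr
  have hex : ∀ u, slabForm (fun i j => slabMetric hg i j) (x, t) u (f 2) = 0 →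
      ∃ a b : ℝ, u = a • f 0 + b • f 1 := fun u hu => by
    have h : ∑ i, slabForm (fun i j => slabMetric hg i j) (x, t) u (f i) • f i = u :=
      sum_frame_expand (slabEval_mul_inv hg (x, t)) hfr u
    rw [Fin.sum_univ_three, hu, zero_smul, add_zero] at h
    exact ⟨_, _, h.symm⟩
  obtain ⟨a, b, rfl⟩ := hex u huw
  obtain ⟨c, d, rfl⟩ := hex v hvw
  have h1 := slabCurv_antisymm hg (x, t)
  have h2 := slabCurv_antisymm' hg (x, t)
  rw [slabCurv, form4_add_smul h1 h2]
  refine mul_nonneg (sq_nonneg _) ?_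
  change 0 ≤ slabCurv hg (x, t) (f 0) (f 1) (f 1) (f 0)
  have hle := ric_le_half_scalar hg hf hc x ht (f 2)
  rw [hw, slabEval_aSc_eq_sum hg hfr'] at hle
  simp only [slabForm_aRic_eq_sum hg hfr', Fin.sum_univ_three] at hle
  have z : ∀ u w z, slabCurv hg (x, t) u u w z = 0 := fun u w z => by linarith [h1 u u w z]
  rw [z, z, z, h1 (f 0) (f 1), h2 (f 0) (f 1) (f 1) (f 0), h1 (f 0) (f 2),
    h2 (f 0) (f 2) (f 2) (f 0), h1 (f 1) (f 2), h2 (f 1) (f 2) (f 2) (f 1)] at hle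
  linarith

theorem slabForm_metric_cauchySchwarz (hg : SmoothMetricFamily g (Iio T)) {t : ℝ} (ht : t < T)
    (x u v : E) : slabForm (fun i j => slabMetric hg i j) (x, t) u v ^ 2 ≤
      slabForm (fun i j => slabMetric hg i j) (x, t) u u *
        slabForm (fun i j => slabMetric hg i j) (x, t) v v := by
  set G := slabForm (fun i j => slabMetric hg i j) (x, t)
  have hs : G v u = G u v := slabForm_symm (fun i j => slabMetric_symm hg i j) (x, t) v u
  have hp : ∀ w, 0 ≤ G w w := fun w => by
    rcases eq_or_ne w 0 with rfl | hw
    · simp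
    · exact (slabForm_metric_pos hg ht x hw).le
  have h := discrim_le_zero (a := G u u) (b := 2 * G u v) (c := G v v) fun s => by
    have h1 := hp (s • u + v)
    simp only [map_add, map_smul, _root_.add_apply, _root_.smul_apply, smul_eq_mul, hs] at h1
    linarith
  rw [discrim] at h
  linarith

end Pinching

/-- Any complete ancient solution to the Ricci flow on ℝ³ has nonnegative
sectional curvature (Corollary 2.4). -/
theorem stmt_6 (T : ℝ)
    (g : (Fin 3 → ℝ) → ℝ → Matrix (Fin 3) (Fin 3) ℝ)
    (hg : SmoothMetricFamily g (Iio T)) (hflow : IsRicciFlow g (Iio T))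
    (hcomplete : ∀ t ∈ Iio T, riemComplete (fun x => g x t)) :
    ∀ x : Fin 3 → ℝ, ∀ t ∈ Iio T, ∀ u v : Fin 3 → ℝ, LinearIndependent ℝ ![u, v] →
      0 ≤ sectionalCurv (fun y => g y t) x u v := by
  intro x t ht u v _
  have hcurv := slabCurv_nonneg hg hflow hcomplete x ht u v
  simp only [slabCurv, form4, slabEval_aRd hg _ _ _ _ x ht] at hcurv
  refine div_nonneg hcurv ?_
  have hG := fun u v => slabForm_metric_apply hg ht x u v
  rw [← hG, ← hG, ← hG, sub_nonneg]
  exact slabForm_metric_cauchySchwarz hg ht x u v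

end
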